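/- Let α ∉ {−1,−2,−3,…} be a real number and 𝓕 = (F_1,F_2) a pair of finite sets of positive integers, not both empty, such that α+1 and 𝓕 are admissible. Then for every n ∈ σ_𝓕: ∫_0^∞ (L_n^{α;𝓕}(x))²·x^{α+k}·e^{−x}/(Ω_𝓕^α(x))² dx = 𝒫_𝓕(n−u_𝓕)·Γ(n−u_𝓕+α+1)/(n−u_𝓕)!, where 𝒫_𝓕(t) = ∏_{f∈F_1}(t−f)·∏_{f∈F_2}(t+α+f+1) and Γ is the real Gamma function. -/

import Mathlib

open Finset MeasureTheory Polynomial

/-- Generalized binomial coefficient `C(t, j) = t(t-1)⋯(t-j+1)/j!`. -/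
noncomputable def gbinom (t : ℝ) (j : ℕ) : ℝ :=
  (∏ i ∈ Finset.range j, (t - i)) / (Nat.factorial j)

/-- Pochhammer symbol `(t)_m = t(t+1)⋯(t+m-1)`. -/
noncomputable def poch (t : ℝ) (m : ℕ) : ℝ := ∏ i ∈ Finset.range m, (t + i)

/-- Pochhammer symbol with integer index (Γ-quotient convention for negative index). -/
noncomputable def pochZ (t : ℝ) (m : ℤ) : ℝ :=
  if 0 ≤ m then ∏ i ∈ Finset.range m.toNat, (t + i)
  else (∏ i ∈ Finset.range (-m).toNat, (t - (i + 1)))⁻¹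

/-- `ĉ = max(-⌊c⌋, 0)`. -/
noncomputable def chat (c : ℝ) : ℕ := (-⌊c⌋).toNat

/-- Admissibility of `c` and the pair `𝓕 = (F₁, F₂)`. -/
def IsAdmissible (c : ℝ) (F1 F2 : Finset ℕ) : Prop :=
  ∀ x : ℕ, 0 ≤ (∏ f ∈ F1, ((x : ℝ) - f)) * (∏ f ∈ F2, ((x : ℝ) + c + f)) /
    poch ((x : ℝ) + c) (chat c)

/-- `u_𝓕 = ∑_{f∈F₁} f + ∑_{f∈F₂} f - C(k₁+1, 2) - C(k₂, 2)`. -/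
def uF (F1 F2 : Finset ℕ) : ℕ :=
  (∑ f ∈ F1, f + ∑ f ∈ F2, f) - (Nat.choose (F1.card + 1) 2 + Nat.choose F2.card 2)

/-- `σ_𝓕 = {u_𝓕, u_𝓕+1, …} \ {u_𝓕 + f : f ∈ F₁}`. -/
def sigmaF (F1 F2 : Finset ℕ) : Set ℕ :=
  {n | uF F1 F2 ≤ n ∧ ∀ f ∈ F1, n ≠ uF F1 F2 + f}

/-- The `i`-th element (0-based) of `F` in increasing order. -/
def nth (F : Finset ℕ) (i : ℕ) : ℕ := (F.sort (· ≤ ·)).getD i 0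
/-- The Laguerre polynomial `L_n^α` as a real polynomial. -/
noncomputable def lag (α : ℝ) (n : ℕ) : Polynomial ℝ :=
  ∑ j ∈ Finset.range (n + 1),
    Polynomial.C ((-1 : ℝ) ^ j / (Nat.factorial j : ℝ) * gbinom ((n : ℝ) + α) (n - j)) *
      Polynomial.X ^ j

/-- `j`-th derivative of a real polynomial. -/
noncomputable def iterDeriv (j : ℕ) (p : Polynomial ℝ) : Polynomial ℝ :=
  (fun q => Polynomial.derivative q)^[j] p

/-- The polynomial `L_n^{α;𝓕}` (Wronskian type determinant of Laguerre polynomials). -/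
noncomputable def lagExc (α : ℝ) (F1 F2 : Finset ℕ) (n : ℕ) : Polynomial ℝ :=
  Matrix.det (Matrix.of fun i j : Fin (F1.card + F2.card + 1) =>
    if (i : ℕ) = 0 then iterDeriv (j : ℕ) (lag α (n - uF F1 F2))
    else if (i : ℕ) - 1 < F1.card then iterDeriv (j : ℕ) (lag α (nth F1 ((i : ℕ) - 1)))
    else (lag (α + ((j : ℕ) : ℝ)) (nth F2 ((i : ℕ) - 1 - F1.card))).comp (-Polynomial.X))

/-- The Wronskian type determinant `Ω_𝓕^α` as a real polynomial. -/
noncomputable def OmegaL (α : ℝ) (F1 F2 : Finset ℕ) : Polynomial ℝ :=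
  Matrix.det (Matrix.of fun i j : Fin (F1.card + F2.card) =>
    if (i : ℕ) < F1.card then iterDeriv (j : ℕ) (lag α (nth F1 (i : ℕ)))
    else (lag (α + ((j : ℕ) : ℝ)) (nth F2 ((i : ℕ) - F1.card))).comp (-Polynomial.X))

/-! ### Part A: the Darboux chain in the ring of formal power series -/

/-- formal derivative -/
noncomputable def dd (f : PowerSeries ℝ) : PowerSeries ℝ := PowerSeries.derivative ℝ f

lemma dd_add (f g : PowerSeries ℝ) : dd (f + g) = dd f + dd g := by simp [dd]
lemma dd_sub (f g : PowerSeries ℝ) : dd (f - g) = dd f - dd g := by simp [dd]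
lemma dd_mul (f g : PowerSeries ℝ) : dd (f * g) = f * dd g + dd f * g := by
  simp [dd, mul_comm]
lemma dd_C (r : ℝ) : dd (PowerSeries.C r) = 0 := by simp [dd]
lemma dd_X : dd (PowerSeries.X) = 1 := by simp [dd]
lemma dd_zero : dd 0 = 0 := by simp [dd]
lemma dd_sum {ι : Type*} (s : Finset ι) (f : ι → PowerSeries ℝ) :
    dd (∑ i ∈ s, f i) = ∑ i ∈ s, dd (f i) := by simp [dd]
lemma dd_Cmul (r : ℝ) (f : PowerSeries ℝ) :
    dd (PowerSeries.C r * f) = PowerSeries.C r * dd f := by rw [dd_mul, dd_C]; ring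
lemma dd_Xpow (j : ℕ) : PowerSeries.X * dd ((PowerSeries.X : PowerSeries ℝ) ^ j)
    = PowerSeries.C (j : ℝ) * PowerSeries.X ^ j := by
  induction j with
  | zero => simp [dd]
  | succ j ih =>
    rw [pow_succ, dd_mul, dd_X]
    push_cast
    rw [map_add, map_one]
    linear_combination PowerSeries.X * ih

lemma coeff_dd (f : PowerSeries ℝ) (n : ℕ) :
    PowerSeries.coeff n (dd f) = PowerSeries.coeff (n+1) f * (n + 1) := by
  simp [dd, PowerSeries.coeff_derivative]

lemma dd_coe (p : Polynomial ℝ) : dd (p : PowerSeries ℝ) = (Polynomial.derivative p : Polynomial ℝ) := by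
  simp [dd, PowerSeries.derivative_coe]

/-- The chain of Darboux transforms. -/
noncomputable def Yc (v : ℕ → PowerSeries ℝ) : ℕ → PowerSeries ℝ → PowerSeries ℝ
  | 0, b => b
  | j+1, b => dd (Yc v j b) - dd (Yc v j (v j)) * (Yc v j (v j))⁻¹ * Yc v j b

def IsEig (c : ℝ) (b : PowerSeries ℝ) (μ : ℝ) : Prop :=
  PowerSeries.X * dd (dd b) + (PowerSeries.C c - PowerSeries.X) * dd b + PowerSeries.C μ * b = 0

lemma Yc_rel (v : ℕ → PowerSeries ℝ) (j : ℕ) (b : PowerSeries ℝ)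
    (h : PowerSeries.constantCoeff (Yc v j (v j)) ≠ 0) :
    Yc v j (v j) * Yc v (j+1) b = Yc v j (v j) * dd (Yc v j b) - dd (Yc v j (v j)) * Yc v j b := by
  have h1 := PowerSeries.mul_inv_cancel _ h
  simp only [Yc]
  linear_combination (- dd (Yc v j (v j)) * Yc v j b) * h1

/-- Lagrange identity along the chain -/
lemma chain_L (c : ℝ) (v : ℕ → PowerSeries ℝ) (lam : ℕ → ℝ) (k : ℕ)
    (hv : ∀ j < k, IsEig c (v j) (lam j))
    (hu : ∀ j < k, PowerSeries.constantCoeff (Yc v j (v j)) ≠ 0) :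
    ∀ j ≤ k, ∀ (b e : PowerSeries ℝ) (μ ν : ℝ), IsEig c b μ → IsEig c e ν →
      (PowerSeries.C (c + j) - PowerSeries.X) * (Yc v j b * dd (Yc v j e) - dd (Yc v j b) * Yc v j e)
       + PowerSeries.X * dd (Yc v j b * dd (Yc v j e) - dd (Yc v j b) * Yc v j e)
       = PowerSeries.C (μ - ν) * (Yc v j b * Yc v j e) := by
  intro j
  induction j with
  | zero =>
    intro _ b e μ ν hb he
    simp only [Yc, dd_sub, dd_mul, Nat.cast_zero, add_zero, map_sub]
    unfold IsEig at hb he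
    linear_combination b * he - e * hb
  | succ j ih =>
    intro hj b e μ ν hb he
    have hj' : j < k := hj
    have ih' := ih (le_of_lt hj')
    have hvu := hu j hj'
    have hVb := ih' (v j) b (lam j) μ (hv j hj') hb
    have hVe := ih' (v j) e (lam j) ν (hv j hj') he
    have hb1 := Yc_rel v j b hvu
    have he1 := Yc_rel v j e hvu
    rw [← hb1] at hVb
    rw [← he1] at hVe
    have h1 := PowerSeries.mul_inv_cancel _ hvu
    set V := Yc v j (v j) with hV
    set yb := Yc v j b
    set ye := Yc v j e
    set zb := Yc v (j+1) b
    set ze := Yc v (j+1) e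
    set u := dd V * V⁻¹ with hu'
    have hV0 : V ≠ 0 := by
      intro h0; rw [h0] at hvu; simp at hvu
    have yb' : dd yb = zb + u * yb := by
      apply mul_left_cancel₀ hV0
      linear_combination -hb1 - dd V * yb * h1
    have ye' : dd ye = ze + u * ye := by
      apply mul_left_cancel₀ hV0
      linear_combination -he1 - dd V * ye * h1
    have zb' : PowerSeries.X * dd zb = PowerSeries.C (lam j - μ) * yb
        - (PowerSeries.C (c + j) - PowerSeries.X + PowerSeries.X * u) * zb := by
      apply mul_left_cancel₀ hV0
      rw [dd_mul] at hVb
      linear_combination hVb + PowerSeries.X * dd V * zb * h1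
    have ze' : PowerSeries.X * dd ze = PowerSeries.C (lam j - ν) * ye
        - (PowerSeries.C (c + j) - PowerSeries.X + PowerSeries.X * u) * ze := by
      apply mul_left_cancel₀ hV0
      rw [dd_mul] at hVe
      linear_combination hVe + PowerSeries.X * dd V * ze * h1
    set T := zb * dd ze - dd zb * ze with hT
    have hXT : PowerSeries.X * T = PowerSeries.C (lam j - ν) * (zb * ye)
        - PowerSeries.C (lam j - μ) * (yb * ze) := by
      rw [hT]; linear_combination zb * ze' - ze * zb'
    clear_value T
    have hd := congrArg dd hXT
    rw [dd_mul, dd_X, dd_sub, dd_Cmul, dd_Cmul, dd_mul, dd_mul] at hd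
    apply mul_left_cancel₀ (PowerSeries.X_ne_zero (R := ℝ))
    have e1 : PowerSeries.C (c + ((j+1 : ℕ):ℝ)) = PowerSeries.C (c + (j:ℝ)) + 1 := by
      push_cast; rw [← add_assoc, map_add _ _ (1:ℝ), map_one]
    have e2 : (PowerSeries.C (μ - ν) : PowerSeries ℝ) =
      PowerSeries.C (lam j - ν) - PowerSeries.C (lam j - μ) := by
      rw [← map_sub]; congr 1; ring
    rw [e1, e2]
    linear_combination (PowerSeries.X) * hd + (PowerSeries.C (c + (j:ℝ)) - PowerSeries.X) * hXT
      + PowerSeries.C (lam j - ν) * ye * zb' - PowerSeries.C (lam j - μ) * yb * ze'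
      + PowerSeries.C (lam j - ν) * PowerSeries.X * zb * ye'
      - PowerSeries.C (lam j - μ) * PowerSeries.X * ze * yb'

lemma chain_step (c : ℝ) (v : ℕ → PowerSeries ℝ) (lam : ℕ → ℝ) (k : ℕ)
    (hv : ∀ j < k, IsEig c (v j) (lam j))
    (hu : ∀ j < k, PowerSeries.constantCoeff (Yc v j (v j)) ≠ 0)
    (j : ℕ) (hj : j < k) (b : PowerSeries ℝ) (μ : ℝ) (hb : IsEig c b μ) :
    PowerSeries.X ^ (j+1) * (Yc v (j+1) b)^2
      - PowerSeries.C (μ - lam j) * (PowerSeries.X ^ j * (Yc v j b)^2)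
    = (PowerSeries.C c - PowerSeries.X) * (PowerSeries.X ^ j * (Yc v j b * Yc v (j+1) b))
      + PowerSeries.X * dd (PowerSeries.X ^ j * (Yc v j b * Yc v (j+1) b)) := by
  have hvu := hu j hj
  have hVb := chain_L c v lam k hv hu j hj.le (v j) b (lam j) μ (hv j hj) hb
  have hb1 := Yc_rel v j b hvu
  rw [← hb1] at hVb
  have h1 := PowerSeries.mul_inv_cancel _ hvu
  set V := Yc v j (v j) with hV
  set yb := Yc v j b
  set zb := Yc v (j+1) b
  set u := dd V * V⁻¹ with hu'
  have hV0 : V ≠ 0 := by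
    intro h0; rw [h0] at hvu; simp at hvu
  have yb' : dd yb = zb + u * yb := by
    apply mul_left_cancel₀ hV0
    linear_combination -hb1 - dd V * yb * h1
  have zb' : PowerSeries.X * dd zb = PowerSeries.C (lam j - μ) * yb
      - (PowerSeries.C (c + j) - PowerSeries.X + PowerSeries.X * u) * zb := by
    apply mul_left_cancel₀ hV0
    rw [dd_mul] at hVb
    linear_combination hVb + PowerSeries.X * dd V * zb * h1
  rw [dd_mul, dd_mul]
  have e1 : (PowerSeries.C (c + (j:ℝ)) : PowerSeries ℝ) = PowerSeries.C c + PowerSeries.C (j:ℝ) :=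
    map_add _ _ _
  have e2 : (PowerSeries.C (μ - lam j) : PowerSeries ℝ) = - PowerSeries.C (lam j - μ) := by
    rw [← map_neg]; congr 1; ring
  rw [e1] at zb'
  rw [e2]
  linear_combination (-(yb*zb)) * dd_Xpow j - PowerSeries.X^j * yb * zb'
     - PowerSeries.X^(j+1) * zb * yb'

/-- linear form of the chain operator -/
lemma Yc_linear_form (v : ℕ → PowerSeries ℝ) (j : ℕ) :
    ∃ a : ℕ → PowerSeries ℝ, (∀ b, Yc v j b = dd^[j] b + ∑ i ∈ range j, a i * dd^[i] b) ∧
      (0 < j → a (j-1) = - ∑ i ∈ range j, dd (Yc v i (v i)) * (Yc v i (v i))⁻¹) := by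
  induction j with
  | zero => exact ⟨fun _ => 0, by simp [Yc], by simp⟩
  | succ j ih =>
    obtain ⟨a, ha, hal⟩ := ih
    set w := dd (Yc v j (v j)) * (Yc v j (v j))⁻¹ with hw
    refine ⟨fun i => (if i < j then dd (a i) - w * a i else 0)
        + (if i = 0 then 0 else if i - 1 < j then a (i-1) else 0) - (if i = j then w else 0), ?_, ?_⟩
    · intro b
      have : Yc v (j+1) b = dd (Yc v j b) - w * Yc v j b := rfl
      rw [this, ha b, dd_add, dd_sum]
      simp only [Function.iterate_succ_apply', dd_mul]
      simp only [sub_mul, add_mul, Finset.sum_add_distrib, Finset.sum_sub_distrib]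
      have s1 : ∑ i ∈ range (j+1), (if i < j then dd (a i) - w * a i else 0) * dd^[i] b
          = ∑ i ∈ range j, dd (a i) * dd^[i] b - w * ∑ i ∈ range j, a i * dd^[i] b := by
        rw [Finset.sum_range_succ]
        simp only [lt_irrefl, if_false, zero_mul, add_zero]
        rw [Finset.mul_sum, ← Finset.sum_sub_distrib]
        apply Finset.sum_congr rfl
        intro i hi
        rw [if_pos (Finset.mem_range.mp hi)]; ring
      have s2 : ∑ i ∈ range (j+1), (if i = 0 then 0 else if i - 1 < j then a (i-1) else 0) * dd^[i] b
          = ∑ i ∈ range j, a i * dd (dd^[i] b) := by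
        rw [Finset.sum_range_succ']
        simp only [if_true, zero_mul, add_zero]
        apply Finset.sum_congr rfl
        intro i hi
        have := Finset.mem_range.mp hi
        simp [this, Function.iterate_succ_apply']
      have s3 : ∑ i ∈ range (j+1), (if i = j then w else 0) * dd^[i] b = w * dd^[j] b := by
        rw [Finset.sum_range_succ, Finset.sum_eq_zero]
        · simp
        · intro i hi
          have := (Finset.mem_range.mp hi).ne
          simp [this]
      rw [s1, s2, s3]
      ring
    · intro _
      simp only [Nat.add_sub_cancel, lt_irrefl, if_false, zero_add, if_true]
      rw [Finset.sum_range_succ]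
      rcases Nat.eq_zero_or_pos j with h | h
      · subst h; simp [hw]
      · have h1 : j - 1 < j := by omega
        have h0 : j ≠ 0 := by omega
        simp only [h0, h1, if_true, if_false]
        rw [hal h, ← hw]; ring

lemma Yc_zero_arg (v : ℕ → PowerSeries ℝ) (j i : ℕ) (b : PowerSeries ℝ) (h : Yc v j b = 0)
    (hij : j ≤ i) : Yc v i b = 0 := by
  induction i, hij using Nat.le_induction with
  | base => exact h
  | succ i _ ih => simp [Yc, ih, dd_zero]

lemma Yc_kill (v : ℕ → PowerSeries ℝ) (i j : ℕ) (hij : i < j)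
    (h : PowerSeries.constantCoeff (Yc v i (v i)) ≠ 0) : Yc v j (v i) = 0 := by
  apply Yc_zero_arg v (i+1) j _ _ hij
  have h1 := PowerSeries.mul_inv_cancel _ h
  simp only [Yc]
  linear_combination (- dd (Yc v i (v i))) * h1

/-- column operation -/
lemma det_colop {R : Type*} [CommRing R] (j : ℕ) (M : Matrix (Fin (j+1)) (Fin (j+1)) R) (a : ℕ → R) :
    M.det = ∑ i : Fin (j+1), (-1)^((i:ℕ) + j) *
      (M i (Fin.last j) + ∑ t : Fin j, a t * M i t.castSucc) *
        (M.submatrix i.succAbove Fin.castSucc).det := by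
  have key : M.det = (M.updateCol (Fin.last j)
      (fun i => M i (Fin.last j) + ∑ t : Fin j, a t * M i t.castSucc)).det := by
    have e : (fun i => M i (Fin.last j) + ∑ t : Fin j, a t * M i t.castSucc)
       = (fun i => M i (Fin.last j)) + ∑ t : Fin j, a t • (fun i => M i t.castSucc) := by
      ext i; simp
    rw [e, Matrix.det_updateCol_add]
    have h1 : M.updateCol (Fin.last j) (fun i => M i (Fin.last j)) = M :=
      Matrix.updateCol_eq_self M (Fin.last j)
    rw [h1]
    have h2 : (M.updateCol (Fin.last j) (∑ t : Fin j, a t • (fun i => M i t.castSucc))).det = 0 := by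
      have aux : ∀ s : Finset (Fin j),
          (M.updateCol (Fin.last j) (∑ t ∈ s, a t • (fun i => M i t.castSucc))).det = 0 := by
        intro s
        induction s using Finset.induction_on with
        | empty =>
          apply Matrix.det_eq_zero_of_column_eq_zero (Fin.last j)
          intro i; simp
        | insert x s hx ih =>
          rw [Finset.sum_insert hx, Matrix.det_updateCol_add, ih, Matrix.det_updateCol_smul, add_zero]
          have : (M.updateCol (Fin.last j) (fun i => M i x.castSucc)).det = 0 := by
            apply Matrix.det_zero_of_column_eq (Fin.castSucc_lt_last x).ne
            intro i
            simp [Matrix.updateCol_apply, (Fin.castSucc_lt_last x).ne]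
          rw [this, mul_zero]
      exact aux _
    rw [h2, add_zero]
  rw [key, Matrix.det_succ_column _ (Fin.last j)]
  apply Finset.sum_congr rfl
  intro i _
  rw [Matrix.updateCol_self]
  congr 2
  ext x y
  simp [Matrix.updateCol_ne]

/-- Wronskian determinants of a sequence -/
noncomputable def Wom (v : ℕ → PowerSeries ℝ) (j : ℕ) : PowerSeries ℝ :=
  Matrix.det (Matrix.of fun i t : Fin j => dd^[(t:ℕ)] (v i))

/-- the Wronskian with an additional first row -/
noncomputable def Wex (v : ℕ → PowerSeries ℝ) (j : ℕ) (b : PowerSeries ℝ) : PowerSeries ℝ :=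
  Matrix.det (Matrix.of fun i t : Fin (j+1) =>
    if (i:ℕ) = 0 then dd^[(t:ℕ)] b else dd^[(t:ℕ)] (v ((i:ℕ)-1)))

lemma Wom_succ (v : ℕ → PowerSeries ℝ) (j : ℕ)
    (hu : ∀ i < j, PowerSeries.constantCoeff (Yc v i (v i)) ≠ 0) :
    Wom v (j+1) = Wom v j * Yc v j (v j) := by
  obtain ⟨a, ha, -⟩ := Yc_linear_form v j
  unfold Wom
  rw [det_colop j _ a, Finset.sum_eq_single (Fin.last j)]
  · have : (-1 : PowerSeries ℝ)^(((Fin.last j : Fin (j+1)):ℕ) + j) = 1 := by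
      rw [Fin.val_last, ← two_mul, pow_mul]; simp
    rw [this, ha (v j), Finset.sum_range]
    simp only [Matrix.of_apply, Fin.val_last, Fin.val_castSucc, one_mul]
    rw [mul_comm]
    congr 1
    congr 1
    ext x y
    simp
  · intro i _ hi
    have hi' : (i:ℕ) < j := by
      have := i.2
      have h2 : (i:ℕ) ≠ j := fun h => hi (Fin.ext h)
      omega
    have h0 := Yc_kill v i j hi' (hu i hi')
    rw [ha, Finset.sum_range] at h0
    simp only [Matrix.of_apply, Fin.val_last, Fin.val_castSucc]
    rw [h0]; ring
  · simp

lemma Wex_eq (v : ℕ → PowerSeries ℝ) (j : ℕ) (b : PowerSeries ℝ)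
    (hu : ∀ i < j, PowerSeries.constantCoeff (Yc v i (v i)) ≠ 0) :
    Wex v j b = (-1)^j * (Wom v j * Yc v j b) := by
  obtain ⟨a, ha, -⟩ := Yc_linear_form v j
  unfold Wex Wom
  rw [det_colop j _ a, Finset.sum_eq_single 0]
  · rw [ha b, Finset.sum_range]
    simp only [Matrix.of_apply, Fin.val_last, Fin.val_castSucc, Fin.val_zero, if_true, zero_add]
    rw [mul_assoc, mul_comm (Matrix.det _)]
    congr 3
  · intro i _ hi
    have hi' : (i:ℕ) - 1 < j := by
      have := i.2
      have h2 : (i:ℕ) ≠ 0 := fun h => hi (Fin.ext h)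
      omega
    have h2 : (i:ℕ) ≠ 0 := fun h => hi (Fin.ext h)
    have h0 := Yc_kill v (i-1) j hi' (hu _ hi')
    rw [ha, Finset.sum_range] at h0
    simp only [Matrix.of_apply, Fin.val_last, Fin.val_castSucc, h2, if_false]
    rw [h0]; ring
  · simp

lemma Yc_unit_of_Wom (v : ℕ → PowerSeries ℝ) (k : ℕ)
    (h : ∀ j ≤ k, PowerSeries.constantCoeff (Wom v j) ≠ 0) :
    ∀ j < k, PowerSeries.constantCoeff (Yc v j (v j)) ≠ 0 := by
  intro j
  induction j using Nat.strong_induction_on with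
  | _ j ih =>
    intro hj h0
    have := Wom_succ v j (fun i hi => ih i hi (hi.trans hj))
    apply h (j+1) hj
    rw [this, map_mul, h0, mul_zero]

/-! ### Part B: Laguerre polynomials as power series -/

lemma poch_succ (t : ℝ) (m : ℕ) : poch t (m+1) = poch t m * (t + m) := by
  simp [poch, Finset.prod_range_succ]
lemma poch_zero (t : ℝ) : poch t 0 = 1 := by simp [poch]
lemma poch_add (t : ℝ) (m n : ℕ) : poch t (m+n) = poch t m * poch (t+m) n := by
  simp [poch, Finset.prod_range_add, add_assoc]

lemma gbinom_poch (t : ℝ) (m : ℕ) : gbinom t m = poch (t - m + 1) m / (Nat.factorial m) := by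
  unfold gbinom poch
  congr 1
  rw [← Finset.prod_range_reflect]
  apply Finset.prod_congr rfl
  intro i hi
  have : i + 1 ≤ m := Finset.mem_range.mp hi
  have h : ((m - 1 - i : ℕ) : ℝ) = m - 1 - i := by
    rw [Nat.cast_sub (by omega), Nat.cast_sub (by omega)]; simp
  rw [h]; ring

lemma gbinom_pascal (t : ℝ) (m : ℕ) : gbinom (t+1) (m+1) = gbinom t (m+1) + gbinom t m := by
  unfold gbinom
  have h1 : ∏ i ∈ range (m+1), (t + 1 - (i:ℝ)) = (t+1) * ∏ i ∈ range m, (t - (i:ℝ)) := by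
    rw [Finset.prod_range_succ', mul_comm]
    congr 1
    · simp
    · apply Finset.prod_congr rfl
      intro i _; push_cast; ring
  rw [h1, Finset.prod_range_succ, Nat.factorial_succ]
  have : (Nat.factorial m : ℝ) ≠ 0 := by positivity
  push_cast
  field_simp
  ring

lemma gbinom_zero (t : ℝ) : gbinom t 0 = 1 := by simp [gbinom]

lemma lag_coeff (α : ℝ) (n j : ℕ) : (lag α n).coeff j =
    if j ≤ n then (-1 : ℝ) ^ j / (Nat.factorial j : ℝ) * gbinom ((n : ℝ) + α) (n - j) else 0 := by
  unfold lag
  simp only [Polynomial.finsetSum_coeff, Polynomial.coeff_C_mul, Polynomial.coeff_X_pow]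
  simp only [mul_ite, mul_one, mul_zero]
  rw [Finset.sum_ite_eq]
  simp

lemma lagneg_coeff (α : ℝ) (n j : ℕ) : ((lag α n).comp (-X)).coeff j =
    if j ≤ n then gbinom ((n : ℝ) + α) (n - j) / (Nat.factorial j : ℝ) else 0 := by
  rw [show (-X : Polynomial ℝ) = C (-1) * X by simp, Polynomial.comp_C_mul_X_coeff, lag_coeff]
  split_ifs
  · have : ((-1:ℝ)^j) * (-1)^j = 1 := by rw [← mul_pow]; simp
    linear_combination (gbinom ((n : ℝ) + α) (n - j) / (Nat.factorial j : ℝ)) * this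
  · simp

/-- the coefficients of the confluent series -/
noncomputable def sC (c lam : ℝ) (i : ℕ) : ℝ := poch (-lam) i / poch c i

noncomputable def phi (c lam : ℝ) : PowerSeries ℝ :=
  PowerSeries.mk (fun i => sC c lam i / (Nat.factorial i : ℝ))

lemma coeff_dd_iter (f : PowerSeries ℝ) (j i : ℕ) :
    PowerSeries.coeff i (dd^[j] f) * (Nat.factorial i : ℝ)
      = PowerSeries.coeff (i+j) f * (Nat.factorial (i+j) : ℝ) := by
  induction j generalizing i with
  | zero => simp
  | succ j ih =>
    rw [Function.iterate_succ_apply', coeff_dd]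
    have := ih (i+1)
    rw [Nat.factorial_succ] at this
    push_cast at this
    rw [show i + (j+1) = i + 1 + j by ring, ← this]; ring

lemma coeff_dd_phi (c lam : ℝ) (j i : ℕ) :
    PowerSeries.coeff i (dd^[j] (phi c lam)) = sC c lam (i+j) / (Nat.factorial i : ℝ) := by
  rw [eq_div_iff (by positivity), coeff_dd_iter, phi, PowerSeries.coeff_mk,
    div_mul_cancel₀ _ (by positivity)]

lemma sC_succ (c lam : ℝ) (hc : ∀ n, poch c n ≠ 0) (i : ℕ) :
    (c + i) * sC c lam (i+1) = (i - lam) * sC c lam i := by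
  unfold sC
  have h1 := hc (i+1)
  have h2 := hc i
  rw [poch_succ] at h1
  have h3 : c + i ≠ 0 := right_ne_zero_of_mul h1
  rw [poch_succ, poch_succ]
  field_simp
  ring

lemma phi_eig (c lam : ℝ) (hc : ∀ n, poch c n ≠ 0) : IsEig c (phi c lam) lam := by
  unfold IsEig
  have d1 : dd (phi c lam) = dd^[1] (phi c lam) := rfl
  have d2 : dd (dd (phi c lam)) = dd^[2] (phi c lam) := rfl
  have d0 : phi c lam = dd^[0] (phi c lam) := rfl
  rw [d1]; rw [show dd (dd^[1] (phi c lam)) = dd^[2] (phi c lam) from rfl]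
  ext n
  rw [sub_mul]
  simp only [map_add, map_sub, map_zero, PowerSeries.coeff_C_mul, coeff_dd_phi]
  have e0 : PowerSeries.coeff n (phi c lam) = sC c lam n / (Nat.factorial n : ℝ) := by
    simp [phi]
  rw [e0]
  have hs := sC_succ c lam hc n
  cases n with
  | zero =>
    simp at hs
    simp
    linear_combination hs
  | succ n =>
    rw [PowerSeries.coeff_succ_X_mul, PowerSeries.coeff_succ_X_mul, coeff_dd_phi, coeff_dd_phi]
    rw [Nat.factorial_succ]
    push_cast at hs ⊢
    have : (Nat.factorial n : ℝ) ≠ 0 := by positivity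
    have h3 : (n:ℝ) + 1 ≠ 0 := by positivity
    field_simp
    have e : n + 1 + 1 = n + 2 := rfl
    rw [e] at *
    linear_combination hs

noncomputable def gF (c : ℝ) (f : ℕ) : ℝ := poch c f / (Nat.factorial f : ℝ)

lemma poch_neg_nat (f j : ℕ) (h : j ≤ f) :
    poch (-(f:ℝ)) j * (Nat.factorial (f-j) : ℝ) = (-1)^j * (Nat.factorial f : ℝ) := by
  induction j with
  | zero => simp [poch]
  | succ j ih =>
    have := ih (by omega)
    rw [poch_succ, pow_succ]
    have e : f - j = (f - (j+1)) + 1 := by omega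
    rw [e, Nat.factorial_succ] at this
    have e2 : ((f - (j+1) : ℕ) : ℝ) = f - (j+1) := by
      rw [Nat.cast_sub h]; push_cast; ring
    push_cast at this
    rw [e2] at this
    linear_combination (-1) * this

lemma poch_neg_nat_zero (f j : ℕ) (h : f < j) : poch (-(f:ℝ)) j = 0 := by
  unfold poch
  apply Finset.prod_eq_zero (Finset.mem_range.mpr h); simp

lemma lag_eq_phi (α : ℝ) (hc : ∀ n, poch (α+1) n ≠ 0) (f : ℕ) :
    (lag α f : PowerSeries ℝ) = PowerSeries.C (gF (α+1) f) * phi (α+1) f := by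
  ext j
  rw [Polynomial.coeff_coe, lag_coeff, PowerSeries.coeff_C_mul, phi, PowerSeries.coeff_mk]
  unfold sC gF
  split_ifs with h
  · rw [gbinom_poch]
    have e2 : ((f - j : ℕ) : ℝ) = f - j := Nat.cast_sub h
    rw [e2, show (f:ℝ) + α - (f - j) + 1 = (α+1) + j by ring]
    have hp := poch_add (α+1) j (f-j)
    rw [show j + (f-j) = f by omega] at hp
    have hn := poch_neg_nat f j h
    have h1 := hc j
    have h2 : (Nat.factorial (f-j) : ℝ) ≠ 0 := by positivity
    have h3 : (Nat.factorial f : ℝ) ≠ 0 := by positivity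
    have h4 : (Nat.factorial j : ℝ) ≠ 0 := by positivity
    rw [hp]
    field_simp
    linear_combination - poch (α + 1 + ↑j) (f - j) * hn
  · rw [poch_neg_nat_zero f j (by omega)]; simp

noncomputable def Ex : PowerSeries ℝ := PowerSeries.exp ℝ
lemma dd_Ex : dd Ex = Ex := by
  ext n
  rw [coeff_dd, Ex, PowerSeries.coeff_exp, PowerSeries.coeff_exp, Nat.factorial_succ]
  have : (Nat.factorial n : ℝ) ≠ 0 := by positivity
  simp
  field_simp
lemma Ex_const : PowerSeries.constantCoeff Ex = 1 := by simp [Ex]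
lemma Ex_mul_inv : Ex * Ex⁻¹ = 1 := PowerSeries.mul_inv_cancel _ (by rw [Ex_const]; simp)
lemma Ex_ne : Ex ≠ 0 := by
  intro h; have := Ex_const; rw [h] at this; simp at this

lemma dd_Elag (a : ℝ) (f : ℕ) :
    dd (Ex * (((lag a f).comp (-X) : Polynomial ℝ) : PowerSeries ℝ))
      = Ex * (((lag (a+1) f).comp (-X) : Polynomial ℝ) : PowerSeries ℝ) := by
  rw [dd_mul, dd_Ex, ← mul_add]
  congr 1
  rw [dd_coe, ← Polynomial.coe_add]
  congr 1
  ext t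
  rw [Polynomial.coeff_add, Polynomial.coeff_derivative, lagneg_coeff, lagneg_coeff, lagneg_coeff]
  rcases lt_trichotomy t f with h | h | h
  · rw [if_pos (by omega), if_pos (by omega), if_pos (by omega)]
    obtain ⟨m, rfl⟩ : ∃ m, f = t + 1 + m := ⟨f - (t+1), by omega⟩
    rw [show t+1+m-t = m+1 by omega, show t+1+m-(t+1) = m by omega]
    rw [show ((t+1+m:ℕ):ℝ) + (a+1) = ((t+1+m:ℕ):ℝ) + a + 1 by ring, gbinom_pascal, Nat.factorial_succ]
    have : (Nat.factorial t : ℝ) ≠ 0 := by positivity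
    have h3 : (t:ℝ) + 1 ≠ 0 := by positivity
    push_cast
    field_simp
    ring
  · subst h; simp [gbinom_zero]
  · rw [if_neg (by omega), if_neg (by omega), if_neg (by omega)]; simp

lemma dd_iter_Elag (a : ℝ) (f j : ℕ) :
    dd^[j] (Ex * (((lag a f).comp (-X) : Polynomial ℝ) : PowerSeries ℝ))
      = Ex * (((lag (a+j) f).comp (-X) : Polynomial ℝ) : PowerSeries ℝ) := by
  induction j with
  | zero => simp
  | succ j ih =>
    rw [Function.iterate_succ_apply', ih, dd_Elag]; push_cast; rw [add_assoc]

lemma dd_iter_Cmul (r : ℝ) (b : PowerSeries ℝ) (j : ℕ) :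
    dd^[j] (PowerSeries.C r * b) = PowerSeries.C r * dd^[j] b := by
  induction j with
  | zero => simp
  | succ j ih => rw [Function.iterate_succ_apply', ih, dd_Cmul, Function.iterate_succ_apply']

lemma Elag_eq_phi (α : ℝ) (hc : ∀ n, poch (α+1) n ≠ 0) (f : ℕ) :
    Ex * (((lag α f).comp (-X) : Polynomial ℝ) : PowerSeries ℝ)
      = PowerSeries.C (gF (α+1) f) * phi (α+1) (-((α+1)+f)) := by
  ext i
  have h := coeff_dd_iter (Ex * (((lag α f).comp (-X) : Polynomial ℝ) : PowerSeries ℝ)) i 0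
  rw [dd_iter_Elag, zero_add, PowerSeries.coeff_zero_eq_constantCoeff_apply, map_mul, Ex_const, one_mul,
    ← PowerSeries.coeff_zero_eq_constantCoeff_apply, Polynomial.coeff_coe, lagneg_coeff] at h
  simp only [Nat.zero_le, if_true, Nat.sub_zero, Nat.factorial_zero, Nat.cast_one, div_one, mul_one] at h
  have hi : (Nat.factorial i : ℝ) ≠ 0 := by positivity
  apply mul_right_cancel₀ hi
  rw [← h, PowerSeries.coeff_C_mul, phi, PowerSeries.coeff_mk, gbinom_poch]
  unfold sC gF
  rw [neg_neg, show (f:ℝ) + (α + i) - f + 1 = (α + 1) + i by ring]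
  have h1 := poch_add (α+1) i f
  have h2 := poch_add (α+1) f i
  rw [add_comm f i, h1] at h2
  have := hc i
  have h3 : (Nat.factorial f : ℝ) ≠ 0 := by positivity
  field_simp
  linear_combination h2

/-- eigenvalues -/
noncomputable def lamF (c : ℝ) (F1 F2 : Finset ℕ) (i : ℕ) : ℝ :=
  if i < F1.card then (nth F1 i : ℝ) else -(c + (nth F2 (i - F1.card) : ℝ))

noncomputable def vF (c : ℝ) (F1 F2 : Finset ℕ) (i : ℕ) : PowerSeries ℝ := phi c (lamF c F1 F2 i)

noncomputable def rF (c : ℝ) (F1 F2 : Finset ℕ) (i : ℕ) : PowerSeries ℝ :=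
  if i < F1.card then PowerSeries.C (gF c (nth F1 i))
  else PowerSeries.C (gF c (nth F2 (i - F1.card))) * Ex⁻¹

lemma coe_iterDeriv (j : ℕ) (p : Polynomial ℝ) :
    ((iterDeriv j p : Polynomial ℝ) : PowerSeries ℝ) = dd^[j] (p : PowerSeries ℝ) := by
  unfold iterDeriv
  induction j with
  | zero => simp
  | succ j ih => rw [Function.iterate_succ_apply', Function.iterate_succ_apply', ← ih, dd_coe]

/-- determinant with a general polynomial in the first row -/
noncomputable def lagP (α : ℝ) (F1 F2 : Finset ℕ) (p : Polynomial ℝ) : Polynomial ℝ :=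
  Matrix.det (Matrix.of fun i j : Fin (F1.card + F2.card + 1) =>
    if (i : ℕ) = 0 then iterDeriv (j : ℕ) p
    else if (i : ℕ) - 1 < F1.card then iterDeriv (j : ℕ) (lag α (nth F1 ((i : ℕ) - 1)))
    else (lag (α + ((j : ℕ) : ℝ)) (nth F2 ((i : ℕ) - 1 - F1.card))).comp (-Polynomial.X))

lemma entry_eq (α : ℝ) (hc : ∀ n, poch (α+1) n ≠ 0) (F1 F2 : Finset ℕ) (i j : ℕ) :
    (((if i < F1.card then iterDeriv j (lag α (nth F1 i))
    else (lag (α + (j : ℝ)) (nth F2 (i - F1.card))).comp (-Polynomial.X)) : Polynomial ℝ) : PowerSeries ℝ)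
      = rF (α+1) F1 F2 i * dd^[j] (vF (α+1) F1 F2 i) := by
  unfold rF vF lamF
  split_ifs with h
  · rw [coe_iterDeriv, lag_eq_phi α hc, dd_iter_Cmul]
  · have := dd_iter_Elag α (nth F2 (i - F1.card)) j
    rw [Elag_eq_phi α hc, dd_iter_Cmul] at this
    linear_combination (-Ex⁻¹) * this - (((lag (α + (j : ℝ)) (nth F2 (i - F1.card))).comp (-Polynomial.X) : Polynomial ℝ) : PowerSeries ℝ) * Ex_mul_inv

lemma OmegaL_coe (α : ℝ) (hc : ∀ n, poch (α+1) n ≠ 0) (F1 F2 : Finset ℕ) :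
    (OmegaL α F1 F2 : PowerSeries ℝ) = (∏ i ∈ range (F1.card + F2.card), rF (α+1) F1 F2 i) *
      Wom (vF (α+1) F1 F2) (F1.card + F2.card) := by
  have : (OmegaL α F1 F2 : PowerSeries ℝ) = Polynomial.coeToPowerSeries.ringHom (OmegaL α F1 F2) := rfl
  rw [this, OmegaL, RingHom.map_det, Wom, Finset.prod_range, ← Matrix.det_mul_column]
  congr 1
  ext1 i j
  simp only [RingHom.mapMatrix_apply, Matrix.map_apply, Matrix.of_apply,
    Polynomial.coeToPowerSeries.ringHom_apply]
  exact entry_eq α hc F1 F2 i j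

lemma lagP_coe0 (α : ℝ) (hc : ∀ n, poch (α+1) n ≠ 0) (F1 F2 : Finset ℕ) (p : Polynomial ℝ) :
    (lagP α F1 F2 p : PowerSeries ℝ) = (∏ i ∈ range (F1.card + F2.card), rF (α+1) F1 F2 i) *
      Wex (vF (α+1) F1 F2) (F1.card + F2.card) p := by
  have : (lagP α F1 F2 p : PowerSeries ℝ) = Polynomial.coeToPowerSeries.ringHom (lagP α F1 F2 p) := rfl
  have hp : (∏ i ∈ range (F1.card + F2.card), rF (α+1) F1 F2 i)
     = ∏ i : Fin (F1.card + F2.card + 1), (if (i:ℕ) = 0 then 1 else rF (α+1) F1 F2 ((i:ℕ)-1)) := by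
    rw [Fin.prod_univ_succ, Finset.prod_range]
    simp
  rw [this, lagP, RingHom.map_det, Wex, hp, ← Matrix.det_mul_column]
  congr 1
  ext1 i j
  simp only [RingHom.mapMatrix_apply, Matrix.map_apply, Matrix.of_apply,
    Polynomial.coeToPowerSeries.ringHom_apply]
  by_cases h : (i:ℕ) = 0
  · simp only [h, if_true, one_mul]; exact coe_iterDeriv _ _
  · simp only [h, if_false]
    exact entry_eq α hc F1 F2 _ j

lemma nth_eq (F : Finset ℕ) (i : Fin F.card) : nth F i = F.orderEmbOfFin rfl i := by
  rw [Finset.orderEmbOfFin_apply, nth, List.getD_eq_getElem]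
  · rfl

lemma nth_inj (F : Finset ℕ) {i j : ℕ} (hi : i < F.card) (hj : j < F.card) (h : nth F i = nth F j) :
    i = j := by
  have h1 := nth_eq F ⟨i, hi⟩
  have h2 := nth_eq F ⟨j, hj⟩
  simp only at h1 h2
  rw [h1, h2] at h
  have := (F.orderEmbOfFin rfl).injective h
  exact congrArg Fin.val this

lemma nth_mem (F : Finset ℕ) {i : ℕ} (hi : i < F.card) : nth F i ∈ F := by
  have h1 := nth_eq F ⟨i, hi⟩
  simp only at h1
  rw [h1]; exact Finset.orderEmbOfFin_mem F rfl _

lemma nth_surj (F : Finset ℕ) {f : ℕ} (hf : f ∈ F) : ∃ i < F.card, nth F i = f := by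
  have : f ∈ Set.range (F.orderEmbOfFin rfl) := by rw [Finset.range_orderEmbOfFin]; exact hf
  obtain ⟨i, hi⟩ := this
  exact ⟨i, i.2, by rw [nth_eq, hi]⟩

lemma prod_nth {R : Type*} [CommMonoid R] (F : Finset ℕ) (h : ℕ → R) :
    ∏ i ∈ range F.card, h (nth F i) = ∏ f ∈ F, h f := by
  apply Finset.prod_bij (fun i _ => nth F i)
  · intro i hi; exact nth_mem F (Finset.mem_range.mp hi)
  · intro i hi j hj hij; exact nth_inj F (Finset.mem_range.mp hi) (Finset.mem_range.mp hj) hij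
  · intro f hf
    obtain ⟨i, hi, h⟩ := nth_surj F hf
    exact ⟨i, Finset.mem_range.mpr hi, h⟩
  · intros; rfl

lemma prod_lamF (c : ℝ) (F1 F2 : Finset ℕ) (t : ℝ) :
    ∏ i ∈ range (F1.card + F2.card), (t - lamF c F1 F2 i)
      = (∏ f ∈ F1, (t - (f:ℝ))) * ∏ f ∈ F2, (t + c + (f:ℝ)) := by
  rw [Finset.prod_range_add, ← prod_nth F1, ← prod_nth F2]
  congr 1
  · apply Finset.prod_congr rfl
    intro i hi
    simp [lamF, Finset.mem_range.mp hi]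
  · apply Finset.prod_congr rfl
    intro i hi
    simp [lamF]; ring

lemma c_add_ne (c : ℝ) (hc : ∀ n, poch c n ≠ 0) (n : ℕ) : c + n ≠ 0 := by
  have := hc (n+1)
  rw [poch_succ] at this
  exact right_ne_zero_of_mul this

lemma lamF_inj (c : ℝ) (hc : ∀ n, poch c n ≠ 0) (F1 F2 : Finset ℕ) {i j : ℕ}
    (hi : i < F1.card + F2.card) (hj : j < F1.card + F2.card)
    (h : lamF c F1 F2 i = lamF c F1 F2 j) : i = j := by
  unfold lamF at h
  split_ifs at h with h1 h2 h2
  · exact nth_inj F1 h1 h2 (by exact_mod_cast h)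
  · exfalso
    apply c_add_ne c hc (nth F2 (j - F1.card) + nth F1 i)
    push_cast; linarith
  · exfalso
    apply c_add_ne c hc (nth F2 (i - F1.card) + nth F1 j)
    push_cast; linarith
  · have h3 : nth F2 (i - F1.card) = nth F2 (j - F1.card) := by
      have : (nth F2 (i - F1.card) : ℝ) = nth F2 (j - F1.card) := by linarith
      exact_mod_cast this
    have := nth_inj F2 (by omega) (by omega) h3
    omega

/-- the Pochhammer polynomial -/
lemma poch_neg_eval (lam : ℝ) (t : ℕ) : poch (-lam) t = (-1)^t * (descPochhammer ℝ t).eval lam := by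
  induction t with
  | zero => simp [poch]
  | succ t ih =>
    rw [poch_succ, ih, descPochhammer_succ_right, pow_succ]
    simp; ring

lemma det_sC_ne (c : ℝ) (hc : ∀ n, poch c n ≠ 0) (j : ℕ) (x : Fin j → ℝ)
    (hx : Function.Injective x) : (Matrix.of fun i t : Fin j => sC c (x i) t).det ≠ 0 := by
  have h1 := Matrix.det_eval_matrixOfPolynomials_eq_det_vandermonde x
    (fun t => descPochhammer ℝ t) (fun t => by simp)
    (fun t => monic_descPochhammer ℝ t)
  have h2 : (Matrix.of fun i t : Fin j => sC c (x i) t)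
     = Matrix.of fun i t : Fin j => ((-1)^(t:ℕ) / poch c t) *
      (Matrix.of (fun i j_1 : Fin j => Polynomial.eval (x i) (descPochhammer ℝ (j_1:ℕ)))) i t := by
    ext i t
    simp only [Matrix.of_apply, sC, poch_neg_eval]; ring
  rw [h2, Matrix.det_mul_row, ← h1]
  apply mul_ne_zero
  · apply Finset.prod_ne_zero_iff.mpr
    intro t _
    exact div_ne_zero (pow_ne_zero _ (by norm_num)) (hc _)
  · exact Matrix.det_vandermonde_ne_zero_iff.mpr hx

lemma Wom_const (c : ℝ) (hc : ∀ n, poch c n ≠ 0) (F1 F2 : Finset ℕ) (j : ℕ)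
    (hj : j ≤ F1.card + F2.card) : PowerSeries.constantCoeff (Wom (vF c F1 F2) j) ≠ 0 := by
  have h := det_sC_ne c hc j (fun i => lamF c F1 F2 i) (fun a b hab => by
    have := lamF_inj c hc F1 F2 (lt_of_lt_of_le a.2 hj) (lt_of_lt_of_le b.2 hj) hab
    exact Fin.ext this)
  convert h using 1
  rw [Wom, RingHom.map_det]
  congr 1
  ext i t
  simp only [RingHom.mapMatrix_apply, Matrix.map_apply, Matrix.of_apply, vF]
  rw [← PowerSeries.coeff_zero_eq_constantCoeff_apply, coeff_dd_phi]
  simp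

lemma vF_unit (c : ℝ) (hc : ∀ n, poch c n ≠ 0) (F1 F2 : Finset ℕ) :
    ∀ j < F1.card + F2.card, PowerSeries.constantCoeff (Yc (vF c F1 F2) j (vF c F1 F2 j)) ≠ 0 :=
  Yc_unit_of_Wom _ _ (fun j hj => Wom_const c hc F1 F2 j hj)

lemma gF_ne (c : ℝ) (hc : ∀ n, poch c n ≠ 0) (f : ℕ) : gF c f ≠ 0 :=
  div_ne_zero (hc f) (by positivity)

lemma OmegaL_const (α : ℝ) (hc : ∀ n, poch (α+1) n ≠ 0) (F1 F2 : Finset ℕ) :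
    (OmegaL α F1 F2).coeff 0 ≠ 0 := by
  rw [← Polynomial.coeff_coe, OmegaL_coe α hc, PowerSeries.coeff_zero_eq_constantCoeff_apply,
    map_mul, map_prod]
  apply mul_ne_zero _ (Wom_const _ hc F1 F2 _ le_rfl)
  apply Finset.prod_ne_zero_iff.mpr
  intro i _
  unfold rF
  split_ifs
  · simpa using gF_ne _ hc _
  · rw [map_mul, PowerSeries.constantCoeff_inv, Ex_const]
    simpa using gF_ne _ hc _

lemma lagP_coe (α : ℝ) (hc : ∀ n, poch (α+1) n ≠ 0) (F1 F2 : Finset ℕ) (p : Polynomial ℝ) :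
    (lagP α F1 F2 p : PowerSeries ℝ) = (-1)^(F1.card + F2.card) *
      (OmegaL α F1 F2 : PowerSeries ℝ) * Yc (vF (α+1) F1 F2) (F1.card + F2.card) p := by
  rw [lagP_coe0 α hc, Wex_eq _ _ _ (vF_unit _ hc F1 F2), OmegaL_coe α hc]; ring

/-! rational power series -/

def IsRat (g : PowerSeries ℝ) : Prop := ∃ p q : Polynomial ℝ, q.coeff 0 ≠ 0 ∧
  (q : PowerSeries ℝ) * g = p

lemma IsRat.coe (p : Polynomial ℝ) : IsRat p := ⟨p, 1, by simp, by simp⟩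
lemma IsRat.CC (r : ℝ) : IsRat (PowerSeries.C r) := by
  simpa using IsRat.coe (Polynomial.C r)
lemma IsRat.one : IsRat 1 := by simpa using IsRat.coe 1
lemma IsRat.XX : IsRat PowerSeries.X := by simpa using IsRat.coe X
lemma IsRat.zero : IsRat 0 := by simpa using IsRat.coe 0
lemma IsRat.mul {f g : PowerSeries ℝ} (hf : IsRat f) (hg : IsRat g) : IsRat (f * g) := by
  obtain ⟨p, q, h, e⟩ := hf
  obtain ⟨p', q', h', e'⟩ := hg
  refine ⟨p * p', q * q', by rw [Polynomial.mul_coeff_zero]; exact mul_ne_zero h h', ?_⟩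
  rw [Polynomial.coe_mul, Polynomial.coe_mul, ← e, ← e']; ring
lemma IsRat.add {f g : PowerSeries ℝ} (hf : IsRat f) (hg : IsRat g) : IsRat (f + g) := by
  obtain ⟨p, q, h, e⟩ := hf
  obtain ⟨p', q', h', e'⟩ := hg
  refine ⟨p * q' + p' * q, q * q', by rw [Polynomial.mul_coeff_zero]; exact mul_ne_zero h h', ?_⟩
  rw [Polynomial.coe_mul, Polynomial.coe_add, Polynomial.coe_mul, Polynomial.coe_mul, ← e, ← e']; ring
lemma IsRat.sub {f g : PowerSeries ℝ} (hf : IsRat f) (hg : IsRat g) : IsRat (f - g) := by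
  have := hf.add ((IsRat.CC (-1)).mul hg)
  simpa [sub_eq_add_neg] using this
lemma IsRat.pow {f : PowerSeries ℝ} (hf : IsRat f) (n : ℕ) : IsRat (f^n) := by
  induction n with
  | zero => simpa using IsRat.one
  | succ n ih => rw [pow_succ]; exact ih.mul hf
lemma IsRat.dd {f : PowerSeries ℝ} (hf : IsRat f) : IsRat (dd f) := by
  obtain ⟨p, q, h, e⟩ := hf
  refine ⟨derivative p * q - derivative q * p, q * q, by rw [Polynomial.mul_coeff_zero]; exact mul_ne_zero h h, ?_⟩
  have e2 := congrArg _root_.dd e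
  rw [dd_mul, dd_coe, dd_coe] at e2
  rw [Polynomial.coe_sub, Polynomial.coe_mul, Polynomial.coe_mul, Polynomial.coe_mul, ← e, ← e2]; ring
lemma IsRat.inv {f : PowerSeries ℝ} (hf : IsRat f) (hu : PowerSeries.constantCoeff f ≠ 0) :
    IsRat f⁻¹ := by
  obtain ⟨p, q, h, e⟩ := hf
  refine ⟨q, p, ?_, ?_⟩
  · have := congrArg PowerSeries.constantCoeff e
    rw [map_mul] at this
    have h2 : PowerSeries.constantCoeff (p : PowerSeries ℝ) = p.coeff 0 := by simp
    have h3 : PowerSeries.constantCoeff (q : PowerSeries ℝ) = q.coeff 0 := by simp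
    rw [h2, h3] at this
    rw [← this]; exact mul_ne_zero h hu
  · rw [← e, mul_assoc, PowerSeries.mul_inv_cancel _ hu, mul_one]

lemma Yc_rat_aux (v : ℕ → PowerSeries ℝ) (j : ℕ)
    (hw : ∀ i < j, IsRat (dd (Yc v i (v i)) * (Yc v i (v i))⁻¹)) (b : PowerSeries ℝ) (hb : IsRat b) :
    IsRat (Yc v j b) ∧ ∃ r, IsRat r ∧ Yc v j (Ex * b) = Ex * r := by
  induction j with
  | zero => exact ⟨hb, b, hb, rfl⟩
  | succ j ih =>
    obtain ⟨h1, r, h2, h3⟩ := ih (fun i hi => hw i (by omega))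
    have hwj := hw j (by omega)
    refine ⟨h1.dd.sub (hwj.mul h1), dd r + r - dd (Yc v j (v j)) * (Yc v j (v j))⁻¹ * r,
      (h2.dd.add h2).sub (hwj.mul h2), ?_⟩
    simp only [Yc]
    rw [h3, dd_mul, dd_Ex]; ring

lemma Yc_rat (v : ℕ → PowerSeries ℝ) (k : ℕ)
    (hv : ∀ j < k, IsRat (v j) ∨ ∃ r, IsRat r ∧ v j = Ex * r)
    (hu : ∀ j < k, PowerSeries.constantCoeff (Yc v j (v j)) ≠ 0) :
    ∀ j < k, IsRat (dd (Yc v j (v j)) * (Yc v j (v j))⁻¹) := by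
  intro j
  induction j using Nat.strong_induction_on with
  | _ j ih =>
    intro hj
    have hw : ∀ i < j, IsRat (dd (Yc v i (v i)) * (Yc v i (v i))⁻¹) :=
      fun i hi => ih i hi (hi.trans hj)
    have huj := hu j hj
    rcases hv j hj with h | ⟨r, hr, h⟩
    · have h1 := (Yc_rat_aux v j hw _ h).1
      exact h1.dd.mul (h1.inv huj)
    · obtain ⟨_, s, hs, h3⟩ := Yc_rat_aux v j hw _ hr
      rw [← h] at h3
      rw [h3] at huj ⊢
      have hs0 : PowerSeries.constantCoeff s ≠ 0 := by
        rw [map_mul] at huj; exact right_ne_zero_of_mul huj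
      have e : dd (Ex * s) * (Ex * s)⁻¹ = 1 + dd s * s⁻¹ := by
        have i1 := PowerSeries.mul_inv_cancel _ huj
        have i2 := PowerSeries.mul_inv_cancel _ hs0
        have hne : Ex * s ≠ 0 := by
          intro h0; rw [h0] at huj; simp at huj
        apply mul_right_cancel₀ hne
        rw [dd_mul, dd_Ex]
        linear_combination (Ex * dd s + Ex * s) * i1 - Ex * dd s * i2
      rw [e]
      exact IsRat.one.add (hs.dd.mul (hs.inv hs0))

lemma vF_rat (α : ℝ) (hc : ∀ n, poch (α+1) n ≠ 0) (F1 F2 : Finset ℕ) (j : ℕ) :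
    IsRat (vF (α+1) F1 F2 j) ∨ ∃ r, IsRat r ∧ vF (α+1) F1 F2 j = Ex * r := by
  have cc : ∀ f, (PowerSeries.C (gF (α+1) f)⁻¹ : PowerSeries ℝ) * PowerSeries.C (gF (α+1) f) = 1 := by
    intro f; rw [← map_mul, inv_mul_cancel₀ (gF_ne _ hc f), map_one]
  unfold vF lamF
  split_ifs with h
  · left
    have := lag_eq_phi α hc (nth F1 j)
    have e : phi (α+1) (nth F1 j) = PowerSeries.C (gF (α+1) (nth F1 j))⁻¹ * (lag α (nth F1 j) : PowerSeries ℝ) := by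
      rw [this, ← mul_assoc, cc, one_mul]
    rw [e]; exact (IsRat.CC _).mul (IsRat.coe _)
  · right
    have := Elag_eq_phi α hc (nth F2 (j - F1.card))
    refine ⟨PowerSeries.C (gF (α+1) (nth F2 (j - F1.card)))⁻¹ * (((lag α (nth F2 (j - F1.card))).comp (-X) : Polynomial ℝ) : PowerSeries ℝ),
      (IsRat.CC _).mul (IsRat.coe _), ?_⟩
    linear_combination (- PowerSeries.C (gF (α+1) (nth F2 (j - F1.card)))⁻¹) * this - phi (α + 1) (-(α + 1 + ↑(nth F2 (j - F1.card)))) * cc (nth F2 (j - F1.card))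

lemma lag_eig (α : ℝ) (hc : ∀ n, poch (α+1) n ≠ 0) (m : ℕ) :
    IsEig (α+1) (lag α m : PowerSeries ℝ) m := by
  rw [lag_eq_phi α hc]
  have := phi_eig (α+1) m hc
  unfold IsEig at *
  rw [dd_Cmul, dd_Cmul]
  linear_combination PowerSeries.C (gF (α+1) m) * this

/-- telescoped norm identity (power series form) -/
lemma norm_identity_ps (α : ℝ) (hc : ∀ n, poch (α+1) n ≠ 0) (F1 F2 : Finset ℕ) (m : ℕ) (j : ℕ)
    (hj : j ≤ F1.card + F2.card) :
    ∃ g, IsRat g ∧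
    PowerSeries.X ^ j * (Yc (vF (α+1) F1 F2) j (lag α m))^2
      - PowerSeries.C (∏ i ∈ range j, ((m:ℝ) - lamF (α+1) F1 F2 i)) * (lag α m : PowerSeries ℝ)^2
    = (PowerSeries.C (α+1) - PowerSeries.X) * g + PowerSeries.X * dd g := by
  induction j with
  | zero => exact ⟨0, IsRat.zero, by simp [Yc, dd_zero]⟩
  | succ j ih =>
    obtain ⟨g, hg, e⟩ := ih (by omega)
    have hj' : j < F1.card + F2.card := hj
    have hst := chain_step (α+1) (vF (α+1) F1 F2) (lamF (α+1) F1 F2) (F1.card + F2.card)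
      (fun i _ => phi_eig _ _ hc) (vF_unit _ hc F1 F2) j hj' (lag α m) m (lag_eig α hc m)
    have hw := Yc_rat (vF (α+1) F1 F2) (F1.card + F2.card) (fun i _ => vF_rat α hc F1 F2 i)
      (vF_unit _ hc F1 F2)
    have r1 := (Yc_rat_aux (vF (α+1) F1 F2) j (fun i hi => hw i (by omega)) _ (IsRat.coe (lag α m))).1
    have r2 := (Yc_rat_aux (vF (α+1) F1 F2) (j+1) (fun i hi => hw i (by omega)) _ (IsRat.coe (lag α m))).1
    refine ⟨PowerSeries.C ((m:ℝ) - lamF (α+1) F1 F2 j) * g + PowerSeries.X ^ j *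
      (Yc (vF (α+1) F1 F2) j (lag α m) * Yc (vF (α+1) F1 F2) (j+1) (lag α m)),
      ((IsRat.CC _).mul hg).add ((IsRat.XX.pow _).mul (r1.mul r2)), ?_⟩
    rw [dd_add, dd_Cmul, Finset.prod_range_succ, map_mul]
    linear_combination hst + PowerSeries.C ((m:ℝ) - lamF (α+1) F1 F2 j) * e

/-- telescoped norm identity (polynomial form) -/
lemma norm_identity (α : ℝ) (hc : ∀ n, poch (α+1) n ≠ 0) (F1 F2 : Finset ℕ) (m : ℕ) :
    ∃ p q : Polynomial ℝ, q.coeff 0 ≠ 0 ∧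
    (X ^ (F1.card + F2.card) * (lagP α F1 F2 (lag α m))^2
      - C (∏ i ∈ range (F1.card + F2.card), ((m:ℝ) - lamF (α+1) F1 F2 i)) * (lag α m)^2 * (OmegaL α F1 F2)^2) * q^2
    = (OmegaL α F1 F2)^2 * ((C (α+1) - X) * p * q + X * (derivative p * q - p * derivative q)) := by
  obtain ⟨g, ⟨p, q, hq, e⟩, h⟩ := norm_identity_ps α hc F1 F2 m _ le_rfl
  refine ⟨p, q, hq, ?_⟩
  apply Polynomial.coe_injective
  have e2 := congrArg dd e
  rw [dd_mul, dd_coe, dd_coe] at e2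
  push_cast
  rw [lagP_coe α hc]
  have hs : ((-1 : PowerSeries ℝ)^(F1.card + F2.card))^2 = 1 := by
    rw [← pow_mul, mul_comm, pow_mul]; simp
  rw [← e2, ← e]
  set Y := Yc (vF (α + 1) F1 F2) (F1.card + F2.card) (lag α m)
  linear_combination ((q : PowerSeries ℝ)^2 * (OmegaL α F1 F2 : PowerSeries ℝ)^2) * h +
    PowerSeries.X ^ (F1.card + F2.card) * ((q : PowerSeries ℝ)^2 * (OmegaL α F1 F2 : PowerSeries ℝ)^2 * Y^2) * hs

lemma dd_one : dd 1 = 0 := by simp [dd]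

lemma dd_Wom (v : ℕ → PowerSeries ℝ) (k : ℕ)
    (hu : ∀ j < k, PowerSeries.constantCoeff (Yc v j (v j)) ≠ 0) (j : ℕ) (hj : j ≤ k) :
    dd (Wom v j) = Wom v j * ∑ i ∈ range j, dd (Yc v i (v i)) * (Yc v i (v i))⁻¹ := by
  induction j with
  | zero => simp [Wom, dd_one]
  | succ j ih =>
    rw [Wom_succ v j (fun i hi => hu i (by omega)), dd_mul, ih (by omega), Finset.sum_range_succ]
    have := PowerSeries.mul_inv_cancel _ (hu j hj)
    linear_combination (- Wom v j * dd (Yc v j (v j))) * this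

lemma dd_Exinv : dd Ex⁻¹ = - Ex⁻¹ := by
  have h := congrArg dd Ex_mul_inv
  rw [dd_mul, dd_Ex, dd_one] at h
  apply mul_left_cancel₀ Ex_ne
  linear_combination h

lemma dd_prod_r (c : ℝ) (F1 F2 : Finset ℕ) (j : ℕ) :
    dd (∏ i ∈ range j, rF c F1 F2 i) = - PowerSeries.C ((j - F1.card : ℕ):ℝ) * ∏ i ∈ range j, rF c F1 F2 i := by
  induction j with
  | zero => simp [dd_one]
  | succ j ih =>
    rw [Finset.prod_range_succ, dd_mul, ih]
    by_cases h : j < F1.card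
    · rw [show j - F1.card = 0 by omega, show j + 1 - F1.card = 0 by omega]
      simp [rF, h, dd_C]
    · rw [show j + 1 - F1.card = (j - F1.card) + 1 by omega]
      simp only [rF, h, if_false]
      rw [dd_Cmul, dd_Exinv]
      push_cast
      rw [map_add, map_one]
      ring

lemma abel_dvd (α : ℝ) (hc : ∀ n, poch (α+1) n ≠ 0) (F1 F2 : Finset ℕ) (hk : 0 < F1.card + F2.card)
    (D : Polynomial ℝ) (hD : ∀ p, D ∣ lagP α F1 F2 p) :
    D ∣ derivative (OmegaL α F1 F2) + C (F2.card : ℝ) * OmegaL α F1 F2 := by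
  set k := F1.card + F2.card with hkdef
  obtain ⟨a, ha, hal⟩ := Yc_linear_form (vF (α+1) F1 F2) k
  have key : ∀ t < k, ∃ Q : Polynomial ℝ, (Q : PowerSeries ℝ) = (OmegaL α F1 F2 : PowerSeries ℝ) * a t ∧ D ∣ Q := by
    intro t
    induction t using Nat.strong_induction_on with
    | _ t ih =>
      intro ht
      choose! Q hQ hQD using ih
      have hl := lagP_coe α hc F1 F2 (X^t)
      rw [← hkdef, ha, ← coe_iterDeriv] at hl
      simp only [← coe_iterDeriv] at hl
      have hid : ∀ i, iterDeriv i (X^t : Polynomial ℝ) = C ((t.descFactorial i : ℕ):ℝ) * X^(t-i) := by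
        intro i
        exact Polynomial.iterate_derivative_X_pow_eq_C_mul t i
      have hz : ∀ i, t < i → iterDeriv i (X^t : Polynomial ℝ) = 0 := by
        intro i hi
        rw [hid, Nat.descFactorial_of_lt hi]; simp
      rw [hz k ht] at hl
      have hsplit : ∑ i ∈ range k, a i * ((iterDeriv i (X^t : Polynomial ℝ) : Polynomial ℝ) : PowerSeries ℝ)
          = ∑ i ∈ range t, a i * ((iterDeriv i (X^t : Polynomial ℝ) : Polynomial ℝ) : PowerSeries ℝ)
            + a t * PowerSeries.C (t.factorial : ℝ) := by
        rw [← Finset.sum_subset (Finset.range_subset_range.mpr (show t+1 ≤ k from ht)), Finset.sum_range_succ, hid t]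
        · rw [Nat.descFactorial_self, Nat.sub_self, pow_zero, mul_one, Polynomial.coe_C]
        · intro i _ hi
          rw [hz i (by simpa using hi)]; simp
      rw [hsplit] at hl
      have hs : ((-1 : PowerSeries ℝ)^k) * (-1)^k = 1 := by
        rw [← mul_pow]; simp
      have hf : (PowerSeries.C ((t.factorial:ℝ)⁻¹) : PowerSeries ℝ) * PowerSeries.C (t.factorial : ℝ) = 1 := by
        rw [← map_mul, inv_mul_cancel₀ (by positivity), map_one]
      refine ⟨C ((t.factorial:ℝ)⁻¹) * ((-1)^k * lagP α F1 F2 (X^t) - ∑ i ∈ range t, Q i * iterDeriv i (X^t)), ?_, ?_⟩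
      · have hsum : ((∑ i ∈ range t, Q i * iterDeriv i (X^t : Polynomial ℝ) : Polynomial ℝ) : PowerSeries ℝ)
            = (OmegaL α F1 F2 : PowerSeries ℝ) * ∑ i ∈ range t, a i * ((iterDeriv i (X^t : Polynomial ℝ) : Polynomial ℝ) : PowerSeries ℝ) := by
          have : ∀ p : Polynomial ℝ, (p : PowerSeries ℝ) = Polynomial.coeToPowerSeries.ringHom p := fun _ => rfl
          rw [this, map_sum, Finset.mul_sum]
          apply Finset.sum_congr rfl
          intro i hi
          have hi' := Finset.mem_range.mp hi
          rw [← this, Polynomial.coe_mul, hQ i hi' (hi'.trans ht)]; ring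
        push_cast
        rw [hsum, hl]
        simp only [Polynomial.coe_zero, zero_add]
        linear_combination (PowerSeries.C ((t.factorial:ℝ)⁻¹) * (OmegaL α F1 F2 : PowerSeries ℝ) *
          (∑ i ∈ range t, a i * ((iterDeriv i (X^t : Polynomial ℝ) : Polynomial ℝ) : PowerSeries ℝ)
            + a t * PowerSeries.C (t.factorial : ℝ))) * hs + (OmegaL α F1 F2 : PowerSeries ℝ) * a t * hf
      · apply Dvd.dvd.mul_left
        apply dvd_sub
        · exact (hD _).mul_left _
        · apply Finset.dvd_sum
          intro i hi
          have hi' := Finset.mem_range.mp hi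
          exact (hQD i hi' (hi'.trans ht)).mul_right _
  obtain ⟨Q, hQ, hQD⟩ := key (k-1) (by omega)
  rw [hal hk] at hQ
  have e : derivative (OmegaL α F1 F2) + C (F2.card : ℝ) * OmegaL α F1 F2 = - Q := by
    apply Polynomial.coe_injective
    push_cast
    rw [hQ, ← dd_coe]
    conv_lhs => rw [OmegaL_coe α hc]
    rw [dd_mul, ← hkdef, dd_Wom _ k (vF_unit _ hc F1 F2) k le_rfl, dd_prod_r]
    rw [OmegaL_coe α hc, show k - F1.card = F2.card by omega, ← hkdef]
    ring
  rw [e]; exact hQD.neg_right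

/-! ### Part C: the regularised Laguerre functional and the final integral -/

/-- the regularised functional with moments `Γ(a+1+j)` -/
noncomputable def LL (a : ℝ) : Polynomial ℝ →ₗ[ℝ] ℝ :=
  Polynomial.lsum (fun j => Real.Gamma (a + 1 + j) • LinearMap.id)

lemma LL_monomial (a : ℝ) (j : ℕ) (r : ℝ) : LL a (monomial j r) = r * Real.Gamma (a + 1 + j) := by
  simp [LL, Polynomial.lsum_apply, Polynomial.sum_monomial_index, mul_comm]

lemma LL_C (a r : ℝ) : LL a (C r) = r * Real.Gamma (a + 1) := by
  rw [← monomial_zero_left, LL_monomial]; simp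

lemma LL_X_mul (a : ℝ) (Q : Polynomial ℝ) : LL a (X * Q) = LL (a+1) Q := by
  induction Q using Polynomial.induction_on' with
  | add p q hp hq => rw [mul_add, map_add, map_add, hp, hq]
  | monomial n r =>
    rw [Polynomial.X_mul_monomial, LL_monomial, LL_monomial]; push_cast; ring_nf

/-- the operator `D R = (a+1-X) R + X (derivative R)` -/
noncomputable def DD (a : ℝ) (R : Polynomial ℝ) : Polynomial ℝ := (C (a+1) - X) * R + X * derivative R

lemma DD_add (a : ℝ) (R S : Polynomial ℝ) : DD a (R + S) = DD a R + DD a S := by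
  simp only [DD, derivative_add]; ring

lemma LL_DD (a : ℝ) (ha : ∀ n : ℕ, a + 1 + n ≠ 0) (R : Polynomial ℝ) : LL a (DD a R) = 0 := by
  induction R using Polynomial.induction_on' with
  | add p q hp hq => rw [DD_add, map_add, hp, hq, add_zero]
  | monomial n r =>
    have e : DD a (monomial n r) = monomial n ((a+1+n) * r) - monomial (n+1) r := by
      unfold DD
      rw [derivative_monomial, sub_mul, Polynomial.C_mul_monomial, Polynomial.X_mul_monomial, Polynomial.X_mul_monomial]
      cases n with
      | zero => simp
      | succ n =>
        rw [show n + 1 - 1 + 1 = n + 1 by omega, sub_add_eq_add_sub, ← map_add]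
        congr 2; ring
    rw [e, map_sub, LL_monomial, LL_monomial]
    have := Real.Gamma_add_one (ha n)
    push_cast
    rw [← add_assoc, this]; ring

lemma regularize (a : ℝ) (ha : ∀ n : ℕ, a + 1 + n ≠ 0) (u : Polynomial ℝ) (N : ℕ) :
    ∃ R Q : Polynomial ℝ, u = DD a R + X^N * Q ∧ LL a u = LL (a+N) Q := by
  induction N with
  | zero => exact ⟨0, u, by simp [DD], by simp⟩
  | succ N ih =>
    obtain ⟨R, Q, h1, h2⟩ := ih
    set r := Q.coeff 0 / (a + 1 + N) with hr
    have hQ := Polynomial.X_mul_divX_add Q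
    have hrn : (a + 1 + N) * r = Q.coeff 0 := by rw [hr]; field_simp [ha N]
    refine ⟨R + C r * X^N, Q.divX + C r, ?_, ?_⟩
    · rw [DD_add]
      have : DD a (C r * X^N) + X^(N+1) * C r = C (Q.coeff 0) * X^N := by
        rw [← hrn]
        unfold DD
        cases N with
        | zero => simp; ring
        | succ N =>
          simp only [derivative_mul, derivative_C, derivative_X_pow, map_mul, map_add, map_natCast]
          push_cast
          ring
      conv_lhs => rw [h1, ← hQ]
      linear_combination -this
    · have hL : LL (a+N) Q = LL (a+N) (X * Q.divX + C (Q.coeff 0)) := by rw [hQ]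
      rw [h2, hL, map_add, LL_X_mul]
      have hn : a + N + 1 ≠ 0 := by have := ha N; intro h; apply this; linarith
      rw [LL_C]
      push_cast
      rw [map_add, LL_C, ← add_assoc, Real.Gamma_add_one hn, ← hrn]
      ring

lemma lag_rodrigues (a : ℝ) (m : ℕ) : C ((m:ℝ)+1) * lag a (m+1) = DD a (lag (a+1) m) := by
  have key : ∀ (T : ℝ) (j : ℕ), ((j:ℝ)+1) * gbinom T (j+1) = (T - j) * gbinom T j := by
    intro T j
    unfold gbinom
    rw [Finset.prod_range_succ, Nat.factorial_succ]
    have : (Nat.factorial j : ℝ) ≠ 0 := by positivity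
    push_cast
    field_simp
  ext t
  unfold DD
  rw [coeff_C_mul, sub_mul, coeff_add, coeff_sub, coeff_C_mul, lag_coeff, lag_coeff]
  have hT : ((m+1:ℕ):ℝ) + a = (m:ℝ) + (a+1) := by push_cast; ring
  rw [hT]
  cases t with
  | zero =>
    simp
    have := key (m + (a+1)) m
    linear_combination this
  | succ t =>
    rw [coeff_X_mul, coeff_X_mul, coeff_derivative, lag_coeff, lag_coeff, pow_succ, Nat.factorial_succ]
    have h1 : (Nat.factorial t : ℝ) ≠ 0 := by positivity
    have h2 : (t:ℝ) + 1 ≠ 0 := by positivity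
    rcases lt_trichotomy t m with h | h | h
    · rw [if_pos (by omega), if_pos (by omega), if_pos (by omega)]
      obtain ⟨j, rfl⟩ : ∃ j, m = t + 1 + j := ⟨m - (t+1), by omega⟩
      rw [show t+1+j+1-(t+1) = j+1 by omega, show t+1+j-(t+1) = j by omega, show t+1+j-t = j+1 by omega]
      have := key (((t+1+j:ℕ):ℝ) + (a+1)) j
      push_cast at this ⊢
      field_simp
      linear_combination (-1) * this
    · subst h
      rw [if_pos (by omega), if_neg (by omega), if_pos (by omega)]
      simp only [Nat.sub_self, gbinom_zero]
      push_cast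
      field_simp
      ring
    · rw [if_neg (by omega), if_neg (by omega), if_neg (by omega)]; simp

lemma LL_lag_mul (m : ℕ) : ∀ (a : ℝ), (∀ n : ℕ, a + 1 + n ≠ 0) → ∀ q : Polynomial ℝ, q.natDegree ≤ m →
    LL a (lag a m * q) = (-1)^m * q.coeff m * Real.Gamma (a + m + 1) := by
  induction m with
  | zero =>
    intro a ha q hq
    rw [Polynomial.eq_C_of_natDegree_le_zero hq]
    have : lag a 0 = 1 := by simp [lag, gbinom_zero]
    rw [this, one_mul, LL_C]; simp
  | succ m ih =>
    intro a ha q hq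
    have ha' : ∀ n : ℕ, a + 1 + 1 + n ≠ 0 := by
      intro n; have := ha (n+1); push_cast at this; intro h; apply this; linarith
    have h1 := ih (a+1) ha' (derivative q) (by
      have := Polynomial.natDegree_derivative_le q; omega)
    have h2 : C ((m:ℝ)+1) * (lag a (m+1) * q) = DD a (lag (a+1) m * q) - X * (lag (a+1) m * derivative q) := by
      rw [← mul_assoc, lag_rodrigues]; unfold DD; rw [derivative_mul]; ring
    have h3 := congrArg (LL a) h2
    rw [map_sub, LL_DD a ha, LL_X_mul, h1, ← Polynomial.smul_eq_C_mul, map_smul, smul_eq_mul, coeff_derivative] at h3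
    have h4 : (m:ℝ)+1 ≠ 0 := by positivity
    apply mul_left_cancel₀ h4
    rw [h3]
    push_cast
    rw [show a + 1 + (m:ℝ) + 1 = a + (m+1) + 1 by ring]
    ring

lemma lag_natDegree (a : ℝ) (m : ℕ) : (lag a m).natDegree ≤ m := by
  rw [Polynomial.natDegree_le_iff_coeff_eq_zero]
  intro N hN
  rw [lag_coeff, if_neg (by omega)]

lemma LL_lag_sq (a : ℝ) (ha : ∀ n : ℕ, a + 1 + n ≠ 0) (m : ℕ) :
    LL a ((lag a m)^2) = Real.Gamma (m + a + 1) / (Nat.factorial m : ℝ) := by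
  rw [pow_two, LL_lag_mul m a ha _ (lag_natDegree a m), lag_coeff, if_pos le_rfl, Nat.sub_self, gbinom_zero]
  have : ((-1:ℝ)^m) * (-1)^m = 1 := by rw [← mul_pow]; simp
  rw [add_comm (m:ℝ) a]
  linear_combination (Real.Gamma (a + m + 1) / (Nat.factorial m : ℝ)) * this

lemma not_dvd_derivative (q : Polynomial ℝ) (r : ℝ) (hq : q ≠ 0) (hr : q.IsRoot r) :
    ¬ (X - C r)^(q.rootMultiplicity r) ∣ derivative q := by
  intro h
  have hpos := (rootMultiplicity_pos hq).2 hr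
  have hd : derivative q ≠ 0 := by
    intro h0
    have h2 := Polynomial.derivative_eq_zero.mp h0
    rw [Polynomial.eq_C_of_natDegree_eq_zero h2] at hr hq
    simp only [IsRoot.def, eval_C] at hr
    rw [hr] at hq; simp at hq
  have h1 := (le_rootMultiplicity_iff hd).2 h
  rw [derivative_rootMultiplicity_of_root hr] at h1
  omega

lemma coprime_reduction (A B W p q : Polynomial ℝ) (hq : q.coeff 0 ≠ 0)
    (h : A * q^2 = W * (B * p * q + X * (derivative p * q - p * derivative q)))
    (hW : ∀ x : ℝ, 0 < x → W.eval x ≠ 0) :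
    ∃ p1 q1 : Polynomial ℝ, (∀ x : ℝ, 0 ≤ x → q1.eval x ≠ 0) ∧
      A * q1^2 = W * (B * p1 * q1 + X * (derivative p1 * q1 - p1 * derivative q1)) := by
  classical
  have hq0 : q ≠ 0 := by rintro rfl; simp at hq
  set d := EuclideanDomain.gcd p q with hd
  have hd0 : d ≠ 0 := by
    intro h0; rw [hd, EuclideanDomain.gcd_eq_zero_iff] at h0; exact hq0 h0.2
  obtain ⟨p1, hp1⟩ := EuclideanDomain.gcd_dvd_left p q
  obtain ⟨q1, hq1⟩ := EuclideanDomain.gcd_dvd_right p q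
  rw [← hd] at hp1 hq1
  have hcop : IsCoprime p1 q1 := by
    have hb := EuclideanDomain.gcd_eq_gcd_ab p q
    rw [← hd] at hb
    refine ⟨EuclideanDomain.gcdA p q, EuclideanDomain.gcdB p q, ?_⟩
    apply mul_left_cancel₀ hd0
    calc d * (EuclideanDomain.gcdA p q * p1 + EuclideanDomain.gcdB p q * q1)
        = (d * p1) * EuclideanDomain.gcdA p q + (d * q1) * EuclideanDomain.gcdB p q := by ring
      _ = d * 1 := by rw [← hp1, ← hq1, ← hb, mul_one]
  clear_value d
  have hid : A * q1^2 = W * (B * p1 * q1 + X * (derivative p1 * q1 - p1 * derivative q1)) := by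
    apply mul_left_cancel₀ (pow_ne_zero 2 hd0)
    rw [hp1, hq1, derivative_mul, derivative_mul] at h
    linear_combination h
  have hq10 : q1.coeff 0 ≠ 0 := by
    rw [hq1, mul_coeff_zero] at hq; exact right_ne_zero_of_mul hq
  have hq1ne : q1 ≠ 0 := by rintro rfl; simp at hq10
  refine ⟨p1, q1, ?_, hid⟩
  intro x hx hroot
  rcases hx.eq_or_lt with h0 | hpos
  · rw [← h0, ← Polynomial.coeff_zero_eq_eval_zero] at hroot; exact hq10 hroot
  · apply not_dvd_derivative q1 x hq1ne hroot
    have d1 : q1 ∣ W * X * derivative q1 := by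
      have : q1 ∣ (W * X * derivative q1) * p1 := by
        refine ⟨W * (B * p1) + W * X * derivative p1 - A * q1, ?_⟩
        linear_combination hid
      exact hcop.symm.dvd_of_dvd_mul_right this
    have d2 := (Polynomial.pow_rootMultiplicity_dvd q1 x).trans d1
    refine IsCoprime.dvd_of_dvd_mul_left ?_ d2
    apply IsCoprime.pow_left
    rw [(irreducible_X_sub_C x).coprime_iff_not_dvd, dvd_iff_isRoot, IsRoot.def, eval_mul, eval_X]
    exact mul_ne_zero (hW x hpos) hpos.ne'

/-- order of vanishing at the origin -/
lemma X_pow_dvd_of (a : ℝ) (ha : ∀ n : ℕ, a + 1 + n ≠ 0) (k : ℕ) (W A p q : Polynomial ℝ)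
    (hW : W.eval 0 ≠ 0) (hq : q.eval 0 ≠ 0)
    (h : X^k * A = W * ((C (a+1) - X) * p * q + X * (derivative p * q - p * derivative q))) :
    ∀ i ≤ k, X^i ∣ p := by
  intro i
  induction i with
  | zero => intro _; simp
  | succ i ih =>
    intro hi
    obtain ⟨s, rfl⟩ := ih (by omega)
    have h1 : X^(k-i) * A = W * ((C (a+1+i) - X) * s * q + X * (derivative s * q - s * derivative q)) := by
      apply mul_left_cancel₀ (pow_ne_zero i (X_ne_zero (R := ℝ)))
      rw [← mul_assoc, ← pow_add, show i + (k - i) = k by omega, h, derivative_mul]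
      have : X * derivative (X^i : Polynomial ℝ) = C (i:ℝ) * X^i := by
        cases i with
        | zero => simp
        | succ i => rw [derivative_X_pow, Nat.add_sub_cancel, pow_succ]; ring
      rw [map_add C (a+1) (i:ℝ)]
      linear_combination (W * s * q) * this
    have h2 := congrArg (Polynomial.eval 0) h1
    simp only [eval_mul, eval_pow, eval_X, eval_add, eval_sub, eval_C, zero_mul, add_zero, sub_zero] at h2
    rw [zero_pow (by omega), zero_mul] at h2
    have h3 : s.eval 0 = 0 := by
      by_contra h4
      exact mul_ne_zero hW (mul_ne_zero (mul_ne_zero (ha i) h4) hq) h2.symm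
    obtain ⟨r, rfl⟩ := (X_dvd_iff.mpr (by rw [coeff_zero_eq_eval_zero, h3]) : X ∣ s)
    exact ⟨r, by ring⟩

/-- the algebraic content of the norm computation -/
lemma norm_algebra (a : ℝ) (ha : ∀ n : ℕ, a + 1 + n ≠ 0) (k : ℕ) (V L Om p q : Polynomial ℝ) (P : ℝ)
    (hq : q.coeff 0 ≠ 0) (hOm : ∀ x : ℝ, 0 ≤ x → Om.eval x ≠ 0)
    (h : (X^k * V^2 - C P * L^2 * Om^2) * q^2
      = Om^2 * ((C (a+1) - X) * p * q + X * (derivative p * q - p * derivative q))) :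
    ∃ Q p3 q1 : Polynomial ℝ, LL a (L^2) = LL (a+k) Q ∧ (∀ x : ℝ, 0 ≤ x → q1.eval x ≠ 0) ∧
      (V^2 - C P * Q * Om^2) * q1^2 = Om^2 * ((C (a+k+1) - X) * p3 * q1
        + X * (derivative p3 * q1 - p3 * derivative q1)) := by
  obtain ⟨p1, q1, hq1, h1⟩ := coprime_reduction _ _ _ _ _ hq h (fun x hx => by
    rw [eval_pow]; exact pow_ne_zero 2 (hOm x hx.le))
  obtain ⟨R, Q, hR, hL⟩ := regularize a ha (L^2) k
  have h2 : X^k * ((V^2 - C P * Q * Om^2) * q1^2) = Om^2 * ((C (a+1) - X) * (p1 + C P * R * q1) * q1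
      + X * (derivative (p1 + C P * R * q1) * q1 - (p1 + C P * R * q1) * derivative q1)) := by
    unfold DD at hR
    simp only [derivative_add, derivative_mul, derivative_C]
    linear_combination h1 + C P * Om^2 * q1^2 * hR
  obtain ⟨p3, hp3⟩ := X_pow_dvd_of a ha k _ _ _ _
    (by rw [eval_pow]; exact pow_ne_zero 2 (hOm 0 le_rfl)) (hq1 0 le_rfl) h2 k le_rfl
  refine ⟨Q, p3, q1, hL, hq1, ?_⟩
  rw [hp3] at h2
  apply mul_left_cancel₀ (pow_ne_zero k (X_ne_zero (R := ℝ)))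
  rw [h2, derivative_mul]
  have : X * derivative (X^k : Polynomial ℝ) = C (k:ℝ) * X^k := by
    cases k with
    | zero => simp
    | succ i => rw [derivative_X_pow, Nat.add_sub_cancel, pow_succ]; ring
  rw [show a + k + 1 = (a + 1) + k by ring, map_add C (a+1) (k:ℝ)]
  linear_combination (Om^2 * p3 * q1) * this

lemma integrable_LL (b : ℝ) (hb : -1 < b) (Q : Polynomial ℝ) :
    IntegrableOn (fun x : ℝ => x^b * Real.exp (-x) * Q.eval x) (Set.Ioi 0) ∧
    ∫ x in Set.Ioi (0:ℝ), x^b * Real.exp (-x) * Q.eval x = LL b Q := by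
  induction Q using Polynomial.induction_on' with
  | add p q hp hq =>
    simp only [eval_add, mul_add]
    refine ⟨hp.1.add hq.1, ?_⟩
    rw [integral_add hp.1 hq.1, hp.2, hq.2, map_add]
  | monomial n r =>
    have hs : 0 < b + 1 + n := by have : (0:ℝ) ≤ n := n.cast_nonneg; linarith
    have e : Set.EqOn (fun x : ℝ => r * (Real.exp (-x) * x^(b+1+n-1)))
        (fun x : ℝ => x^b * Real.exp (-x) * (monomial n r).eval x) (Set.Ioi 0) := by
      intro x hx
      have hx' : (0:ℝ) < x := hx
      simp only [eval_monomial]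
      rw [show b + 1 + n - 1 = b + n by ring, Real.rpow_add hx', Real.rpow_natCast]; ring
    constructor
    · exact IntegrableOn.congr_fun ((Real.GammaIntegral_convergent hs).const_mul r) e measurableSet_Ioi
    · rw [← setIntegral_congr_fun measurableSet_Ioi e, integral_const_mul, ← Real.Gamma_eq_integral hs,
        LL_monomial]

lemma poly_inv_bound (q : Polynomial ℝ) (hq : ∀ x : ℝ, 0 ≤ x → q.eval x ≠ 0) :
    ∃ M : ℝ, 0 < M ∧ ∀ x : ℝ, 0 ≤ x → |(q.eval x)⁻¹| ≤ M := by
  have : ∃ A : ℝ, 0 ≤ A ∧ ∃ δ : ℝ, 0 < δ ∧ ∀ x, A ≤ x → δ ≤ |q.eval x| := by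
    by_cases hd : 0 < q.degree
    · have := Polynomial.abs_tendsto_atTop q hd
      obtain ⟨A, hA⟩ := (Filter.tendsto_atTop.mp this 1).exists_forall_of_atTop
      exact ⟨max A 0, le_max_right _ _, 1, one_pos, fun x hx => hA x (le_trans (le_max_left _ _) hx)⟩
    · have hc := Polynomial.eq_C_of_degree_le_zero (not_lt.mp hd)
      refine ⟨0, le_rfl, |q.coeff 0|, ?_, ?_⟩
      · have := hq 0 le_rfl
        rw [← coeff_zero_eq_eval_zero] at this
        exact abs_pos.mpr this
      · intro x _
        rw [hc]; simp
  obtain ⟨A, hA0, δ, hδ, hA⟩ := this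
  obtain ⟨x0, hx0, hmin⟩ := (isCompact_Icc (a := (0:ℝ)) (b := A)).exists_isMinOn
    (Set.nonempty_Icc.mpr hA0) (f := fun x => |q.eval x|) (by fun_prop)
  have hpos : 0 < |q.eval x0| := abs_pos.mpr (hq x0 hx0.1)
  refine ⟨(min δ |q.eval x0|)⁻¹, by positivity, ?_⟩
  intro x hx
  rw [abs_inv]
  apply inv_anti₀ (lt_min hδ hpos)
  rcases le_total A x with h | h
  · exact (min_le_left _ _).trans (hA x h)
  · exact (min_le_right _ _).trans (hmin ⟨hx, h⟩)

lemma rpow_exp_poly_tendsto (s : ℝ) (Q : Polynomial ℝ) :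
    Filter.Tendsto (fun x : ℝ => x^s * Real.exp (-x) * Q.eval x) Filter.atTop (nhds 0) := by
  induction Q using Polynomial.induction_on' with
  | add p q hp hq =>
    simp only [eval_add, mul_add]
    simpa using hp.add hq
  | monomial n r =>
    have h := (tendsto_rpow_mul_exp_neg_mul_atTop_nhds_zero (s + n) 1 one_pos).const_mul r
    rw [mul_zero] at h
    apply h.congr'
    filter_upwards [Filter.eventually_gt_atTop 0] with x hx
    simp only [eval_monomial]
    rw [Real.rpow_add hx, Real.rpow_natCast]
    simp only [neg_mul, one_mul]; ring

lemma norm_analysis (b : ℝ) (hb : -1 < b) (V Om Q p q : Polynomial ℝ) (P : ℝ)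
    (hq : ∀ x : ℝ, 0 ≤ x → q.eval x ≠ 0) (hOm : ∀ x : ℝ, 0 ≤ x → Om.eval x ≠ 0)
    (h : (V^2 - C P * Q * Om^2) * q^2 = Om^2 * ((C (b+1) - X) * p * q
        + X * (derivative p * q - p * derivative q))) :
    ∫ x in Set.Ioi (0:ℝ), (V.eval x)^2 * (x^b * Real.exp (-x) / (Om.eval x)^2) = P * LL b Q := by
  obtain ⟨M, hM, hMq⟩ := poly_inv_bound q hq
  set G : ℝ → ℝ := fun x => x^(b+1) * Real.exp (-x) * (p.eval x / q.eval x) with hG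
  set N : Polynomial ℝ := (C (b+1) - X) * p * q + X * (derivative p * q - p * derivative q) with hN
  set G' : ℝ → ℝ := fun x => (x^b * Real.exp (-x) * N.eval x) * ((q.eval x)⁻¹)^2 with hG'
  have hInt1 : IntegrableOn G' (Set.Ioi 0) := by
    apply Integrable.mul_bdd (c := M^2) (integrable_LL b hb N).1
    · apply ContinuousOn.aestronglyMeasurable _ measurableSet_Ioi
      apply ContinuousOn.pow
      apply ContinuousOn.inv₀
      · exact q.continuous.continuousOn
      · intro x hx; exact hq x (le_of_lt hx)
    · filter_upwards [ae_restrict_mem measurableSet_Ioi] with x hx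
      rw [norm_pow, Real.norm_eq_abs]
      gcongr
      exact hMq x (le_of_lt hx)
  have hder : ∀ x ∈ Set.Ioi (0:ℝ), HasDerivAt G (G' x) x := by
    intro x hx
    have hx' : (0:ℝ) < x := hx
    have h1 := (Real.hasDerivAt_rpow_const (x := x) (p := b+1) (Or.inl hx'.ne'))
    have h2 : HasDerivAt (fun x : ℝ => Real.exp (-x)) (-Real.exp (-x)) x := by
      simpa using (hasDerivAt_neg x).exp
    have h3 := (p.hasDerivAt x).div (q.hasDerivAt x) (hq x hx'.le)
    have h4 := (h1.mul h2).mul h3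
    have h4' : HasDerivAt G _ x := h4
    refine h4'.congr_deriv ?_
    simp only [hG', hN, eval_add, eval_mul, eval_sub, eval_C, eval_X, Pi.mul_apply, Pi.div_apply]
    have hqx := hq x hx'.le
    rw [show b + 1 - 1 = b by ring, Real.rpow_add hx', Real.rpow_one]
    field_simp
    ring
  have hcont : ContinuousWithinAt G (Set.Ici 0) 0 := by
    apply ContinuousAt.continuousWithinAt
    apply ContinuousAt.mul
    · apply ContinuousAt.mul
      · exact Real.continuousAt_rpow_const 0 (b+1) (Or.inr (by linarith))
      · fun_prop
    · exact p.continuous.continuousAt.div q.continuous.continuousAt (hq 0 le_rfl)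
  have htop : Filter.Tendsto G Filter.atTop (nhds 0) := by
    have h1 := (rpow_exp_poly_tendsto (b+1) p).abs.mul_const M
    simp only [abs_zero, zero_mul] at h1
    apply squeeze_zero_norm' _ h1
    filter_upwards [Filter.eventually_ge_atTop 0] with x hx
    simp only [hG]
    rw [div_eq_mul_inv, ← mul_assoc, Real.norm_eq_abs, abs_mul]
    gcongr
    exact hMq x hx
  have hI := integral_Ioi_of_hasDerivAt_of_tendsto hcont hder hInt1 htop
  have hG0 : G 0 = 0 := by
    simp only [hG]
    rw [Real.zero_rpow (by linarith)]; simp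
  rw [hG0, sub_zero] at hI
  have hQ := integrable_LL b hb Q
  have e : Set.EqOn (fun x : ℝ => (V.eval x)^2 * (x^b * Real.exp (-x) / (Om.eval x)^2))
      (fun x => P * (x^b * Real.exp (-x) * Q.eval x) + G' x) (Set.Ioi 0) := by
    intro x hx
    have hx' : (0:ℝ) ≤ x := le_of_lt hx
    have h1 := congrArg (Polynomial.eval x) h
    simp only [eval_mul, eval_pow, eval_sub, eval_C] at h1
    have hqx := hq x hx'
    have hox := hOm x hx'
    simp only [hG']
    field_simp
    linear_combination x^b * h1
  rw [setIntegral_congr_fun measurableSet_Ioi e, integral_add (hQ.1.const_mul P) hInt1, integral_const_mul,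
    hQ.2, hI, add_zero]

lemma lagExc_eq (α : ℝ) (F1 F2 : Finset ℕ) (n : ℕ) :
    lagExc α F1 F2 n = lagP α F1 F2 (lag α (n - uF F1 F2)) := rfl

/-- the norm formula, assuming the nonvanishing of `Ω` and the integrability condition at `0` -/
lemma norm_formula (α : ℝ) (hc : ∀ n, poch (α+1) n ≠ 0) (F1 F2 : Finset ℕ)
    (hk : -1 < α + ((F1.card + F2.card : ℕ):ℝ)) (hOm : ∀ x : ℝ, 0 < x → (OmegaL α F1 F2).eval x ≠ 0) (m : ℕ) :
    ∫ x in Set.Ioi (0:ℝ), ((lagP α F1 F2 (lag α m)).eval x)^2 *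
      (x^(α + ((F1.card + F2.card : ℕ):ℝ)) * Real.exp (-x) / ((OmegaL α F1 F2).eval x)^2)
      = (∏ i ∈ range (F1.card + F2.card), ((m:ℝ) - lamF (α+1) F1 F2 i)) *
        (Real.Gamma (m + α + 1) / (Nat.factorial m : ℝ)) := by
  obtain ⟨p, q, hq, h⟩ := norm_identity α hc F1 F2 m
  have hOm' : ∀ x : ℝ, 0 ≤ x → (OmegaL α F1 F2).eval x ≠ 0 := by
    intro x hx
    rcases hx.eq_or_lt with h0 | h0
    · rw [← h0, ← coeff_zero_eq_eval_zero]; exact OmegaL_const α hc F1 F2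
    · exact hOm x h0
  have ha := c_add_ne _ hc
  obtain ⟨Q, p3, q1, hL, hq1, h1⟩ := norm_algebra α ha _ _ _ _ p q _ hq hOm' h
  rw [norm_analysis _ hk _ _ Q p3 q1 _ hq1 hOm' h1, ← hL, LL_lag_sq α ha]

lemma binom_hasSum (c a : ℝ) (ha : 0 ≤ a) (ha1 : a < 1) :
    HasSum (fun j : ℕ => a^j * poch c j / (Nat.factorial j : ℝ)) ((1-a)^(-c)) := by
  have h := (Real.one_div_one_sub_rpow_hasFPowerSeriesOnBall_zero c).hasSum (y := a)
    (by simp [Metric.mem_eball, edist_dist, ENNReal.ofReal_lt_one, abs_of_nonneg ha, ha1])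
  simp only [FormalMultilinearSeries.ofScalars_apply_eq, zero_add] at h
  rw [one_div, ← Real.rpow_neg (by linarith)] at h
  have e : ∀ j : ℕ, Ring.choose (c + j - 1) j = poch c j / (Nat.factorial j : ℝ) := by
    intro j
    have h1 : Ring.choose (c + j - 1) j = Ring.multichoose c j := by
      rw [Ring.choose]; congr 1; ring
    have h2 := Ring.factorial_nsmul_multichoose_eq_ascPochhammer c j
    rw [h1, eq_div_iff (by positivity), mul_comm, ← nsmul_eq_mul, h2, Polynomial.ascPochhammer_smeval_eq_eval]
    clear h1 h2
    induction j with
    | zero => simp [poch]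
    | succ j ih => rw [ascPochhammer_succ_eval, ih, poch_succ]
  have e2 : (fun j : ℕ => a^j * poch c j / (Nat.factorial j : ℝ))
      = fun n : ℕ => Ring.choose (c + (n:ℝ) - 1) n • a ^ n := by
    funext j
    rw [e, smul_eq_mul]; ring
  rw [e2]; exact h

noncomputable def aL (l : ℕ) : ℝ := (l:ℝ)/(l+1)
noncomputable def S0 (c : ℝ) (l : ℕ) : ℝ := (1 - aL l)^(-c)
noncomputable def rho (c : ℝ) (l : ℕ) (j : ℕ) : ℝ := (aL l)^j * poch c j / (Nat.factorial j : ℝ)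
noncomputable def sP (c : ℝ) (i : ℕ) : ℝ[X] := C (1/poch c i) * ∏ t ∈ range i, (C (t:ℝ) - X)
noncomputable def eP (c : ℝ) (l n t : ℕ) : ℝ[X] :=
  ∑ i ∈ range (n+1), C ((n.choose i : ℝ) * (1/(l:ℝ))^(i+t)) * sP c (i+t)
noncomputable def pP (c : ℝ) (j : ℕ) : ℝ[X] := ∏ t ∈ range j, (X + C (c + t))
noncomputable def ellL (c : ℝ) (l : ℕ) (p : ℝ[X]) : ℝ := ∑' j : ℕ, p.eval (j:ℝ) * rho c l j

lemma aL_nonneg (l : ℕ) : 0 ≤ aL l := by unfold aL; positivity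
lemma aL_lt (l : ℕ) : aL l < 1 := by
  unfold aL; rw [div_lt_one (by positivity)]; linarith
lemma one_sub_aL (l : ℕ) : 1 - aL l = ((l:ℝ)+1)⁻¹ := by
  unfold aL; field_simp; ring
lemma S0_eq (c : ℝ) (l : ℕ) : S0 c l = ((l:ℝ)+1)^c := by
  rw [S0, one_sub_aL, Real.inv_rpow (by positivity), ← Real.rpow_neg (by positivity), neg_neg]
lemma S0_pos (c : ℝ) (l : ℕ) : 0 < S0 c l := by rw [S0_eq]; positivity

lemma sP_eval (c x : ℝ) (i : ℕ) : (sP c i).eval x = sC c x i := by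
  unfold sP sC poch
  rw [eval_mul, eval_C, eval_prod]
  simp only [eval_sub, eval_C, eval_X]
  rw [one_div, div_eq_inv_mul]; congr 1
  exact Finset.prod_congr rfl fun t _ => by ring

lemma pP_eval (c x : ℝ) (j : ℕ) : (pP c j).eval x = poch (x + c) j := by
  unfold pP poch
  rw [eval_prod]
  simp only [eval_add, eval_C, eval_X]
  exact Finset.prod_congr rfl fun t _ => by ring

lemma pP_monic (c : ℝ) (j : ℕ) : (pP c j).Monic := monic_prod_of_monic _ _ fun t _ => monic_X_add_C _
lemma pP_deg (c : ℝ) (j : ℕ) : (pP c j).natDegree = j := by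
  unfold pP
  rw [natDegree_prod_of_monic _ _ fun t _ => monic_X_add_C _]
  simp only [natDegree_X_add_C]
  simp

lemma basis_ind (Q : ℝ[X] → Prop) (b : ℕ → ℝ[X]) (hb : ∀ j, (b j).Monic ∧ (b j).natDegree = j)
    (N : ℕ) (h0 : Q 0) (hadd : ∀ p q, Q p → Q q → Q (p+q)) (hQ : ∀ j ≤ N, ∀ r : ℝ, Q (C r * b j)) :
    ∀ p : ℝ[X], p.natDegree ≤ N → Q p := by
  have key : ∀ n ≤ N + 1, ∀ p : ℝ[X], p.degree < n → Q p := by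
    intro n
    induction n with
    | zero =>
      intro _ p hp
      have : p = 0 := by
        rw [← degree_eq_bot]; 
        by_contra hne
        rw [degree_eq_natDegree (by rintro rfl; simp at hne)] at hp
        norm_cast at hp
      rw [this]; exact h0
    | succ n ih =>
      intro hn p hp
      have e : p = (p - C (p.coeff n) * b n) + C (p.coeff n) * b n := by ring
      rw [e]
      apply hadd _ _ _ (hQ n (by omega) _)
      apply ih (by omega)
      rw [degree_lt_iff_coeff_zero]
      intro m hm
      rcases hm.eq_or_lt with h | h
      · have h1 := (hb n).1
        rw [Monic, leadingCoeff, (hb n).2] at h1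
        rw [← h]; simp [h1]
      · rw [coeff_sub, coeff_C_mul, (degree_lt_iff_coeff_zero _ _).mp hp m (by exact_mod_cast h),
          coeff_eq_zero_of_natDegree_lt (p := b n) (by rw [(hb n).2]; exact h)]
        simp
  intro p hp
  apply key (N+1) le_rfl
  exact lt_of_le_of_lt degree_le_natDegree (by exact_mod_cast Nat.lt_succ_of_le hp)

/-- basic moment sums -/
lemma moment_hasSum (c : ℝ) (hc : ∀ n, poch c n ≠ 0) (l i j : ℕ) (hl : 0 < l) :
    HasSum (fun t : ℕ => ((1/(l:ℝ))^i * sC c t i * poch (t + c) j) * rho c l t)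
      ((-1)^i * poch (c+i) j * ((l:ℝ)+1)^j * S0 c l) := by
  have h := (binom_hasSum (c+i+j) (aL l) (aL_nonneg l) (aL_lt l)).mul_left
    ((-1)^i * (1/(l:ℝ))^i * (aL l)^i * poch (c+i) j)
  have hz : ∀ t ∈ range i, ((1/(l:ℝ))^i * sC c (t:ℝ) i * poch (t + c) j) * rho c l t = 0 := by
    intro t ht
    unfold sC
    rw [poch_neg_nat_zero t i (Finset.mem_range.mp ht)]; simp
  rw [← hasSum_nat_add_iff' i, Finset.sum_eq_zero hz, sub_zero]
  have hf : (fun t : ℕ => ((1/(l:ℝ))^i * sC c ((t+i:ℕ):ℝ) i * poch (((t+i:ℕ):ℝ) + c) j) * rho c l (t+i))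
      = fun t : ℕ => ((-1)^i * (1/(l:ℝ))^i * (aL l)^i * poch (c+i) j) *
        ((aL l)^t * poch (c+i+j) t / (Nat.factorial t : ℝ)) := by
    funext r
    unfold sC rho
    have h1 := poch_neg_nat (r+i) i (by omega)
    rw [Nat.add_sub_cancel] at h1
    have h2 : poch c (r+i) = poch c i * poch (c+i) r := by rw [add_comm r i, poch_add]
    have h3 : poch (c+i) r * poch (c+i+r) j = poch (c+i) j * poch (c+i+j) r := by
      rw [← poch_add, ← poch_add, add_comm r j]
    have h4 : ((r+i:ℕ):ℝ) + c = c + i + r := by push_cast; ring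
    rw [h4, h2]
    have hci := hc i
    have f1 : (Nat.factorial r : ℝ) ≠ 0 := by positivity
    have f2 : (Nat.factorial (r+i) : ℝ) ≠ 0 := by positivity
    have h5 : poch (-((r+i:ℕ):ℝ)) i = (-1)^i * (Nat.factorial (r+i) : ℝ) / (Nat.factorial r : ℝ) := by
      rw [eq_div_iff f1, h1]
    rw [h5, pow_add]
    field_simp
    linear_combination (aL l)^i * (aL l)^r * h3
  have hv : (-1)^i * poch (c+i) j * ((l:ℝ)+1)^j * S0 c l =
      ((-1)^i * (1/(l:ℝ))^i * (aL l)^i * poch (c+i) j) * (1 - aL l)^(-(c+i+j)) := by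
    have e1 : (1/(l:ℝ))^i * (aL l)^i * ((l:ℝ)+1)^i = 1 := by
      have : (l:ℝ) ≠ 0 := by positivity
      rw [← mul_pow, ← mul_pow]; unfold aL; field_simp; simp
    have e2 : (1 - aL l)^(-(c+i+j)) = S0 c l * ((l:ℝ)+1)^i * ((l:ℝ)+1)^j := by
      rw [S0_eq, one_sub_aL, Real.inv_rpow (by positivity), ← Real.rpow_neg (by positivity), neg_neg,
        Real.rpow_add (by positivity), Real.rpow_add (by positivity), Real.rpow_natCast, Real.rpow_natCast]
    rw [e2]
    linear_combination (-(-1)^i * poch (c+i) j * S0 c l * ((l:ℝ)+1)^j) * e1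
  rw [hf, hv]; exact h

lemma ell_summable (c : ℝ) (hc : ∀ n, poch c n ≠ 0) (l : ℕ) (hl : 0 < l) (p : ℝ[X]) :
    Summable (fun t : ℕ => p.eval (t:ℝ) * rho c l t) := by
  apply basis_ind (fun p => Summable (fun t : ℕ => p.eval (t:ℝ) * rho c l t)) (pP c)
    (fun j => ⟨pP_monic c j, pP_deg c j⟩) p.natDegree _ _ _ p le_rfl
  · simp
  · intro p q hp hq
    simpa [add_mul] using hp.add hq
  · intro j _ r
    have h := (moment_hasSum c hc l 0 j hl).summable.mul_left r
    refine h.congr fun t => ?_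
    rw [eval_mul, eval_C, pP_eval]
    simp [sC, poch_zero]; ring

lemma ell_add (c : ℝ) (hc : ∀ n, poch c n ≠ 0) (l : ℕ) (hl : 0 < l) (p q : ℝ[X]) :
    ellL c l (p+q) = ellL c l p + ellL c l q := by
  unfold ellL
  rw [← (ell_summable c hc l hl p).tsum_add (ell_summable c hc l hl q)]
  simp [add_mul]

lemma ell_C_mul (c : ℝ) (l : ℕ) (r : ℝ) (p : ℝ[X]) : ellL c l (C r * p) = r * ellL c l p := by
  unfold ellL
  rw [← tsum_mul_left]
  simp [mul_assoc]

lemma ell_zero (c : ℝ) (l : ℕ) : ellL c l 0 = 0 := by simp [ellL]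

lemma ell_sum (c : ℝ) (hc : ∀ n, poch c n ≠ 0) (l : ℕ) (hl : 0 < l) {ι : Type} (s : Finset ι)
    (f : ι → ℝ[X]) : ellL c l (∑ i ∈ s, f i) = ∑ i ∈ s, ellL c l (f i) := by
  classical
  induction s using Finset.induction_on with
  | empty => simp [ell_zero]
  | insert i s hi ih => rw [sum_insert hi, sum_insert hi, ell_add c hc l hl, ih]

lemma eP_zero (c : ℝ) (l t : ℕ) : eP c l 0 t = C ((1/(l:ℝ))^t) * sP c t := by
  simp [eP]

lemma eP_succ (c : ℝ) (l n t : ℕ) : eP c l (n+1) t = eP c l n t + eP c l n (t+1) := by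
  unfold eP
  rw [Finset.sum_range_succ' _ (n+1)]
  have h1 : ∀ i ∈ range (n+1), C (((n+1).choose (i+1) : ℝ) * (1/(l:ℝ))^(i+1+t)) * sP c (i+1+t)
      = C ((n.choose (i+1) : ℝ) * (1/(l:ℝ))^(i+1+t)) * sP c (i+1+t)
        + C ((n.choose i : ℝ) * (1/(l:ℝ))^(i+(t+1))) * sP c (i+(t+1)) := by
    intro i _
    rw [show i + 1 + t = i + (t+1) by ring, Nat.choose_succ_succ, Nat.cast_add, ← add_mul, ← C_add]
    congr 2; ring
  rw [Finset.sum_congr rfl h1, Finset.sum_add_distrib]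
  have h2 : ∑ i ∈ range (n+1), C ((n.choose i : ℝ) * (1/(l:ℝ))^(i+t)) * sP c (i+t)
      = ∑ i ∈ range (n+1), C ((n.choose (i+1) : ℝ) * (1/(l:ℝ))^(i+1+t)) * sP c (i+1+t)
        + C ((n.choose 0 : ℝ) * (1/(l:ℝ))^(0+t)) * sP c (0+t) := by
    rw [Finset.sum_range_succ' _ n, Finset.sum_range_succ _ n, Nat.choose_succ_self]
    simp
  rw [h2]
  simp only [Nat.choose_zero_right]
  ring

lemma ell_eP_pP (c : ℝ) (hc : ∀ n, poch c n ≠ 0) (l : ℕ) (hl : 0 < l) (n t j : ℕ) :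
    ellL c l (eP c l n t * pP c j) =
      (-1)^(t+n) * (j.descFactorial n : ℝ) * poch (c+t+n) (j-n) * ((l:ℝ)+1)^j * S0 c l := by
  induction n generalizing t with
  | zero =>
    have h := (moment_hasSum c hc l t j hl).tsum_eq
    rw [eP_zero]
    simp only [Nat.descFactorial_zero, Nat.cast_one, mul_one, add_zero, Nat.sub_zero, Nat.cast_zero]
    rw [← h]
    unfold ellL
    congr 1; funext r
    rw [eval_mul, eval_mul, eval_C, sP_eval, pP_eval]
  | succ n ih =>
    rw [eP_succ, add_mul, ell_add c hc l hl, ih, ih]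
    rcases le_or_gt j n with h | h
    · rw [Nat.sub_eq_zero_of_le h, Nat.descFactorial_eq_zero_iff_lt.mpr (show j < n + 1 by omega)]
      simp only [poch_zero]
      push_cast
      ring
    · obtain ⟨r, rfl⟩ := Nat.exists_eq_add_of_lt h
      rw [show n + r + 1 - n = r + 1 by omega, show n + r + 1 - (n+1) = r by omega,
        Nat.descFactorial_succ, show n + r + 1 - n = r + 1 by omega]
      have e1 : poch (c+t+n) (r+1) = (c+t+n) * poch (c+t+n+1) r := by
        rw [add_comm r 1, poch_add]
        simp [poch]
      have e2 : poch (c+(t+1:ℕ)+n) (r+1) = poch (c+t+n+1) r * (c+t+n+1+r) := by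
        rw [show c + ((t+1:ℕ):ℝ) + n = c + t + n + 1 by push_cast; ring, poch_succ]
      have e3 : poch (c+t+((n+1:ℕ):ℝ)) r = poch (c+t+n+1) r := by
        congr 1; push_cast; ring
      rw [e1, e2, e3]
      push_cast
      ring

lemma ell_eP (c : ℝ) (hc : ∀ n, poch c n ≠ 0) (l : ℕ) (hl : 0 < l) (n t : ℕ) (p : ℝ[X])
    (hp : p.natDegree ≤ n) :
    ellL c l (eP c l n t * p) = (-1)^(t+n) * p.coeff n * (Nat.factorial n : ℝ) * ((l:ℝ)+1)^n * S0 c l := by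
  apply basis_ind (fun p => ellL c l (eP c l n t * p) =
    (-1)^(t+n) * p.coeff n * (Nat.factorial n : ℝ) * ((l:ℝ)+1)^n * S0 c l) (pP c)
    (fun j => ⟨pP_monic c j, pP_deg c j⟩) n _ _ _ p hp
  · simp [ell_zero]
  · intro p q hp hq
    rw [mul_add, ell_add c hc l hl, hp, hq, coeff_add]; ring
  · intro j hj r
    rw [show eP c l n t * (C r * pP c j) = C r * (eP c l n t * pP c j) by ring, ell_C_mul,
      ell_eP_pP c hc l hl, coeff_C_mul]
    rcases hj.eq_or_lt with h | h
    · have h1 := pP_monic c j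
      rw [Monic, leadingCoeff, pP_deg] at h1
      rw [← h, h1, Nat.descFactorial_self, Nat.sub_self, poch_zero]; ring
    · rw [coeff_eq_zero_of_natDegree_lt (by rw [pP_deg]; exact h), Nat.descFactorial_eq_zero_iff_lt.mpr h]
      simp

lemma sP_natDegree_le (c : ℝ) (i : ℕ) : (sP c i).natDegree ≤ i := by
  unfold sP
  refine (natDegree_C_mul_le _ _).trans ?_
  refine (natDegree_prod_le _ _).trans ?_
  calc ∑ t ∈ range i, (C (t:ℝ) - X).natDegree ≤ ∑ t ∈ range i, 1 := by
        apply Finset.sum_le_sum; intro t _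
        compute_degree
    _ = i := by simp

lemma sP_coeff (c : ℝ) (i : ℕ) : (sP c i).coeff i = (-1)^i / poch c i := by
  unfold sP
  have h : ∏ t ∈ range i, (C (t:ℝ) - X) = C ((-1)^i) * ∏ t ∈ range i, (X - C (t:ℝ)) := by
    have : ∀ t ∈ range i, (C (t:ℝ) - X) = C (-1) * (X - C (t:ℝ)) := by
      intro t _; simp
    rw [Finset.prod_congr rfl this, Finset.prod_mul_distrib, Finset.prod_const, card_range, C_pow]
  have hm : (∏ t ∈ range i, (X - C (t:ℝ))).Monic := monic_prod_of_monic _ _ fun t _ => monic_X_sub_C _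
  have hd : (∏ t ∈ range i, (X - C (t:ℝ))).natDegree = i := by
    rw [natDegree_prod_of_monic _ _ fun t _ => monic_X_sub_C _]
    simp only [natDegree_X_sub_C]
    simp
  rw [Monic, leadingCoeff, hd] at hm
  rw [h, coeff_C_mul, coeff_C_mul, hm]; ring

lemma eP_natDegree_le (c : ℝ) (l n t : ℕ) : (eP c l n t).natDegree ≤ n + t := by
  unfold eP
  apply natDegree_sum_le_of_forall_le
  intro i hi
  refine (natDegree_C_mul_le _ _).trans ((sP_natDegree_le c (i+t)).trans ?_)
  have := Finset.mem_range.mp hi; omega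

lemma eP_coeff (c : ℝ) (l n t : ℕ) :
    (eP c l n t).coeff (n+t) = (1/(l:ℝ))^(n+t) * ((-1)^(n+t) / poch c (n+t)) := by
  unfold eP
  rw [finsetSum_coeff, Finset.sum_eq_single n]
  · rw [coeff_C_mul, sP_coeff]; simp
  · intro i hi hin
    have := Finset.mem_range.mp hi
    rw [coeff_C_mul, coeff_eq_zero_of_natDegree_lt (lt_of_le_of_lt (sP_natDegree_le c (i+t)) (by omega)), mul_zero]
  · intro h; simp at h

noncomputable def OmD (c : ℝ) (lam : ℕ → ℝ) (k l n : ℕ) : ℝ :=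
  (Matrix.of fun i t : Fin k => (eP c l n t).eval (lam i)).det

noncomputable def minD (c : ℝ) (lam : ℕ → ℝ) (k l n : ℕ) (t : Fin (k+1)) : ℝ :=
  (Matrix.of fun i j : Fin k => (eP c l n (t.succAbove j)).eval (lam i)).det

noncomputable def NP (c : ℝ) (lam : ℕ → ℝ) (k l n : ℕ) : ℝ[X] :=
  ∑ t : Fin (k+1), C ((-1)^(t:ℕ) * minD c lam k l n t) * eP c l n t

noncomputable def rowM (c : ℝ) (lam : ℕ → ℝ) (k l n : ℕ) (r : Fin (k+1) → ℝ) :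
    Matrix (Fin (k+1)) (Fin (k+1)) ℝ :=
  Matrix.of (Fin.cons r (fun (i : Fin k) (t : Fin (k+1)) => (eP c l n t).eval (lam i)))

lemma rowM_det (c : ℝ) (lam : ℕ → ℝ) (k l n : ℕ) (r : Fin (k+1) → ℝ) :
    (rowM c lam k l n r).det = ∑ t : Fin (k+1), (-1)^(t:ℕ) * r t * minD c lam k l n t := by
  rw [Matrix.det_succ_row_zero]
  rfl

lemma NP_eval (c : ℝ) (lam : ℕ → ℝ) (k l n : ℕ) (x : ℝ) :
    (NP c lam k l n).eval x = (rowM c lam k l n fun t => (eP c l n t).eval x).det := by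
  rw [rowM_det, NP, eval_finsetSum]
  refine Finset.sum_congr rfl fun t _ => ?_
  rw [eval_mul, eval_C]; ring

lemma NP_root (c : ℝ) (lam : ℕ → ℝ) (k l n i : ℕ) (hi : i < k) :
    (NP c lam k l n).eval (lam i) = 0 := by
  rw [NP_eval]
  apply Matrix.det_zero_of_row_eq (i := 0) (j := Fin.succ ⟨i, hi⟩) (Fin.succ_ne_zero _).symm
  rfl

lemma rowM_alt (c : ℝ) (lam : ℕ → ℝ) (k l n : ℕ) :
    (rowM c lam k l n fun t => (-1)^(t:ℕ)).det = OmD c lam k l (n+1) := by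
  let B : Matrix (Fin (k+1)) (Fin (k+1)) ℝ := fun i => Fin.cons (rowM c lam k l n (fun t => (-1)^(t:ℕ)) i 0)
    (fun j : Fin k => rowM c lam k l n (fun t => (-1)^(t:ℕ)) i j.succ
      + rowM c lam k l n (fun t => (-1)^(t:ℕ)) i j.castSucc)
  have h := Matrix.det_eq_of_forall_col_eq_smul_add_pred (A := rowM c lam k l n fun t => (-1)^(t:ℕ)) (B := B)
    (fun _ => -1) (fun i => by simp [B]) (fun i j => by simp [B])
  rw [h, Matrix.det_succ_row_zero, Fin.sum_univ_succ]
  have h0 : ∀ j : Fin k, B 0 j.succ = 0 := by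
    intro j
    simp only [B, Fin.cons_succ, rowM, Matrix.of_apply, Fin.cons_zero]
    simp [pow_succ]
  have h00 : B 0 0 = 1 := by
    simp [B, rowM]
  simp only [h0, h00]
  simp only [Fin.val_zero, pow_zero, mul_zero, zero_mul, Finset.sum_const_zero, add_zero, one_mul, mul_one]
  unfold OmD
  congr 1
  ext i t
  rw [Matrix.of_apply, eP_succ, eval_add, add_comm (eval _ _)]; rfl

lemma ell_NP (c : ℝ) (hc : ∀ n, poch c n ≠ 0) (lam : ℕ → ℝ) (k l n : ℕ) (hl : 0 < l) (p : ℝ[X])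
    (hp : p.natDegree ≤ n) :
    ellL c l (NP c lam k l n * p) =
      (-1)^n * p.coeff n * (Nat.factorial n : ℝ) * ((l:ℝ)+1)^n * S0 c l * OmD c lam k l (n+1) := by
  rw [NP, Finset.sum_mul, ell_sum c hc l hl, ← rowM_alt, rowM_det, Finset.mul_sum]
  refine Finset.sum_congr rfl fun t _ => ?_
  rw [mul_assoc, ell_C_mul, ell_eP c hc l hl n t p hp]
  ring

lemma NP_natDegree_le (c : ℝ) (lam : ℕ → ℝ) (k l n : ℕ) : (NP c lam k l n).natDegree ≤ n + k := by
  unfold NP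
  apply natDegree_sum_le_of_forall_le
  intro t _
  refine (natDegree_C_mul_le _ _).trans ((eP_natDegree_le c l n t).trans ?_)
  have := t.2; omega

lemma NP_coeff (c : ℝ) (lam : ℕ → ℝ) (k l n : ℕ) : (NP c lam k l n).coeff (n+k) =
    (-1)^n * (1/(l:ℝ))^(n+k) * OmD c lam k l n / poch c (n+k) := by
  unfold NP
  rw [finsetSum_coeff, Finset.sum_eq_single (Fin.last k)]
  · rw [coeff_C_mul, Fin.val_last, eP_coeff]
    have : minD c lam k l n (Fin.last k) = OmD c lam k l n := by
      unfold minD OmD; congr 1; ext i j; simp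
    rw [this, pow_add (-1:ℝ) n k]
    have : ((-1:ℝ)^k)*(-1)^k = 1 := by rw [← mul_pow]; simp
    linear_combination ((-1)^n * (1/(l:ℝ))^(n+k) * OmD c lam k l n / poch c (n+k)) * this
  · intro t _ ht
    have h1 : (t:ℕ) ≠ k := fun h => ht (Fin.ext h)
    have := t.2
    rw [coeff_C_mul, coeff_eq_zero_of_natDegree_lt (lt_of_le_of_lt (eP_natDegree_le c l n t) (by omega)), mul_zero]
  · simp

noncomputable def PP (lam : ℕ → ℝ) (k : ℕ) : ℝ[X] := ∏ i ∈ range k, (X - C (lam i))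

lemma PP_monic (lam : ℕ → ℝ) (k : ℕ) : (PP lam k).Monic := monic_prod_of_monic _ _ fun _ _ => monic_X_sub_C _
lemma PP_deg (lam : ℕ → ℝ) (k : ℕ) : (PP lam k).natDegree = k := by
  unfold PP
  rw [natDegree_prod_of_monic _ _ fun _ _ => monic_X_sub_C _]
  simp only [natDegree_X_sub_C]
  simp

lemma exists_q (c : ℝ) (lam : ℕ → ℝ) (k l n : ℕ)
    (hinj : ∀ i < k, ∀ j < k, lam i = lam j → i = j) :
    ∃ q : ℝ[X], NP c lam k l n = PP lam k * q ∧ q.natDegree ≤ n ∧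
      q.coeff n = (-1)^n * (1/(l:ℝ))^(n+k) * OmD c lam k l n / poch c (n+k) := by
  have hd : PP lam k ∣ NP c lam k l n := by
    unfold PP
    apply Finset.prod_dvd_of_coprime
    · intro i hi j hj hij
      apply pairwise_coprime_X_sub_C (s := fun x : ℝ => x) Function.injective_id
      intro h
      exact hij (hinj i (by simpa using hi) j (by simpa using hj) h)
    · intro i hi
      rw [dvd_iff_isRoot]
      exact NP_root c lam k l n i (Finset.mem_range.mp hi)
  obtain ⟨q, hq⟩ := hd
  have hdeg : q.natDegree ≤ n := by
    by_cases h0 : q = 0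
    · simp [h0]
    have h1 := NP_natDegree_le c lam k l n
    rw [hq, (PP_monic lam k).natDegree_mul' h0, PP_deg] at h1
    omega
  refine ⟨q, hq, hdeg, ?_⟩
  rw [← NP_coeff, hq, add_comm n k, coeff_mul_add_eq_of_natDegree_le (PP_deg lam k).le hdeg]
  have := PP_monic lam k
  rw [Monic, leadingCoeff, PP_deg] at this
  rw [this, one_mul]

lemma eP_eval_zero (c : ℝ) (l t : ℕ) (x : ℝ) : (eP c l 0 t).eval x = (1/(l:ℝ))^t * sC c x t := by
  rw [eP_zero, eval_mul, eval_C, sP_eval]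

lemma OmD_zero_ne (c : ℝ) (hc : ∀ n, poch c n ≠ 0) (lam : ℕ → ℝ) (k l : ℕ) (hl : 0 < l)
    (hinj : ∀ i < k, ∀ j < k, lam i = lam j → i = j) : OmD c lam k l 0 ≠ 0 := by
  unfold OmD
  have : (Matrix.of fun i t : Fin k => (eP c l 0 t).eval (lam i))
      = Matrix.of fun i t : Fin k => (1/(l:ℝ))^(t:ℕ) * (Matrix.of fun i t : Fin k => sC c (lam i) t) i t := by
    ext i t; simp [eP_eval_zero]
  rw [this, Matrix.det_mul_row]
  apply mul_ne_zero
  · apply Finset.prod_ne_zero_iff.mpr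
    intro t _
    have : (l:ℝ) ≠ 0 := by positivity
    positivity
  · exact det_sC_ne c hc k (fun i => lam i) (fun i j h => Fin.ext (hinj i i.2 j j.2 h))

lemma ell_lower (c : ℝ) (hc : ∀ n, poch c n ≠ 0) (lam : ℕ → ℝ) (k l : ℕ) (hl : 0 < l) (κ : ℝ)
    (hpos : ∀ j : ℕ, 0 ≤ κ * (PP lam k).eval (j:ℝ) * poch c j)
    (q : ℝ[X]) (m : ℕ) :
    (κ * (PP lam k).eval (m:ℝ) * rho c l m) * (q.eval (m:ℝ))^2 ≤ κ * ellL c l (PP lam k * (q * q)) := by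
  have hs := (ell_summable c hc l hl (PP lam k * (q*q))).mul_left κ
  have h := hs.le_tsum m (fun j _ => by
    have h1 := hpos j
    have h2 : 0 ≤ (aL l)^j / (Nat.factorial j : ℝ) := by have := aL_nonneg l; positivity
    have h3 := mul_nonneg (mul_nonneg h1 h2) (sq_nonneg (q.eval (j:ℝ)))
    refine h3.trans_eq ?_
    rw [eval_mul, eval_mul, rho]; ring)
  rw [tsum_mul_left] at h
  refine le_trans (le_of_eq ?_) h
  rw [eval_mul, eval_mul]; ring

lemma rho_pos (c : ℝ) (hc : ∀ n, poch c n ≠ 0) (lam : ℕ → ℝ) (k l : ℕ) (hl : 0 < l) (κ : ℝ) (F : Finset ℕ)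
    (hpos : ∀ j : ℕ, 0 ≤ κ * (PP lam k).eval (j:ℝ) * poch c j)
    (hposs : ∀ j : ℕ, j ∉ F → 0 < κ * (PP lam k).eval (j:ℝ) * poch c j)
    (m : ℕ) (hm : m ∉ F) : 0 < κ * (PP lam k).eval (m:ℝ) * rho c l m := by
  have h1 := hposs m hm
  have ha : 0 < aL l := by unfold aL; positivity
  have h2 : 0 < (aL l)^m / (Nat.factorial m : ℝ) := by positivity
  refine (mul_pos h1 h2).trans_eq ?_
  rw [rho]; ring

lemma ell_posdef (c : ℝ) (hc : ∀ n, poch c n ≠ 0) (lam : ℕ → ℝ) (k l : ℕ) (hl : 0 < l) (κ : ℝ) (F : Finset ℕ)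
    (hpos : ∀ j : ℕ, 0 ≤ κ * (PP lam k).eval (j:ℝ) * poch c j)
    (hposs : ∀ j : ℕ, j ∉ F → 0 < κ * (PP lam k).eval (j:ℝ) * poch c j)
    (q : ℝ[X]) (hq : q ≠ 0) : 0 < κ * ellL c l (PP lam k * (q * q)) := by
  obtain ⟨m, hm, hqm⟩ : ∃ m : ℕ, m ∉ F ∧ q.eval (m:ℝ) ≠ 0 := by
    by_contra hcon
    push Not at hcon
    have hinf : {m : ℕ | m ∉ F}.Infinite := by
      have := F.finite_toSet.infinite_compl
      exact this
    have hinf2 := hinf.image (f := fun m : ℕ => (m:ℝ)) (fun a _ b _ h => Nat.cast_injective (R := ℝ) h)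
    apply hq
    apply eq_zero_of_infinite_isRoot
    apply hinf2.mono
    rintro _ ⟨m, hm, rfl⟩
    exact hcon m hm
  have h1 := ell_lower c hc lam k l hl κ hpos q m
  have h2 := rho_pos c hc lam k l hl κ F hpos hposs m hm
  have : 0 < (q.eval (m:ℝ))^2 := by positivity
  exact lt_of_lt_of_le (mul_pos h2 this) h1

/-- The main discrete step: Casorati determinants do not vanish and squared norms have a definite sign. -/
lemma OmD_step (c : ℝ) (hc : ∀ n, poch c n ≠ 0) (lam : ℕ → ℝ) (k l : ℕ) (hl : 0 < l) (κ : ℝ) (F : Finset ℕ)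
    (hpos : ∀ j : ℕ, 0 ≤ κ * (PP lam k).eval (j:ℝ) * poch c j)
    (hposs : ∀ j : ℕ, j ∉ F → 0 < κ * (PP lam k).eval (j:ℝ) * poch c j)
    (hinj : ∀ i < k, ∀ j < k, lam i = lam j → i = j)
    (n : ℕ) (h : OmD c lam k l n ≠ 0) :
    0 < κ * ((1/(l:ℝ))^(n+k) * (Nat.factorial n : ℝ) * ((l:ℝ)+1)^n * S0 c l * OmD c lam k l n
      * OmD c lam k l (n+1) / poch c (n+k)) := by
  obtain ⟨q, h1, h2, h3⟩ := exists_q c lam k l n hinj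
  have hl' : (l:ℝ) ≠ 0 := by positivity
  have hq : q ≠ 0 := by
    intro h0
    rw [h0, coeff_zero] at h3
    have : (-1)^n * (1/(l:ℝ))^(n+k) * OmD c lam k l n / poch c (n+k) ≠ 0 :=
      div_ne_zero (mul_ne_zero (by positivity) h) (hc _)
    exact this h3.symm
  have h4 := ell_posdef c hc lam k l hl κ F hpos hposs q hq
  rw [← mul_assoc, ← h1, ell_NP c hc lam k l n hl q h2, h3] at h4
  refine h4.trans_eq ?_
  have : ((-1:ℝ)^n)*(-1)^n = 1 := by rw [← mul_pow]; simp
  linear_combination (κ * ((1/(l:ℝ))^(n+k) * (Nat.factorial n : ℝ) * ((l:ℝ)+1)^n * S0 c l * OmD c lam k l n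
      * OmD c lam k l (n+1) / poch c (n+k))) * this

lemma OmD_ne (c : ℝ) (hc : ∀ n, poch c n ≠ 0) (lam : ℕ → ℝ) (k l : ℕ) (hl : 0 < l) (κ : ℝ) (F : Finset ℕ)
    (hpos : ∀ j : ℕ, 0 ≤ κ * (PP lam k).eval (j:ℝ) * poch c j)
    (hposs : ∀ j : ℕ, j ∉ F → 0 < κ * (PP lam k).eval (j:ℝ) * poch c j)
    (hinj : ∀ i < k, ∀ j < k, lam i = lam j → i = j)
    (n : ℕ) : OmD c lam k l n ≠ 0 := by
  induction n with
  | zero => exact OmD_zero_ne c hc lam k l hl hinj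
  | succ n ih =>
    have h := OmD_step c hc lam k l hl κ F hpos hposs hinj n ih
    intro h0
    rw [h0] at h
    simp at h

/-- Bessel inequality. -/
lemma bessel (c : ℝ) (hc : ∀ n, poch c n ≠ 0) (lam : ℕ → ℝ) (k l : ℕ) (hl : 0 < l) (κ : ℝ) (F : Finset ℕ)
    (hpos : ∀ j : ℕ, 0 ≤ κ * (PP lam k).eval (j:ℝ) * poch c j)
    (hposs : ∀ j : ℕ, j ∉ F → 0 < κ * (PP lam k).eval (j:ℝ) * poch c j)
    (hinj : ∀ i < k, ∀ j < k, lam i = lam j → i = j)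
    (m : ℕ) (hm : m ∉ F) (M : ℕ) :
    ∑ n ∈ range M, ((NP c lam k l n).eval (m:ℝ))^2 / (((PP lam k).eval (m:ℝ))^2 *
      (κ * ((1/(l:ℝ))^(n+k) * (Nat.factorial n : ℝ) * ((l:ℝ)+1)^n * S0 c l * OmD c lam k l n
      * OmD c lam k l (n+1) / poch c (n+k))))
      ≤ 1 / (κ * (PP lam k).eval (m:ℝ) * rho c l m) := by
  choose q hq1 hq2 hq3 using fun n => exists_q c lam k l n hinj
  set h : ℕ → ℝ := fun n => ((1/(l:ℝ))^(n+k) * (Nat.factorial n : ℝ) * ((l:ℝ)+1)^n * S0 c l * OmD c lam k l n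
      * OmD c lam k l (n+1) / poch c (n+k)) with hh
  have hhpos : ∀ n, 0 < κ * h n := fun n => OmD_step c hc lam k l hl κ F hpos hposs hinj n
    (OmD_ne c hc lam k l hl κ F hpos hposs hinj n)
  have hdiag : ∀ n, ellL c l (PP lam k * (q n * q n)) = h n := by
    intro n
    rw [← mul_assoc, ← hq1, ell_NP c hc lam k l n hl _ (hq2 n), hq3]
    have : ((-1:ℝ)^n)*(-1)^n = 1 := by rw [← mul_pow]; simp
    simp only [hh]
    linear_combination (((1/(l:ℝ))^(n+k) * (Nat.factorial n : ℝ) * ((l:ℝ)+1)^n * S0 c l * OmD c lam k l n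
      * OmD c lam k l (n+1) / poch c (n+k))) * this
  have hlt : ∀ i j, i < j → ellL c l (PP lam k * (q i * q j)) = 0 := by
    intro i j hij
    rw [mul_comm (q i), ← mul_assoc, ← hq1, ell_NP c hc lam k l j hl _ ((hq2 i).trans hij.le),
      coeff_eq_zero_of_natDegree_lt (lt_of_le_of_lt (hq2 i) hij)]
    simp
  have hoff : ∀ i j, i ≠ j → ellL c l (PP lam k * (q i * q j)) = 0 := by
    intro i j hij
    rcases lt_or_gt_of_ne hij with h | h
    · exact hlt i j h
    · rw [mul_comm (q i)]; exact hlt j i h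
  have hPm : (PP lam k).eval (m:ℝ) ≠ 0 := by
    intro h0; have := hposs m hm; rw [h0] at this; simp at this
  have hκ : κ ≠ 0 := by
    intro h0; have := hposs m hm; rw [h0] at this; simp at this
  have hN : ∀ n, (NP c lam k l n).eval (m:ℝ) = (PP lam k).eval (m:ℝ) * (q n).eval (m:ℝ) := by
    intro n; rw [hq1, eval_mul]
  have hterm : ∀ n ∈ range M, ((NP c lam k l n).eval (m:ℝ))^2 / (((PP lam k).eval (m:ℝ))^2 * (κ * h n))
      = ((q n).eval (m:ℝ))^2 / (κ * h n) := by
    intro n _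
    have := (hhpos n).ne'
    rw [hN]; field_simp
  rw [Finset.sum_congr rfl hterm]
  set T := ∑ n ∈ range M, ((q n).eval (m:ℝ))^2 / (κ * h n) with hT
  have hT0 : 0 ≤ T := Finset.sum_nonneg fun n _ => div_nonneg (sq_nonneg _) (hhpos n).le
  let Kp : ℝ[X] := ∑ n ∈ range M, C ((q n).eval (m:ℝ) / (κ * h n)) * q n
  have hKe : Kp.eval (m:ℝ) = T := by
    simp only [Kp, eval_finsetSum, eval_mul, eval_C, hT]
    refine Finset.sum_congr rfl fun n _ => by ring
  have hKl : κ * ellL c l (PP lam k * (Kp * Kp)) = T := by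
    have e1 : PP lam k * (Kp * Kp) = ∑ i ∈ range M, ∑ j ∈ range M,
        C (((q i).eval (m:ℝ) / (κ * h i)) * ((q j).eval (m:ℝ) / (κ * h j))) * (PP lam k * (q i * q j)) := by
      simp only [Kp]
      rw [Finset.sum_mul_sum, Finset.mul_sum]
      refine Finset.sum_congr rfl fun i _ => ?_
      rw [Finset.mul_sum]
      refine Finset.sum_congr rfl fun j _ => ?_
      rw [C_mul]; ring
    rw [e1, ell_sum c hc l hl, Finset.mul_sum, hT]
    refine Finset.sum_congr rfl fun i hi => ?_
    rw [ell_sum c hc l hl, Finset.sum_eq_single i]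
    · rw [ell_C_mul, hdiag]
      have h5 := (hhpos i).ne'
      have h6 : h i ≠ 0 := right_ne_zero_of_mul h5
      field_simp
    · intro j _ hji
      rw [ell_C_mul, hoff i j hji.symm, mul_zero]
    · intro hi'; exact absurd hi hi'
  have hlow := ell_lower c hc lam k l hl κ hpos Kp m
  rw [hKl, hKe] at hlow
  have hr := rho_pos c hc lam k l hl κ F hpos hposs m hm
  rw [le_div_iff₀ hr]
  rcases hT0.eq_or_lt with h0 | h0
  · rw [← h0]; simp
  · have : T * ((κ * (PP lam k).eval (m:ℝ) * rho c l m) * T) ≤ T * 1 := by linarith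
    have := le_of_mul_le_mul_left this h0
    linarith

open Filter Topology

noncomputable def DN (c : ℝ) (l n t : ℕ) (y : ℝ) : ℝ :=
  ∑ i ∈ range (n+1), ((n.choose i : ℝ) * (1/(l:ℝ))^i) * sC c y (i+t)

noncomputable def Phi (c y : ℝ) (t : ℕ) (x : ℝ) : ℝ :=
  ∑' i : ℕ, (x^i / (Nat.factorial i : ℝ)) * sC c y (i+t)

lemma eP_eval_DN (c : ℝ) (l n t : ℕ) (y : ℝ) : (eP c l n t).eval y = (1/(l:ℝ))^t * DN c l n t y := by
  unfold eP DN
  rw [eval_finsetSum, Finset.mul_sum]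
  refine Finset.sum_congr rfl fun i _ => ?_
  rw [eval_mul, eval_C, sP_eval, pow_add]; ring

lemma sC_bound (c y : ℝ) (hc : ∀ n, poch c n ≠ 0) : ∃ B : ℝ, 0 < B ∧ ∀ i, |sC c y i| ≤ B^i := by
  have hlim : Tendsto (fun i : ℕ => ((i:ℝ) - y) / (c + i)) atTop (𝓝 1) := by
    have h1 : Tendsto (fun i : ℕ => (1 - y / (i:ℝ)) / (c / (i:ℝ) + 1)) atTop (𝓝 ((1 - 0)/(0+1))) := by
      apply Tendsto.div
      · exact tendsto_const_nhds.sub (tendsto_const_div_atTop_nhds_zero_nat y)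
      · exact (tendsto_const_div_atTop_nhds_zero_nat c).add tendsto_const_nhds
      · norm_num
    have e : ((1:ℝ) - 0)/(0+1) = 1 := by norm_num
    rw [e] at h1
    apply h1.congr'
    filter_upwards [eventually_gt_atTop 0] with i hi
    have hi' : (i:ℝ) ≠ 0 := by positivity
    have := c_add_ne c hc i
    have h2 : c / (i:ℝ) + 1 ≠ 0 := by
      have : c / (i:ℝ) + 1 = (c+i)/i := by field_simp
      rw [this]; positivity
    field_simp
  obtain ⟨B, hB⟩ := (Metric.isBounded_range_of_tendsto _ hlim).exists_norm_le
  refine ⟨|B| + 1, by positivity, fun i => ?_⟩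
  induction i with
  | zero => simp [sC, poch_zero]
  | succ i ih =>
    have h1 := sC_succ c y hc i
    have h2 := c_add_ne c hc i
    have h3 : sC c y (i+1) = (((i:ℝ) - y) / (c+i)) * sC c y i := by
      field_simp; linear_combination h1
    have h4 := hB _ ⟨i, rfl⟩
    rw [Real.norm_eq_abs] at h4
    rw [h3, abs_mul, pow_succ, mul_comm]
    have h5 : |((i:ℝ) - y) / (c+i)| ≤ |B| + 1 := by
      have := le_abs_self B; linarith
    gcongr

lemma choose_real_rec (n i : ℕ) : ((n.choose (i+1) : ℕ) : ℝ) * (i+1) = (n.choose i : ℝ) * ((n:ℝ) - i) := by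
  have h := Nat.choose_succ_right_eq n i
  rcases le_or_gt i n with hi | hi
  · have : (((n - i : ℕ)) : ℝ) = (n:ℝ) - i := Nat.cast_sub hi
    rw [← this]; exact_mod_cast h
  · rw [Nat.choose_eq_zero_of_lt hi, Nat.choose_eq_zero_of_lt (by omega)]; simp

lemma choose_tendsto (n : ℕ → ℕ) (x : ℝ) (hn : Tendsto (fun l : ℕ => (n l : ℝ) / l) atTop (𝓝 x)) (i : ℕ) :
    Tendsto (fun l : ℕ => ((n l).choose i : ℝ) * (1/(l:ℝ))^i) atTop (𝓝 (x^i / (Nat.factorial i : ℝ))) := by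
  induction i with
  | zero => simp
  | succ i ih =>
    have h1 : Tendsto (fun l : ℕ => (n l : ℝ) / l - (i:ℝ) / l) atTop (𝓝 (x - 0)) :=
      hn.sub (tendsto_const_div_atTop_nhds_zero_nat (i:ℝ))
    have h2 := (ih.mul h1).div_const ((i:ℝ)+1)
    have e : x ^ i / (Nat.factorial i : ℝ) * (x - 0) / ((i:ℝ)+1) = x^(i+1) / (Nat.factorial (i+1) : ℝ) := by
      rw [Nat.factorial_succ]; push_cast; field_simp; ring
    rw [e] at h2
    refine h2.congr fun l => ?_
    have h3 := choose_real_rec (n l) i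
    have h4 : (((n l).choose (i+1) : ℕ) : ℝ) = ((n l).choose i : ℝ) * ((n l:ℝ) - i) / ((i:ℝ)+1) := by
      rw [eq_div_iff (by positivity), h3]
    rw [h4, pow_succ]
    ring

lemma choose_bound (n l i : ℕ) (R : ℝ) (h : (n:ℝ)/l ≤ R) :
    ((n.choose i : ℝ) * (1/(l:ℝ))^i) ≤ R^i / (Nat.factorial i : ℝ) := by
  have h1 := Nat.choose_le_pow_div (α := ℝ) i n
  calc ((n.choose i : ℝ) * (1/(l:ℝ))^i) ≤ ((n:ℝ)^i / (Nat.factorial i : ℝ)) * (1/(l:ℝ))^i := by gcongr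
    _ = ((n:ℝ)/l)^i / (Nat.factorial i : ℝ) := by rw [div_pow (n:ℝ) (l:ℝ), div_pow, one_pow]; field_simp
    _ ≤ _ := by gcongr

lemma sC_summable (c y : ℝ) (hc : ∀ n, poch c n ≠ 0) (t : ℕ) (R : ℝ) (hR : 0 ≤ R) :
    Summable (fun i : ℕ => (R^i / (Nat.factorial i : ℝ)) * |sC c y (i+t)|) := by
  obtain ⟨B, hB, h⟩ := sC_bound c y hc
  refine Summable.of_nonneg_of_le (fun i => by positivity) (fun i => ?_)
    ((Real.summable_pow_div_factorial (R * B)).mul_right (B^t))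
  calc (R^i / (Nat.factorial i : ℝ)) * |sC c y (i+t)| ≤ (R^i / (Nat.factorial i : ℝ)) * B^(i+t) := by
        gcongr; exact h _
    _ = _ := by rw [mul_pow, pow_add]; ring

lemma DN_tendsto (c y : ℝ) (hc : ∀ n, poch c n ≠ 0) (t : ℕ) (n : ℕ → ℕ) (x : ℝ)
    (hn : Tendsto (fun l : ℕ => (n l : ℝ) / l) atTop (𝓝 x)) :
    Tendsto (fun l : ℕ => DN c l (n l) t y) atTop (𝓝 (Phi c y t x)) := by
  have hx : 0 ≤ x := ge_of_tendsto' hn fun l => by positivity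
  have e : ∀ l : ℕ, DN c l (n l) t y = ∑' i : ℕ, (((n l).choose i : ℝ) * (1/(l:ℝ))^i) * sC c y (i+t) := by
    intro l
    rw [tsum_eq_sum (s := range (n l + 1))]
    · rfl
    · intro i hi
      have : n l < i := by simpa using hi
      rw [Nat.choose_eq_zero_of_lt this]; simp
  simp only [e]
  apply tendsto_tsum_of_dominated_convergence (sC_summable c y hc t (x+1) (by positivity))
  · intro i
    exact (choose_tendsto n x hn i).mul_const _
  · filter_upwards [hn.eventually (ge_mem_nhds (show x < x + 1 by linarith))] with l hl i
    rw [norm_mul, Real.norm_eq_abs, Real.norm_eq_abs]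
    gcongr
    rw [abs_of_nonneg (by positivity)]
    exact choose_bound _ _ _ _ hl

lemma aL_pow_tendsto (n : ℕ → ℕ) (x : ℝ) (hn : Tendsto (fun l : ℕ => (n l : ℝ) / l) atTop (𝓝 x)) :
    Tendsto (fun l : ℕ => (aL l)^(n l)) atTop (𝓝 (Real.exp (-x))) := by
  have h1 := (Real.tendsto_mul_log_one_add_div_atTop 1).comp tendsto_natCast_atTop_atTop
  have h2 := (hn.mul h1).neg
  rw [mul_one] at h2
  have h3 := (Real.continuous_exp.tendsto (-x)).comp h2
  apply h3.congr'
  filter_upwards [eventually_gt_atTop 0] with l hl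
  have hl' : (l:ℝ) ≠ 0 := by positivity
  have e : aL l = (1 + 1/(l:ℝ))⁻¹ := by unfold aL; field_simp
  simp only [Function.comp_apply]
  rw [e, inv_pow, ← Real.exp_log (show (0:ℝ) < (1 + 1/(l:ℝ))^(n l) by positivity), ← Real.exp_neg, Real.log_pow]
  congr 1
  field_simp

lemma gamma_tendsto (c : ℝ) (hc : ∀ n, poch c n ≠ 0) (k : ℕ) (n : ℕ → ℕ) (x : ℝ) (hx : 0 < x)
    (hn : Tendsto (fun l : ℕ => (n l : ℝ) / l) atTop (𝓝 x)) :
    Tendsto (fun l : ℕ => (1/(l:ℝ))^k * poch c (n l + (k+1)) / ((Nat.factorial (n l) : ℝ) * S0 c l)) atTop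
      (𝓝 (x^(c + k) / Real.Gamma c)) := by
  have hG : Real.Gamma c ≠ 0 := by
    apply Real.Gamma_ne_zero
    intro m h
    have := c_add_ne c hc m
    rw [h] at this; simp at this
  have hnt : Tendsto n atTop atTop := by
    have h1 : Tendsto (fun l : ℕ => ((n l : ℝ) / l) * l) atTop atTop :=
      Tendsto.pos_mul_atTop hx hn tendsto_natCast_atTop_atTop
    rw [← tendsto_natCast_atTop_iff (R := ℝ)]
    apply h1.congr'
    filter_upwards [eventually_gt_atTop 0] with l hl
    have hl' : (l:ℝ) ≠ 0 := by positivity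
    field_simp
  have h1 := ((Real.GammaSeq_tendsto_Gamma c).comp hnt).inv₀ hG
  have hl1 : Tendsto (fun l : ℕ => (n l : ℝ) / ((l:ℝ)+1)) atTop (𝓝 x) := by
    have h2 : Tendsto (fun l : ℕ => ((n l : ℝ) / l) * ((l:ℝ) / ((l:ℝ)+1))) atTop (𝓝 (x * 1)) :=
      hn.mul (tendsto_natCast_div_add_atTop 1)
    rw [mul_one] at h2
    apply h2.congr'
    filter_upwards [eventually_gt_atTop 0] with l hl
    have hl' : (l:ℝ) ≠ 0 := by positivity
    field_simp
  have h2 : Tendsto (fun l : ℕ => ((n l : ℝ) / ((l:ℝ)+1))^c) atTop (𝓝 (x^c)) :=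
    hl1.rpow_const (Or.inl hx.ne')
  have h3 : ∀ j : ℕ, Tendsto (fun l : ℕ => (1/(l:ℝ))^j * poch (c + (n l : ℝ) + 1) j) atTop (𝓝 (x^j)) := by
    intro j
    induction j with
    | zero => simp [poch_zero]
    | succ j ih =>
      have h4 : Tendsto (fun l : ℕ => (n l : ℝ) / l + (c + 1 + j) / l) atTop (𝓝 (x + 0)) :=
        hn.add (tendsto_const_div_atTop_nhds_zero_nat _)
      have h5 := ih.mul h4
      rw [add_zero, ← pow_succ] at h5
      refine h5.congr fun l => ?_
      rw [poch_succ, pow_succ]; ring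
  have h6 := (h1.mul h2).mul (h3 k)
  have e : (Real.Gamma c)⁻¹ * x^c * x^k = x^(c + k) / Real.Gamma c := by
    rw [Real.rpow_add hx, Real.rpow_natCast]; ring
  rw [e] at h6
  apply h6.congr'
  filter_upwards [hnt.eventually (eventually_gt_atTop 0)] with l hl
  have hl' : (0:ℝ) < n l := by exact_mod_cast hl
  simp only [Function.comp_apply, Real.GammaSeq]
  have e1 : ∏ j ∈ range (n l + 1), (c + (j:ℝ)) = poch c (n l + 1) := rfl
  rw [e1, show n l + (k+1) = (n l + 1) + k by ring, poch_add c (n l + 1) k, S0_eq,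
    Real.div_rpow hl'.le (by positivity)]
  have e2 : c + ((n l + 1 : ℕ) : ℝ) = c + (n l : ℝ) + 1 := by push_cast; ring
  rw [e2]
  have := hc (n l + 1)
  have : (0:ℝ) < (n l:ℝ)^c := by positivity
  have : (0:ℝ) < ((l:ℝ)+1)^c := by positivity
  field_simp

noncomputable def OmN (c : ℝ) (lam : ℕ → ℝ) (k l n : ℕ) : ℝ :=
  (Matrix.of fun i t : Fin k => DN c l n t (lam i)).det

noncomputable def WN (c : ℝ) (lam : ℕ → ℝ) (k l n : ℕ) (y : ℝ) : ℝ :=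
  (Matrix.of (Fin.cons (fun t : Fin (k+1) => DN c l n t y)
    (fun (i : Fin k) (t : Fin (k+1)) => DN c l n t (lam i))) : Matrix (Fin (k+1)) (Fin (k+1)) ℝ).det

noncomputable def OmX (c : ℝ) (lam : ℕ → ℝ) (k : ℕ) (x : ℝ) : ℝ :=
  (Matrix.of fun i t : Fin k => Phi c (lam i) t x).det

noncomputable def WX (c : ℝ) (lam : ℕ → ℝ) (k : ℕ) (y x : ℝ) : ℝ :=
  (Matrix.of (Fin.cons (fun t : Fin (k+1) => Phi c y t x)
    (fun (i : Fin k) (t : Fin (k+1)) => Phi c (lam i) t x)) : Matrix (Fin (k+1)) (Fin (k+1)) ℝ).det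

lemma OmD_eq (c : ℝ) (lam : ℕ → ℝ) (k l n : ℕ) :
    OmD c lam k l n = (∏ t : Fin k, (1/(l:ℝ))^(t:ℕ)) * OmN c lam k l n := by
  unfold OmD OmN
  rw [← Matrix.det_mul_row]
  congr 1; ext i t
  simp only [Matrix.of_apply, eP_eval_DN]

lemma NP_eq (c : ℝ) (lam : ℕ → ℝ) (k l n : ℕ) (y : ℝ) :
    (NP c lam k l n).eval y = (∏ t : Fin k, (1/(l:ℝ))^(t:ℕ)) * (1/(l:ℝ))^k * WN c lam k l n y := by
  have e : (∏ t : Fin k, (1/(l:ℝ))^(t:ℕ)) * (1/(l:ℝ))^k = ∏ t : Fin (k+1), (1/(l:ℝ))^(t:ℕ) := by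
    rw [Fin.prod_univ_castSucc]; simp
  rw [e, NP_eval]
  unfold rowM WN
  rw [← Matrix.det_mul_row]
  congr 1; ext i t
  refine Fin.cases ?_ (fun i => ?_) i
  · simp only [Matrix.of_apply, Fin.cons_zero, eP_eval_DN]
  · simp only [Matrix.of_apply, Fin.cons_succ, eP_eval_DN]

lemma OmN_tendsto (c : ℝ) (hc : ∀ n, poch c n ≠ 0) (lam : ℕ → ℝ) (k : ℕ) (n : ℕ → ℕ) (x : ℝ)
    (hn : Tendsto (fun l : ℕ => (n l : ℝ) / l) atTop (𝓝 x)) :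
    Tendsto (fun l : ℕ => OmN c lam k l (n l)) atTop (𝓝 (OmX c lam k x)) := by
  unfold OmN OmX
  simp only [Matrix.det_apply]
  refine tendsto_finset_sum _ fun σ _ => ?_
  refine Tendsto.const_smul ?_ _
  refine tendsto_finset_prod _ fun i _ => ?_
  exact DN_tendsto c _ hc _ n x hn

lemma WN_tendsto (c : ℝ) (hc : ∀ n, poch c n ≠ 0) (lam : ℕ → ℝ) (k : ℕ) (n : ℕ → ℕ) (x y : ℝ)
    (hn : Tendsto (fun l : ℕ => (n l : ℝ) / l) atTop (𝓝 x)) :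
    Tendsto (fun l : ℕ => WN c lam k l (n l) y) atTop (𝓝 (WX c lam k y x)) := by
  unfold WN WX
  simp only [Matrix.det_apply]
  refine tendsto_finset_sum _ fun σ _ => ?_
  refine Tendsto.const_smul ?_ _
  refine tendsto_finset_prod _ fun i _ => ?_
  have : ∀ r : Fin (k+1), Tendsto (fun l : ℕ => (Matrix.of (Fin.cons (fun t : Fin (k+1) => DN c l (n l) t y)
    (fun (i : Fin k) (t : Fin (k+1)) => DN c l (n l) t (lam i))) : Matrix (Fin (k+1)) (Fin (k+1)) ℝ) r i) atTop
    (𝓝 ((Matrix.of (Fin.cons (fun t : Fin (k+1) => Phi c y t x)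
    (fun (i : Fin k) (t : Fin (k+1)) => Phi c (lam i) t x)) : Matrix (Fin (k+1)) (Fin (k+1)) ℝ) r i)) := by
    intro r
    refine Fin.cases ?_ (fun r => ?_) r
    · exact DN_tendsto c _ hc _ n x hn
    · exact DN_tendsto c _ hc _ n x hn
  exact this _

lemma floor_tendsto (x : ℝ) (hx : 0 < x) : Tendsto (fun l : ℕ => (⌊x * (l:ℝ)⌋₊ : ℝ) / l) atTop (𝓝 x) :=
  (tendsto_nat_floor_mul_div_atTop hx.le).comp tendsto_natCast_atTop_atTop

lemma floor_succ_tendsto (n : ℕ → ℕ) (x : ℝ) (hn : Tendsto (fun l : ℕ => (n l : ℝ) / l) atTop (𝓝 x)) :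
    Tendsto (fun l : ℕ => ((n l + 1 : ℕ) : ℝ) / l) atTop (𝓝 x) := by
  have h := hn.add (tendsto_const_div_atTop_nhds_zero_nat (1:ℝ))
  rw [add_zero] at h
  refine h.congr fun l => ?_
  push_cast; ring

/-- Bessel summand -/
noncomputable def TT (c : ℝ) (lam : ℕ → ℝ) (k : ℕ) (κ : ℝ) (m l n : ℕ) : ℝ :=
  ((NP c lam k l n).eval (m:ℝ))^2 / (((PP lam k).eval (m:ℝ))^2 *
      (κ * ((1/(l:ℝ))^(n+k) * (Nat.factorial n : ℝ) * ((l:ℝ)+1)^n * S0 c l * OmD c lam k l n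
      * OmD c lam k l (n+1) / poch c (n+k))))

lemma TT_eq (c : ℝ) (hc : ∀ n, poch c n ≠ 0) (lam : ℕ → ℝ) (k : ℕ) (κ : ℝ) (m l n : ℕ) (hl : 0 < l) :
    (l:ℝ) * TT c lam (k+1) κ m l n = (WN c lam (k+1) l n m)^2 *
      ((1/(l:ℝ))^k * poch c (n + (k+1)) / ((Nat.factorial n : ℝ) * S0 c l)) * (aL l)^n /
      (((PP lam (k+1)).eval (m:ℝ))^2 * κ * (OmN c lam (k+1) l n * OmN c lam (k+1) l (n+1))) := by
  unfold TT
  rw [NP_eq, OmD_eq, OmD_eq]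
  have hl' : (l:ℝ) ≠ 0 := by positivity
  have hp : (∏ t : Fin (k+1), (1/(l:ℝ))^(t:ℕ)) ≠ 0 :=
    Finset.prod_ne_zero_iff.mpr fun t _ => by positivity
  set p := (∏ t : Fin (k+1), (1/(l:ℝ))^(t:ℕ)) with hpdef
  clear_value p
  have hS := (S0_pos c l).ne'
  have hq := hc (n + (k+1))
  have hf : (Nat.factorial n : ℝ) ≠ 0 := by positivity
  have hl1 : ((l:ℝ)+1) ≠ 0 := by positivity
  set W := WN c lam (k+1) l n m
  set O1 := OmN c lam (k+1) l n
  set O2 := OmN c lam (k+1) l (n+1)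
  set q := (PP lam (k+1)).eval (m:ℝ)
  have e : (l:ℝ) * ((p * (1/(l:ℝ))^(k+1) * W)^2 * poch c (n+(k+1)))
      * ((Nat.factorial n : ℝ) * S0 c l)
      = (W^2 * ((1/(l:ℝ))^k * poch c (n + (k+1))) * (aL l)^n) *
        (p^2 * (1/(l:ℝ))^(n+(k+1)) * (Nat.factorial n : ℝ) * ((l:ℝ)+1)^n * S0 c l) := by
    unfold aL
    simp only [div_pow, one_pow, pow_add, pow_one, mul_pow]
    field_simp
  have h1 : (p^2 * (1/(l:ℝ))^(n+(k+1)) * (Nat.factorial n : ℝ) * ((l:ℝ)+1)^n * S0 c l) ≠ 0 := by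
    positivity
  have h2 : ((Nat.factorial n : ℝ) * S0 c l) ≠ 0 := by positivity
  calc (l:ℝ) * ((p * (1/(l:ℝ))^(k+1) * W)^2 / (q^2 * (κ * ((1/(l:ℝ))^(n+(k+1)) * (Nat.factorial n : ℝ) *
        ((l:ℝ)+1)^n * S0 c l * (p * O1) * (p * O2) / poch c (n+(k+1))))))
      = ((l:ℝ) * ((p * (1/(l:ℝ))^(k+1) * W)^2 * poch c (n+(k+1)))) /
        (p^2 * (1/(l:ℝ))^(n+(k+1)) * (Nat.factorial n : ℝ) * ((l:ℝ)+1)^n * S0 c l) /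
          (q^2 * κ * (O1 * O2)) := by
        simp only [div_eq_mul_inv, mul_inv, inv_inv]
        ring
    _ = (W^2 * ((1/(l:ℝ))^k * poch c (n + (k+1))) * (aL l)^n) / ((Nat.factorial n : ℝ) * S0 c l)
          / (q^2 * κ * (O1 * O2)) := by
        congr 1
        rw [div_eq_div_iff h1 h2, e]
    _ = _ := by ring

lemma TT_tendsto (c : ℝ) (hc : ∀ n, poch c n ≠ 0) (lam : ℕ → ℝ) (k : ℕ) (κ : ℝ) (hκ : κ ≠ 0) (m : ℕ)
    (hm : (PP lam (k+1)).eval (m:ℝ) ≠ 0) (x : ℝ) (hx : 0 < x) (hO : OmX c lam (k+1) x ≠ 0) :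
    Tendsto (fun l : ℕ => (l:ℝ) * TT c lam (k+1) κ m l ⌊x * (l:ℝ)⌋₊) atTop
      (𝓝 ((WX c lam (k+1) m x)^2 * (x^(c+k) / Real.Gamma c) * Real.exp (-x) /
        (((PP lam (k+1)).eval (m:ℝ))^2 * κ * (OmX c lam (k+1) x * OmX c lam (k+1) x)))) := by
  have hn := floor_tendsto x hx
  have hn1 := floor_succ_tendsto _ x hn
  have h := ((((WN_tendsto c hc lam (k+1) _ x m hn).pow 2).mul (gamma_tendsto c hc k _ x hx hn)).mul
    (aL_pow_tendsto _ x hn)).div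
    (((OmN_tendsto c hc lam (k+1) _ x hn).mul (OmN_tendsto c hc lam (k+1) _ x hn1)).const_mul
      (((PP lam (k+1)).eval (m:ℝ))^2 * κ)) (by positivity)
  apply h.congr'
  filter_upwards [eventually_gt_atTop 0] with l hl
  exact (TT_eq c hc lam k κ m l _ hl).symm

lemma poly_hasSum (p : ℝ[X]) (x : ℝ) : HasSum (fun i => p.coeff i * x^i) (p.eval x) := by
  rw [eval_eq_sum_range]
  apply hasSum_sum_of_ne_finset_zero
  intro i hi
  rw [coeff_eq_zero_of_natDegree_lt (by simpa using hi), zero_mul]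

lemma lag_eval_Phi (α : ℝ) (hc : ∀ n, poch (α+1) n ≠ 0) (f t : ℕ) (x : ℝ) :
    (iterDeriv t (lag α f)).eval x = gF (α+1) f * Phi (α+1) f t x := by
  rw [← (poly_hasSum _ x).tsum_eq, Phi, ← tsum_mul_left]
  congr 1; ext i
  have h : ((iterDeriv t (lag α f) : ℝ[X]) : PowerSeries ℝ) = PowerSeries.C (gF (α+1) f) * dd^[t] (phi (α+1) f) := by
    rw [coe_iterDeriv, lag_eq_phi α hc, dd_iter_Cmul]
  have h2 := congrArg (PowerSeries.coeff i) h
  rw [Polynomial.coeff_coe, PowerSeries.coeff_C_mul, coeff_dd_phi] at h2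
  rw [h2]; ring

lemma Elag_eval_Phi (α : ℝ) (hc : ∀ n, poch (α+1) n ≠ 0) (f t : ℕ) (x : ℝ) :
    ((lag (α+t) f).comp (-X)).eval x = (gF (α+1) f * Real.exp (-x)) * Phi (α+1) (-((α+1)+f)) t x := by
  set p := (lag (α+t) f).comp (-X) with hp
  have key : Real.exp x * p.eval x = gF (α+1) f * Phi (α+1) (-((α+1)+f)) t x := by
    have he := Real.summable_pow_div_factorial x
    have hE : Real.exp x = ∑' n : ℕ, x^n / (Nat.factorial n : ℝ) := by
      rw [Real.exp_eq_exp_ℝ, NormedSpace.exp_eq_tsum_div]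
    have he' : Summable (fun n : ℕ => ‖x^n / (Nat.factorial n : ℝ)‖) := he.norm
    have hp' : Summable (fun n : ℕ => ‖p.coeff n * x^n‖) := (poly_hasSum p x).summable.norm
    rw [hE, ← (poly_hasSum p x).tsum_eq, tsum_mul_tsum_eq_tsum_sum_antidiagonal_of_summable_norm he' hp',
      Phi, ← tsum_mul_left]
    congr 1; ext n
    have h : Ex * (p : PowerSeries ℝ) = PowerSeries.C (gF (α+1) f) * dd^[t] (phi (α+1) (-((α+1)+f))) := by
      rw [hp, ← dd_iter_Elag, Elag_eq_phi α hc, dd_iter_Cmul]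
    have h2 := congrArg (PowerSeries.coeff n) h
    rw [PowerSeries.coeff_C_mul, coeff_dd_phi, PowerSeries.coeff_mul] at h2
    have h3 : gF (α+1) f * (x^n / (Nat.factorial n : ℝ) * sC (α+1) (-((α+1)+f)) (n+t)) =
      x^n * (gF (α+1) f * (sC (α+1) (-((α+1)+f)) (n+t) / (Nat.factorial n : ℝ))) := by ring
    rw [h3, ← h2, Finset.mul_sum]
    refine Finset.sum_congr rfl fun q hq => ?_
    rw [← (Finset.HasAntidiagonal.mem_antidiagonal.mp hq), pow_add, Polynomial.coeff_coe, Ex, PowerSeries.coeff_exp]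
    simp
    ring
  rw [Real.exp_neg, mul_right_comm, ← key]
  field_simp

noncomputable def rX (c : ℝ) (F1 F2 : Finset ℕ) (x : ℝ) (i : ℕ) : ℝ :=
  if i < F1.card then gF c (nth F1 i) else gF c (nth F2 (i - F1.card)) * Real.exp (-x)

lemma rX_ne (c : ℝ) (hc : ∀ n, poch c n ≠ 0) (F1 F2 : Finset ℕ) (x : ℝ) (i : ℕ) : rX c F1 F2 x i ≠ 0 := by
  unfold rX
  split_ifs
  · exact gF_ne c hc _
  · exact mul_ne_zero (gF_ne c hc _) (Real.exp_ne_zero _)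

noncomputable def RX (c : ℝ) (F1 F2 : Finset ℕ) (x : ℝ) : ℝ := ∏ i ∈ range (F1.card + F2.card), rX c F1 F2 x i

lemma RX_ne (c : ℝ) (hc : ∀ n, poch c n ≠ 0) (F1 F2 : Finset ℕ) (x : ℝ) : RX c F1 F2 x ≠ 0 :=
  Finset.prod_ne_zero_iff.mpr fun i _ => rX_ne c hc F1 F2 x i

lemma entry_eval (α : ℝ) (hc : ∀ n, poch (α+1) n ≠ 0) (F1 F2 : Finset ℕ) (i j : ℕ) (x : ℝ) :
    (((if i < F1.card then iterDeriv j (lag α (nth F1 i))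
    else (lag (α + (j : ℝ)) (nth F2 (i - F1.card))).comp (-Polynomial.X)) : Polynomial ℝ)).eval x
      = rX (α+1) F1 F2 x i * Phi (α+1) (lamF (α+1) F1 F2 i) j x := by
  unfold rX lamF
  split_ifs with h
  · exact lag_eval_Phi α hc _ _ x
  · exact Elag_eval_Phi α hc _ _ x

lemma OmegaL_eval (α : ℝ) (hc : ∀ n, poch (α+1) n ≠ 0) (F1 F2 : Finset ℕ) (x : ℝ) :
    (OmegaL α F1 F2).eval x = RX (α+1) F1 F2 x * OmX (α+1) (lamF (α+1) F1 F2) (F1.card + F2.card) x := by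
  have : (OmegaL α F1 F2).eval x = Polynomial.evalRingHom x (OmegaL α F1 F2) := rfl
  rw [this, OmegaL, RingHom.map_det, RX, OmX, Finset.prod_range, ← Matrix.det_mul_column]
  congr 1
  ext1 i j
  simp only [RingHom.mapMatrix_apply, Matrix.map_apply, Matrix.of_apply, coe_evalRingHom]
  exact entry_eval α hc F1 F2 i j x

lemma lagP_eval (α : ℝ) (hc : ∀ n, poch (α+1) n ≠ 0) (F1 F2 : Finset ℕ) (m : ℕ) (x : ℝ) :
    (lagP α F1 F2 (lag α m)).eval x = gF (α+1) m * RX (α+1) F1 F2 x *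
      WX (α+1) (lamF (α+1) F1 F2) (F1.card + F2.card) m x := by
  have : (lagP α F1 F2 (lag α m)).eval x = Polynomial.evalRingHom x (lagP α F1 F2 (lag α m)) := rfl
  have hp : gF (α+1) m * RX (α+1) F1 F2 x
     = ∏ i : Fin (F1.card + F2.card + 1), (if (i:ℕ) = 0 then gF (α+1) m else rX (α+1) F1 F2 x ((i:ℕ)-1)) := by
    rw [Fin.prod_univ_succ, RX, Finset.prod_range]
    simp
  rw [this, lagP, RingHom.map_det, WX, hp, ← Matrix.det_mul_column]
  congr 1
  ext1 i j
  simp only [RingHom.mapMatrix_apply, Matrix.map_apply, Matrix.of_apply, coe_evalRingHom]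
  refine Fin.cases ?_ (fun i => ?_) i
  · simp only [Fin.val_zero, if_true, Fin.cons_zero]
    exact lag_eval_Phi α hc _ _ x
  · simp only [Fin.val_succ, Nat.add_eq_zero_iff, one_ne_zero, and_false, if_false, Fin.cons_succ, Nat.add_sub_cancel]
    exact entry_eval α hc F1 F2 _ j x

lemma PP_lamF_eval (c : ℝ) (F1 F2 : Finset ℕ) (t : ℝ) :
    (PP (lamF c F1 F2) (F1.card + F2.card)).eval t = (∏ f∈F1,(t-f))*∏ f∈F2,(t+c+f) := by
  rw [← prod_lamF, PP, eval_prod]; simp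

lemma PP_lamF_ne (c : ℝ) (hc : ∀ n, poch c n ≠ 0) (F1 F2 : Finset ℕ) (j : ℕ) (hj : j ∉ F1) :
    (PP (lamF c F1 F2) (F1.card + F2.card)).eval (j:ℝ) ≠ 0 := by
  rw [PP_lamF_eval]
  refine mul_ne_zero (Finset.prod_ne_zero_iff.mpr fun f hf => ?_) (Finset.prod_ne_zero_iff.mpr fun f hf => ?_)
  · rw [sub_ne_zero]; intro h
    exact hj (by rwa [Nat.cast_injective h])
  · have := c_add_ne c hc (j+f)
    push_cast at this
    intro h; apply this; linarith

lemma poch_pos (t : ℝ) (ht : 0 < t) (m : ℕ) : 0 < poch t m :=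
  Finset.prod_pos fun i _ => by positivity

lemma c_chat_pos (c : ℝ) (hc : ∀ n, poch c n ≠ 0) : 0 < c + chat c := by
  have h1 := Int.floor_le c
  have h2 := Int.self_le_toNat (-⌊c⌋)
  have h3 : (-(⌊c⌋:ℝ)) ≤ ((-⌊c⌋).toNat : ℝ) := by exact_mod_cast h2
  have h4 : 0 ≤ c + chat c := by unfold chat; linarith
  exact lt_of_le_of_ne h4 (c_add_ne c hc _).symm

lemma adm_eq (c : ℝ) (hc : ∀ n, poch c n ≠ 0) (F1 F2 : Finset ℕ) (j : ℕ) :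
    (poch c (chat c))⁻¹ * (PP (lamF c F1 F2) (F1.card + F2.card)).eval (j:ℝ) * poch c j =
      ((∏ f ∈ F1, ((j : ℝ) - f)) * (∏ f ∈ F2, ((j : ℝ) + c + f)) / poch ((j : ℝ) + c) (chat c)) *
        poch (c + chat c) j := by
  rw [PP_lamF_eval]
  have h1 := poch_add c j (chat c)
  have h2 := poch_add c (chat c) j
  rw [Nat.add_comm, h2] at h1
  have h3 := hc (chat c)
  have h4 := hc (j + chat c)
  rw [poch_add] at h4
  have h5 : poch (c + j) (chat c) ≠ 0 := right_ne_zero_of_mul h4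
  rw [add_comm (j:ℝ) c]
  field_simp
  linear_combination -(∏ f ∈ F1, ((j : ℝ) - f)) * (∏ f ∈ F2, (c + (j : ℝ) + f)) * h1

lemma adm_nonneg (c : ℝ) (hc : ∀ n, poch c n ≠ 0) (F1 F2 : Finset ℕ) (h : IsAdmissible c F1 F2) (j : ℕ) :
    0 ≤ (poch c (chat c))⁻¹ * (PP (lamF c F1 F2) (F1.card + F2.card)).eval (j:ℝ) * poch c j := by
  rw [adm_eq c hc]
  exact mul_nonneg (h j) (poch_pos _ (c_chat_pos c hc) _).le

lemma adm_pos (c : ℝ) (hc : ∀ n, poch c n ≠ 0) (F1 F2 : Finset ℕ) (h : IsAdmissible c F1 F2) (j : ℕ)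
    (hj : j ∉ F1) :
    0 < (poch c (chat c))⁻¹ * (PP (lamF c F1 F2) (F1.card + F2.card)).eval (j:ℝ) * poch c j :=
  lt_of_le_of_ne (adm_nonneg c hc F1 F2 h j)
    (mul_ne_zero (mul_ne_zero (inv_ne_zero (hc _)) (PP_lamF_ne c hc F1 F2 j hj)) (hc _)).symm

lemma Phi_zero (c y : ℝ) (t : ℕ) : Phi c y t 0 = sC c y t := by
  unfold Phi
  rw [tsum_eq_single 0 (fun i hi => by simp [hi])]
  simp

/-- sign at fixed n -/
lemma step_sign (c : ℝ) (hc : ∀ n, poch c n ≠ 0) (lam : ℕ → ℝ) (k : ℕ) (κ : ℝ) (F : Finset ℕ)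
    (hpos : ∀ j : ℕ, 0 ≤ κ * (PP lam k).eval (j:ℝ) * poch c j)
    (hposs : ∀ j : ℕ, j ∉ F → 0 < κ * (PP lam k).eval (j:ℝ) * poch c j)
    (hinj : ∀ i < k, ∀ j < k, lam i = lam j → i = j) (n : ℕ) : 0 < κ / poch c (n+k) := by
  have h0 : OmX c lam k 0 ≠ 0 := by
    unfold OmX
    simp only [Phi_zero]
    refine det_sC_ne c hc k (fun i => lam i) fun i j h => ?_
    exact Fin.ext (hinj i i.2 j j.2 h)
  have hz : ∀ n : ℕ, Tendsto (fun l : ℕ => (n : ℝ) / l) atTop (𝓝 0) := fun n =>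
    tendsto_const_div_atTop_nhds_zero_nat (n:ℝ)
  have h1 := (OmN_tendsto c hc lam k (fun _ => n) 0 (hz n)).mul
    (OmN_tendsto c hc lam k (fun _ => n+1) 0 (hz (n+1)))
  have h2 : ∀ᶠ l : ℕ in atTop, 0 < OmN c lam k l n * OmN c lam k l (n+1) :=
    h1.eventually (lt_mem_nhds (mul_self_pos.mpr h0))
  obtain ⟨l, hl2, hl⟩ := (h2.and (eventually_gt_atTop 0)).exists
  have h3 := OmD_step c hc lam k l hl κ F hpos hposs hinj n (OmD_ne c hc lam k l hl κ F hpos hposs hinj n)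
  rw [OmD_eq, OmD_eq] at h3
  set p := (∏ t : Fin k, (1/(l:ℝ))^(t:ℕ))
  have h4 := S0_pos c l
  have hp : 0 < p := Finset.prod_pos fun t _ => by positivity
  have h5 : 0 < (1/(l:ℝ))^(n+k) * (Nat.factorial n : ℝ) * ((l:ℝ)+1)^n * S0 c l * p * p *
    (OmN c lam k l n * OmN c lam k l (n+1)) := by positivity
  by_contra hcon
  have := mul_nonpos_of_nonpos_of_nonneg (not_lt.mp hcon) h5.le
  apply absurd h3 (not_lt.mpr _)
  refine le_trans (le_of_eq ?_) this
  ring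

lemma c_add_k_pos (c : ℝ) (hc : ∀ n, poch c n ≠ 0) (F1 F2 : Finset ℕ) (h : IsAdmissible c F1 F2) :
    0 < c + ((F1.card + F2.card : ℕ) : ℝ) := by
  have hs := step_sign c hc (lamF c F1 F2) (F1.card + F2.card) _ F1 (adm_nonneg c hc F1 F2 h)
    (adm_pos c hc F1 F2 h) (fun i hi j hj => lamF_inj c hc F1 F2 hi hj)
  have h0 := hs 0
  have h1 := hs 1
  rw [zero_add] at h0
  rw [add_comm 1, poch_succ] at h1
  have h2 := hc (F1.card + F2.card)
  have h3 := c_add_ne c hc (F1.card + F2.card)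
  have h4 := div_pos h0 h1
  have hk : (poch c (chat c))⁻¹ ≠ 0 := inv_ne_zero (hc _)
  rw [div_div_div_cancel_left' _ _ hk, mul_comm, mul_div_assoc, div_self h2, mul_one] at h4
  exact h4

lemma bessel_TT (c : ℝ) (hc : ∀ n, poch c n ≠ 0) (F1 F2 : Finset ℕ) (h : IsAdmissible c F1 F2) (m : ℕ)
    (hm : m ∉ F1) : ∃ B : ℝ, 0 ≤ B ∧ ∀ l : ℕ, 0 < l →
      (∀ n, 0 ≤ TT c (lamF c F1 F2) (F1.card + F2.card) (poch c (chat c))⁻¹ m l n) ∧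
      ∀ M, ∑ n ∈ range M, TT c (lamF c F1 F2) (F1.card + F2.card) (poch c (chat c))⁻¹ m l n ≤ B := by
  set κ := (poch c (chat c))⁻¹ with hκ
  set lam := lamF c F1 F2
  set k := F1.card + F2.card
  have hinj : ∀ i < k, ∀ j < k, lam i = lam j → i = j := fun i hi j hj => lamF_inj c hc F1 F2 hi hj
  have hpos := adm_nonneg c hc F1 F2 h
  have hposs := adm_pos c hc F1 F2 h
  have hp := hposs m hm
  refine ⟨1 / (κ * (PP lam k).eval (m:ℝ) * poch c m * ((1/2)^m / (Nat.factorial m : ℝ))), by positivity, fun l hl => ⟨fun n => ?_, fun M => ?_⟩⟩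
  · have := OmD_step c hc lam k l hl κ F1 hpos hposs hinj n (OmD_ne c hc lam k l hl κ F1 hpos hposs hinj n)
    unfold TT
    positivity
  · refine (bessel c hc lam k l hl κ F1 hpos hposs hinj m hm M).trans ?_
    apply one_div_le_one_div_of_le (by positivity)
    have ha : (1/2:ℝ) ≤ aL l := by
      unfold aL
      have : (1:ℝ) ≤ l := by exact_mod_cast hl
      rw [div_le_div_iff₀ (by norm_num) (by positivity)]; linarith
    have h2 : (1/2:ℝ)^m ≤ aL l ^ m := by gcongr
    have e : κ * (PP lam k).eval (m:ℝ) * rho c l m = κ * (PP lam k).eval (m:ℝ) * poch c m * (aL l^m / (Nat.factorial m : ℝ)) := by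
      rw [rho]; ring
    rw [e]
    gcongr

lemma step_lintegral (T : ℕ → ℝ) (l : ℕ) (hl : 0 < l) (B : ℝ) (h0 : ∀ n, 0 ≤ T n)
    (hB : ∀ M, ∑ n ∈ range M, T n ≤ B) :
    ∫⁻ x in Set.Ioi (0:ℝ), ‖(l:ℝ) * T ⌊x * (l:ℝ)⌋₊‖ₑ ≤ ENNReal.ofReal B := by
  have hl' : (0:ℝ) < l := by exact_mod_cast hl
  have hsub : Set.Ioi (0:ℝ) ⊆ ⋃ n : ℕ, Set.Ico ((n:ℝ)/l) (((n:ℝ)+1)/l) := by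
    intro x hx
    rw [Set.mem_Ioi] at hx
    rw [Set.mem_iUnion]
    refine ⟨⌊x * (l:ℝ)⌋₊, ?_, ?_⟩
    · rw [div_le_iff₀ hl']; exact Nat.floor_le (by positivity)
    · rw [lt_div_iff₀ hl']; exact Nat.lt_floor_add_one _
  refine (lintegral_mono_set hsub).trans ((lintegral_iUnion_le _ _).trans ?_)
  have hpiece : ∀ n : ℕ, ∫⁻ x in Set.Ico ((n:ℝ)/l) (((n:ℝ)+1)/l), ‖(l:ℝ) * T ⌊x * (l:ℝ)⌋₊‖ₑ = ENNReal.ofReal (T n) := by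
    intro n
    rw [setLIntegral_congr_fun (g := fun _ => ‖(l:ℝ) * T n‖ₑ) measurableSet_Ico]
    · rw [setLIntegral_const, Real.volume_Ico, Real.enorm_eq_ofReal (mul_nonneg hl'.le (h0 n)),
        ← ENNReal.ofReal_mul (mul_nonneg hl'.le (h0 n))]
      congr 1; field_simp; ring
    · intro x hx
      have : ⌊x * (l:ℝ)⌋₊ = n := by
        rw [Set.mem_Ico, div_le_iff₀ hl', lt_div_iff₀ hl'] at hx
        rw [Nat.floor_eq_iff (le_trans (by positivity) hx.1)]
        exact hx
      simp only [this]
  simp only [hpiece]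
  refine ENNReal.tsum_le_of_sum_range_le fun M => ?_
  rw [← ENNReal.ofReal_sum_of_nonneg fun n _ => h0 n]
  exact ENNReal.ofReal_le_ofReal (hB M)

lemma fatou_step (T : ℕ → ℕ → ℝ) (B : ℝ) (G : ℝ → ℝ)
    (h0 : ∀ l, 0 < l → ∀ n, 0 ≤ T l n)
    (hB : ∀ l, 0 < l → ∀ M, ∑ n ∈ range M, T l n ≤ B)
    (hG : ∀ᵐ x ∂(volume.restrict (Set.Ioi (0:ℝ))),
      Tendsto (fun l : ℕ => (l:ℝ) * T l ⌊x * (l:ℝ)⌋₊) atTop (𝓝 (G x))) :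
    ∫⁻ x in Set.Ioi (0:ℝ), ‖G x‖ₑ ≤ ENNReal.ofReal B := by
  have h1 : ∫⁻ x in Set.Ioi (0:ℝ), ‖G x‖ₑ =
      ∫⁻ x in Set.Ioi (0:ℝ), liminf (fun l : ℕ => ‖(l:ℝ) * T l ⌊x * (l:ℝ)⌋₊‖ₑ) atTop := by
    apply lintegral_congr_ae
    filter_upwards [hG] with x hx
    exact hx.enorm.liminf_eq.symm
  rw [h1]
  refine (lintegral_liminf_le fun l => ?_).trans ?_
  · have hm : Measurable (fun x : ℝ => T l ⌊x * (l:ℝ)⌋₊) :=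
      (measurable_from_nat (f := T l)).comp (Nat.measurable_floor.comp (measurable_id.mul_const _))
    exact (hm.const_mul _).enorm
  · apply liminf_le_of_frequently_le'
    apply Eventually.frequently
    filter_upwards [eventually_gt_atTop 0] with l hl
    exact step_lintegral (T l) l hl B (h0 l hl) (hB l hl)

lemma OmegaL_ne (α : ℝ) (hc : ∀ n, poch (α+1) n ≠ 0) (F1 F2 : Finset ℕ) : OmegaL α F1 F2 ≠ 0 := by
  intro h
  have := OmegaL_const α hc F1 F2
  rw [h] at this
  simp at this

lemma int_exc (α : ℝ) (hc : ∀ n, poch (α+1) n ≠ 0) (F1 F2 : Finset ℕ) (hk : 0 < F1.card + F2.card)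
    (h : IsAdmissible (α+1) F1 F2) (m : ℕ) (hm : m ∉ F1) :
    IntegrableOn (fun x : ℝ => ((lagP α F1 F2 (lag α m)).eval x) ^ 2 *
      (x ^ (α + ((F1.card + F2.card : ℕ) : ℝ)) * Real.exp (-x) / ((OmegaL α F1 F2).eval x) ^ 2))
      (Set.Ioi 0) := by
  obtain ⟨B, hB0, hB⟩ := bessel_TT (α+1) hc F1 F2 h m hm
  obtain ⟨k, hk'⟩ : ∃ k, F1.card + F2.card = k + 1 := ⟨_, (Nat.succ_pred_eq_of_pos hk).symm⟩
  have hP := PP_lamF_ne (α+1) hc F1 F2 m hm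
  have hκ : (poch (α+1) (chat (α+1)))⁻¹ ≠ 0 := inv_ne_zero (hc _)
  have hΓ : Real.Gamma (α+1) ≠ 0 := Real.Gamma_ne_zero fun n hn => c_add_ne (α+1) hc n (by linarith)
  have hOe := OmegaL_eval α hc F1 F2
  have hWe := lagP_eval α hc F1 F2 m
  have hR := RX_ne (α+1) hc F1 F2
  set κ := (poch (α+1) (chat (α+1)))⁻¹
  set lam := lamF (α+1) F1 F2
  rw [hk'] at hB hP hOe hWe ⊢
  set G : ℝ → ℝ := fun x => ((WX (α+1) lam (k+1) m x)^2 * (x^((α+1)+k) / Real.Gamma (α+1)) * Real.exp (-x) /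
        (((PP lam (k+1)).eval (m:ℝ))^2 * κ * (OmX (α+1) lam (k+1) x * OmX (α+1) lam (k+1) x))) with hGdef
  have hF := fatou_step (fun l n => TT (α+1) lam (k+1) κ m l n) B G (fun l hl => (hB l hl).1)
    (fun l hl => (hB l hl).2) (by
      have hfin : ∀ᵐ x ∂(volume : Measure ℝ), ¬ (OmegaL α F1 F2).IsRoot x := by
        rw [ae_iff]
        simp only [not_not]
        exact (Polynomial.finite_setOfPred_isRoot (OmegaL_ne α hc F1 F2)).measure_zero _
      filter_upwards [self_mem_ae_restrict (measurableSet_Ioi (a := (0:ℝ))), ae_restrict_of_ae hfin] with x hx hx2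
      refine TT_tendsto (α+1) hc lam k κ hκ m hP x hx fun h0 => hx2 ?_
      rw [Polynomial.IsRoot, hOe, h0, mul_zero])
  have hG : ∀ x, ((lagP α F1 F2 (lag α m)).eval x) ^ 2 *
      (x ^ (α + ((k+1 : ℕ) : ℝ)) * Real.exp (-x) / ((OmegaL α F1 F2).eval x) ^ 2) =
      ((gF (α+1) m)^2 * ((PP lam (k+1)).eval (m:ℝ))^2 * κ * Real.Gamma (α+1)) * G x := by
    intro x
    have hRx := hR x
    rw [hOe, hWe, hGdef]
    have e : α + ((k+1 : ℕ) : ℝ) = (α + 1) + k := by push_cast; ring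
    rw [e]
    simp only [mul_pow]
    rcases eq_or_ne (OmX (α+1) lam (k+1) x) 0 with h0 | h0
    · simp [h0]
    · field_simp
  refine ⟨?_, ?_⟩
  · apply Measurable.aestronglyMeasurable
    have := (lagP α F1 F2 (lag α m)).continuous.measurable
    have := (OmegaL α F1 F2).continuous.measurable
    fun_prop
  · rw [HasFiniteIntegral]
    simp only [hG, enorm_mul _ (G _)]
    rw [lintegral_const_mul' _ _ enorm_ne_top]
    exact ENNReal.mul_lt_top enorm_lt_top (hF.trans_lt ENNReal.ofReal_lt_top)

lemma dvd_of_int (P Om : ℝ[X]) (hOm : Om ≠ 0) (x0 b : ℝ) (hx0 : 0 < x0)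
    (hInt1 : IntegrableOn (fun x : ℝ => (P.eval x)^2 * (x^b * Real.exp (-x) / (Om.eval x)^2)) (Set.Ioi 0)) :
    (X - C x0)^(Om.rootMultiplicity x0) ∣ P := by
  by_cases hP : P = 0
  · rw [hP]; exact dvd_zero _
  rw [← le_rootMultiplicity_iff hP]
  by_contra hlt
  rw [not_le] at hlt
  obtain ⟨p, hp, hp0⟩ := exists_eq_pow_rootMultiplicity_mul_and_not_dvd P hP x0
  obtain ⟨q, hq, hq0⟩ := exists_eq_pow_rootMultiplicity_mul_and_not_dvd Om hOm x0
  rw [dvd_iff_isRoot, IsRoot] at hp0 hq0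
  obtain ⟨d, hd⟩ := Nat.exists_eq_add_of_lt hlt
  set μ := P.rootMultiplicity x0
  set ν := Om.rootMultiplicity x0
  have hnot := not_intervalIntegrable_of_sub_inv_isBigO_punctured (a := x0) (b := x0+1) (c := x0)
    (f := fun x : ℝ => (P.eval x)^2 * (x^b * Real.exp (-x) / (Om.eval x)^2)) ?_ (by linarith) (by simp)
  · apply hnot
    rw [intervalIntegrable_iff_integrableOn_Ioc_of_le (by linarith)]
    exact hInt1.mono_set fun x hx => hx0.trans hx.1
  · set g : ℝ → ℝ := fun x => (x - x0)^(2*d+1) * (q.eval x)^2 / ((p.eval x)^2 * (x^b * Real.exp (-x))) with hg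
    have hgc : ContinuousAt g x0 := by
      have h1 : ContinuousAt (fun x : ℝ => x^b) x0 := Real.continuousAt_rpow_const _ _ (Or.inl hx0.ne')
      apply ContinuousAt.div
      · exact Continuous.continuousAt (by fun_prop)
      · exact (Continuous.continuousAt (by fun_prop)).mul (h1.mul (Continuous.continuousAt (by fun_prop)))
      · have := Real.rpow_pos_of_pos hx0 b
        positivity
    have hgO : g =O[𝓝[≠] x0] (fun _ => (1:ℝ)) :=
      (hgc.tendsto.mono_left nhdsWithin_le_nhds).isBigO_one ℝ
    have hmul := (Asymptotics.isBigO_refl (fun x : ℝ => (P.eval x)^2 * (x^b * Real.exp (-x) / (Om.eval x)^2)) (𝓝[≠] x0)).mul hgO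
    simp only [mul_one] at hmul
    refine hmul.congr' ?_ EventuallyEq.rfl
    have hpe : ∀ᶠ x in 𝓝[≠] x0, p.eval x ≠ 0 :=
      (p.continuous.continuousAt.eventually_ne hp0).filter_mono nhdsWithin_le_nhds
    have hqe : ∀ᶠ x in 𝓝[≠] x0, q.eval x ≠ 0 :=
      (q.continuous.continuousAt.eventually_ne hq0).filter_mono nhdsWithin_le_nhds
    have hxe : ∀ᶠ x in 𝓝[≠] x0, 0 < x := (lt_mem_nhds hx0).filter_mono nhdsWithin_le_nhds
    filter_upwards [hpe, hqe, hxe, self_mem_nhdsWithin] with x h1 h2 h3 h4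
    have h4' : x - x0 ≠ 0 := sub_ne_zero.mpr h4
    have h5 := Real.rpow_pos_of_pos h3 b
    have h6 := Real.exp_pos (-x)
    have e1 : P.eval x = (x-x0)^μ * p.eval x := by conv_lhs => rw [hp]
                                                   simp
    have e2 : Om.eval x = (x-x0)^(μ + d + 1) * q.eval x := by conv_lhs => rw [hq, hd]
                                                              simp
    simp only [hg]
    rw [e1, e2]
    set w := x^b
    set E := Real.exp (-x)
    set y := x - x0
    set P1 := p.eval x
    set Q1 := q.eval x
    have : y^(μ+d+1) = y^μ * y^d * y := by rw [pow_succ, pow_add]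
    rw [this]
    have : y^(2*d+1) = y^d*y^d*y := by rw [pow_succ, two_mul, pow_add]
    rw [this]
    field_simp

noncomputable def lagM (α : ℝ) (F1 F2 : Finset ℕ) : Matrix (Fin (F1.card + F2.card + 1)) (Fin (F1.card + F2.card + 1)) ℝ[X] :=
  Matrix.of fun i j =>
    if (i : ℕ) - 1 < F1.card then iterDeriv (j : ℕ) (lag α (nth F1 ((i : ℕ) - 1)))
    else (lag (α + ((j : ℕ) : ℝ)) (nth F2 ((i : ℕ) - 1 - F1.card))).comp (-Polynomial.X)

lemma lagP_update (α : ℝ) (F1 F2 : Finset ℕ) (p : ℝ[X]) :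
    lagP α F1 F2 p = ((lagM α F1 F2).updateRow 0 (fun j => iterDeriv (j:ℕ) p)).det := by
  unfold lagP
  congr 1
  ext1 i j
  refine Fin.cases ?_ (fun i => ?_) i
  · simp
  · rw [Matrix.updateRow_ne (Fin.succ_ne_zero i)]
    simp [lagM]

lemma iterDeriv_add (j : ℕ) (p q : ℝ[X]) : iterDeriv j (p + q) = iterDeriv j p + iterDeriv j q := by
  unfold iterDeriv
  induction j with
  | zero => rfl
  | succ j ih => simp only [Function.iterate_succ_apply', ih, derivative_add]

lemma iterDeriv_C_mul (j : ℕ) (r : ℝ) (q : ℝ[X]) : iterDeriv j (C r * q) = C r * iterDeriv j q := by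
  unfold iterDeriv
  induction j with
  | zero => rfl
  | succ j ih => simp only [Function.iterate_succ_apply', ih, derivative_C_mul]

lemma lagP_add (α : ℝ) (F1 F2 : Finset ℕ) (p q : ℝ[X]) :
    lagP α F1 F2 (p + q) = lagP α F1 F2 p + lagP α F1 F2 q := by
  simp only [lagP_update, iterDeriv_add]
  exact Matrix.det_updateRow_add _ _ _ _

lemma lagP_C_mul (α : ℝ) (F1 F2 : Finset ℕ) (r : ℝ) (q : ℝ[X]) :
    lagP α F1 F2 (C r * q) = C r * lagP α F1 F2 q := by
  simp only [lagP_update, iterDeriv_C_mul]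
  exact Matrix.det_updateRow_smul _ _ (C r) _

lemma lagP_mem (α : ℝ) (F1 F2 : Finset ℕ) (m : ℕ) (hm : m ∈ F1) : lagP α F1 F2 (lag α m) = 0 := by
  obtain ⟨i, hi, rfl⟩ := nth_surj F1 hm
  unfold lagP
  refine Matrix.det_zero_of_row_eq (i := 0) (j := ⟨i+1, by omega⟩) ?_ ?_
  · intro h; simpa using congrArg Fin.val h
  · funext j
    simp [hi]

lemma dvd_all (α : ℝ) (F1 F2 : Finset ℕ) (D : ℝ[X]) (h : ∀ m, D ∣ lagP α F1 F2 (lag α m)) :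
    ∀ N : ℕ, ∀ p : ℝ[X], (∀ j, N ≤ j → p.coeff j = 0) → D ∣ lagP α F1 F2 p := by
  intro N
  induction N with
  | zero =>
    intro p hp
    have : p = C 0 * 0 := by ext j; rw [hp j (Nat.zero_le _)]; simp
    rw [this, lagP_C_mul]; simp
  | succ N ih =>
    intro p hp
    have hl : (lag α N).coeff N ≠ 0 := by
      rw [lag_coeff, if_pos le_rfl, Nat.sub_self, gbinom_zero]
      positivity
    set r := p.coeff N / (lag α N).coeff N with hr
    have e : p = C r * lag α N + (p + C (-r) * lag α N) := by
      rw [C_neg]; ring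
    rw [e, lagP_add, lagP_C_mul]
    refine dvd_add (Dvd.dvd.mul_left (h N) _) (ih _ fun j hj => ?_)
    rw [coeff_add, coeff_C_mul]
    rcases eq_or_lt_of_le hj with rfl | hj'
    · rw [hr]; field_simp; ring
    · rw [hp j hj', coeff_eq_zero_of_natDegree_lt (lt_of_le_of_lt (lag_natDegree α N) hj')]; simp

lemma OmegaL_no_root (α : ℝ) (hc : ∀ n, poch (α+1) n ≠ 0) (F1 F2 : Finset ℕ) (hk : 0 < F1.card + F2.card)
    (h : IsAdmissible (α+1) F1 F2) (x : ℝ) (hx : 0 < x) : (OmegaL α F1 F2).eval x ≠ 0 := by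
  intro h0
  have hO := OmegaL_ne α hc F1 F2
  have h1 : ∀ m, (X - C x)^((OmegaL α F1 F2).rootMultiplicity x) ∣ lagP α F1 F2 (lag α m) := by
    intro m
    by_cases hm : m ∈ F1
    · rw [lagP_mem α F1 F2 m hm]; exact dvd_zero _
    · exact dvd_of_int _ _ hO x _ hx (int_exc α hc F1 F2 hk h m hm)
  have h2 := abel_dvd α hc F1 F2 hk _ (fun p => dvd_all α F1 F2 _ h1 (p.natDegree + 1) p
    fun j hj => coeff_eq_zero_of_natDegree_lt (by omega))
  rw [dvd_add_left (Dvd.dvd.mul_left (pow_rootMultiplicity_dvd _ _) _)] at h2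
  exact not_dvd_derivative _ _ hO h0 h2

/-- The norm formula (Corollary 6.4): if `α + 1` and `𝓕` are admissible then for every
`n ∈ σ_𝓕`, `∫₀^∞ (L_n^{α;𝓕}(x))² x^{α+k} e^{-x}/(Ω_𝓕^α(x))² dx =
𝒫_𝓕(n-u_𝓕) Γ(n-u_𝓕+α+1)/(n-u_𝓕)!`, where
`𝒫_𝓕(t) = ∏_{f∈F₁}(t-f) ∏_{f∈F₂}(t+α+f+1)`. -/
theorem laguerre_exceptional_norm (α : ℝ) (hα : ∀ n : ℕ, α ≠ -((n : ℝ) + 1))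
    (F1 F2 : Finset ℕ) (hF1 : ∀ f ∈ F1, 0 < f) (hF2 : ∀ f ∈ F2, 0 < f)
    (hne : F1.Nonempty ∨ F2.Nonempty)
    (hadm : IsAdmissible (α + 1) F1 F2)
    (n : ℕ) (hn : n ∈ sigmaF F1 F2) :
    ∫ x in Set.Ioi (0 : ℝ),
        ((lagExc α F1 F2 n).eval x) ^ 2 *
          (x ^ (α + ((F1.card + F2.card : ℕ) : ℝ)) * Real.exp (-x) /
            ((OmegaL α F1 F2).eval x) ^ 2) =
      (∏ f ∈ F1, (((n - uF F1 F2 : ℕ) : ℝ) - (f : ℝ))) *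
        (∏ f ∈ F2, (((n - uF F1 F2 : ℕ) : ℝ) + α + (f : ℝ) + 1)) *
        Real.Gamma (((n - uF F1 F2 : ℕ) : ℝ) + α + 1) /
        (Nat.factorial (n - uF F1 F2) : ℝ) := by
  have hc : ∀ n, poch (α+1) n ≠ 0 := fun N => Finset.prod_ne_zero_iff.mpr fun i _ hi =>
    hα i (by linarith)
  have hk : 0 < F1.card + F2.card := by
    rcases hne with h | h
    · have := h.card_pos; omega
    · have := h.card_pos; omega
  have hck := c_add_k_pos (α+1) hc F1 F2 hadm
  rw [lagExc_eq, norm_formula α hc F1 F2 (by linarith) (OmegaL_no_root α hc F1 F2 hk hadm), prod_lamF, mul_div_assoc]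
  congr 2
  refine Finset.prod_congr rfl fun f _ => ?_
  ring
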